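/- In the level two walled Brauer-Clifford superalgebra BC_{2,r,t} over ℂ, the monomials m = d_1^{−1} c^α x'^β e^f x̄'^{β̄} c̄^{ᾱ} w d_2, with α, β ∈ (ℤ/2)^r, ᾱ, β̄ ∈ (ℤ/2)^t, 0 ≤ f ≤ min{r,t}, d_1, d_2 ∈ D^f_{r,t} and w ∈ Σ_{r−f} × Σ_{t−f}, are ℂ-linearly independent; here c^α = ∏_{i=1}^r c_i^{α_i}, c̄^{ᾱ} = ∏_{i=1}^t c̄_i^{ᾱ_i}, x'^β = x'_r{}^{β_r} ⋯ x'_1{}^{β_1} and x̄'^{β̄} = x̄'_t{}^{β̄_t} ⋯ x̄'_1{}^{β̄_1}. -/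

import Mathlib

open Polynomial

noncomputable section

/-- Transposition `(a b)` (0-based indices) in the symmetric group on `Fin n`;
it is `1` if an index is out of range. -/
def sw (n a b : ℕ) : Equiv.Perm (Fin n) :=
  if h : a < n ∧ b < n then Equiv.swap ⟨a, h.1⟩ ⟨b, h.2⟩ else 1

/-- The permutation word `s_{i,j}` of the paper (1-based indices):
`s_{i,j} = s_i s_{i+1,j}` for `i < j`, `s_{i,i} = 1`, `s_{i,j} = s_{i,j+1} s_j` for `i > j`. -/
def sIJ (n i j : ℕ) : Equiv.Perm (Fin n) :=
  if i < j then ((List.range' i (j - i)).map (fun k => sw n (k - 1) k)).prod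
  else ((List.range' j (i - j)).reverse.map (fun k => sw n (k - 1) k)).prod

/-- The coefficients `a_{2n+1,j}` of the paper: `acoef ω n j = a_{2n+1,j}`, defined by the
recursion `a_{1,0} = -1`, `a_{2n+1,j+1} = a_{2n-1,j}` and
`a_{2n+1,0} = ∑_{j=0}^{n-1} a_{2n-1,j} ω_{2j+1}`. -/
def acoef {A : Type} [Ring A] (ω : ℕ → A) : ℕ → ℕ → A
  | 0, _ => -1
  | n + 1, 0 => ∑ j ∈ Finset.range (n + 1), acoef ω n j * ω (2 * j + 1)
  | n + 1, j + 1 => acoef ω n j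

/-- The parameters `ω̄_k` determined by the parameters `ω` as in Corollary 3.5:
`ω̄_{2n} = 0` and `ω̄_{2n+1} = ∑_{j=0}^{n} a_{2n+1,j} ω_{2j+1}`. -/
def obar {R : Type} [CommRing R] (ω : ℕ → R) (k : ℕ) : R :=
  if k % 2 = 0 then 0
  else ∑ j ∈ Finset.range (k / 2 + 1), acoef ω (k / 2) j * ω (2 * j + 1)

/-- Data for the presentation of the walled Brauer–Clifford superalgebra `BC_{r,t}`
(Definition 2.1 together with relations (2.1)–(2.3)) on an `R`-algebra `A`.
The images of the two symmetric groups are recorded as monoid homomorphisms, so the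
symmetric group relations among the `s_i` (resp. `s̄_j`) hold automatically. -/
structure WBC (R A : Type) [CommRing R] [Ring A] [Algebra R A] (r t : ℕ) : Type where
  σ : Equiv.Perm (Fin r) →* A
  σb : Equiv.Perm (Fin t) →* A
  c : Fin r → A
  cb : Fin t → A
  e : A
  c_sq : ∀ i, c i * c i = -1
  c_anti : ∀ i j, i ≠ j → c i * c j = -(c j * c i)
  c_conj : ∀ w i, σ w * c i * σ (w⁻¹) = c (w i)
  cb_sq : ∀ i, cb i * cb i = 1
  cb_anti : ∀ i j, i ≠ j → cb i * cb j = -(cb j * cb i)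
  cb_conj : ∀ w i, σb w * cb i * σb (w⁻¹) = cb (w i)
  comm_σσb : ∀ w v, σ w * σb v = σb v * σ w
  comm_σcb : ∀ w j, σ w * cb j = cb j * σ w
  comm_σbc : ∀ v i, σb v * c i = c i * σb v
  anti_ccb : ∀ i j, c i * cb j = -(cb j * c i)
  e_c1 : ∀ (h1 : 0 < r) (h2 : 0 < t), e * c ⟨0, h1⟩ = e * cb ⟨0, h2⟩
  c1_e : ∀ (h1 : 0 < r) (h2 : 0 < t), c ⟨0, h1⟩ * e = cb ⟨0, h2⟩ * e
  e_sq : e * e = 0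
  e_s_e : 1 < r → e * σ (sw r 0 1) * e = e
  e_sb_e : 1 < t → e * σb (sw t 0 1) * e = e
  s_e_comm : ∀ i : ℕ, 0 < i → i + 1 < r → σ (sw r i (i + 1)) * e = e * σ (sw r i (i + 1))
  sb_e_comm : ∀ j : ℕ, 0 < j → j + 1 < t → σb (sw t j (j + 1)) * e = e * σb (sw t j (j + 1))
  braid1 : 1 < r → 1 < t →
    e * σ (sw r 0 1) * σb (sw t 0 1) * e * σ (sw r 0 1)
      = e * σ (sw r 0 1) * σb (sw t 0 1) * e * σb (sw t 0 1)
  braid2 : 1 < r → 1 < t →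
    σ (sw r 0 1) * e * σ (sw r 0 1) * σb (sw t 0 1) * e
      = σb (sw t 0 1) * e * σ (sw r 0 1) * σb (sw t 0 1) * e
  c_e_comm : ∀ i : Fin r, (i : ℕ) ≠ 0 → c i * e = e * c i
  cb_e_comm : ∀ j : Fin t, (j : ℕ) ≠ 0 → cb j * e = e * cb j
  e_c_e : ∀ h : 0 < r, e * c ⟨0, h⟩ * e = 0
  e_cb_e : ∀ h : 0 < t, e * cb ⟨0, h⟩ * e = 0

namespace WBC

variable {R A : Type} [CommRing R] [Ring A] [Algebra R A] {r t : ℕ}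

/-- The transposition `(i,j) ∈ Σ_r` (1-based indices). -/
def tr (d : WBC R A r t) (i j : ℕ) : A := d.σ (sw r (i - 1) (j - 1))

/-- The transposition `(ī,j̄) ∈ Σ_t` (1-based indices). -/
def trb (d : WBC R A r t) (i j : ℕ) : A := d.σb (sw t (i - 1) (j - 1))

/-- The generator `s_j = (j, j+1)` (1-based). -/
def s (d : WBC R A r t) (j : ℕ) : A := d.σ (sw r (j - 1) j)

/-- The generator `s̄_j` (1-based). -/
def sb (d : WBC R A r t) (j : ℕ) : A := d.σb (sw t (j - 1) j)

/-- The generator `c_i` (1-based). -/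
def cn (d : WBC R A r t) (i : ℕ) : A := if h : i - 1 < r then d.c ⟨i - 1, h⟩ else 0

/-- The generator `c̄_i` (1-based). -/
def cbn (d : WBC R A r t) (i : ℕ) : A := if h : i - 1 < t then d.cb ⟨i - 1, h⟩ else 0

/-- `e_{i,j} = (1̄,j̄)(1,i) e_1 (1,i)(1̄,j̄)` (1-based). -/
def E (d : WBC R A r t) (i j : ℕ) : A := d.trb 1 j * d.tr 1 i * d.e * d.tr 1 i * d.trb 1 j

/-- `ē_{i,j} = c_i e_{i,j} c_i`. -/
def Eb (d : WBC R A r t) (i j : ℕ) : A := d.cn i * d.E i j * d.cn i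

/-- `L'_i = ∑_{j=1}^{i-1} (j,i)`. -/
def LL (d : WBC R A r t) (i : ℕ) : A := ∑ j ∈ Finset.Ico 1 i, d.tr j i

/-- The Jucys–Murphy element `L_i = L'_i + c_i L'_i c_i`. -/
def L (d : WBC R A r t) (i : ℕ) : A := d.LL i + d.cn i * d.LL i * d.cn i

/-- `L̄'_i = ∑_{j=1}^{i-1} (j̄,ī)`. -/
def LLb (d : WBC R A r t) (i : ℕ) : A := ∑ j ∈ Finset.Ico 1 i, d.trb j i

/-- The Jucys–Murphy element `L̄_i = L̄'_i - c̄_i L̄'_i c̄_i`. -/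
def Lb (d : WBC R A r t) (i : ℕ) : A := d.LLb i - d.cbn i * d.LLb i * d.cbn i

/-- `y_i = ∑_{j=1}^{i-1} (e_{i,j} + ē_{i,j}) - L_i`. -/
def y (d : WBC R A r t) (i : ℕ) : A := (∑ j ∈ Finset.Ico 1 i, (d.E i j + d.Eb i j)) - d.L i

/-- `ȳ_i = ∑_{j=1}^{i-1} (e_{j,i} - ē_{j,i}) - L̄_i`. -/
def yb (d : WBC R A r t) (i : ℕ) : A := (∑ j ∈ Finset.Ico 1 i, (d.E j i - d.Eb j i)) - d.Lb i

/-- `c^α = c_1^{α_1} ⋯ c_r^{α_r}`. -/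
def cpow (d : WBC R A r t) (α : Fin r → Fin 2) : A :=
  ((List.finRange r).map (fun i => d.c i ^ (α i : ℕ))).prod

/-- `c̄^β = c̄_1^{β_1} ⋯ c̄_t^{β_t}`. -/
def cbpow (d : WBC R A r t) (β : Fin t → Fin 2) : A :=
  ((List.finRange t).map (fun j => d.cb j ^ (β j : ℕ))).prod

/-- `e^f = e_1 e_2 ⋯ e_f`. -/
def epow (d : WBC R A r t) (f : ℕ) : A :=
  ((List.range f).map (fun i => d.E (i + 1) (i + 1))).prod

/-- Generators of the subalgebra `BC_{m,m}`: the elements `e_1`, `s_1, …, s_{m-1}`,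
`s̄_1, …, s̄_{m-1}`, `c_1` and `c̄_1` (interpreted as `∅` when `m = 0`). -/
def lowerGens (d : WBC R A r t) (m : ℕ) : Set A :=
  {x | (1 ≤ m ∧ x = d.e) ∨ (∃ j : ℕ, 1 ≤ j ∧ j + 1 ≤ m ∧ x = d.s j)
    ∨ (∃ j : ℕ, 1 ≤ j ∧ j + 1 ≤ m ∧ x = d.sb j)
    ∨ (1 ≤ m ∧ x = d.cn 1) ∨ (1 ≤ m ∧ x = d.cbn 1)}

end WBC

/-- `φ` intertwines two sets of walled Brauer–Clifford data. -/
structure WBCHom {R A B : Type} [CommRing R] [Ring A] [Algebra R A] [Ring B] [Algebra R B]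
    {r t : ℕ} (d : WBC R A r t) (d' : WBC R B r t) (φ : A →ₐ[R] B) : Prop where
  map_σ : ∀ w, φ (d.σ w) = d'.σ w
  map_σb : ∀ w, φ (d.σb w) = d'.σb w
  map_c : ∀ i, φ (d.c i) = d'.c i
  map_cb : ∀ j, φ (d.cb j) = d'.cb j
  map_e : φ d.e = d'.e

/-- `A` (with the data `d`) *is* the walled Brauer–Clifford superalgebra `BC_{r,t}`:
it is initial among all algebras with such data. -/
def WBC.IsUniversal {R A : Type} [CommRing R] [Ring A] [Algebra R A] {r t : ℕ}
    (d : WBC R A r t) : Prop :=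
  ∀ (B : Type) [Ring B] [Algebra R B], ∀ d' : WBC R B r t, ∃! φ : A →ₐ[R] B, WBCHom d d' φ

/-- An element of `D^f_{r,t}`: data `1 ≤ i_1 < ⋯ < i_f ≤ r` and `k ≤ j_k ≤ t`
(all 1-based) describing `s_{f,i_f} s̄_{f,j_f} ⋯ s_{1,i_1} s̄_{1,j_1}`. -/
structure DElt (r t f : ℕ) : Type where
  a : Fin f → ℕ
  b : Fin f → ℕ
  ha_mono : StrictMono a
  ha_lb : ∀ k, 1 ≤ a k
  ha_ub : ∀ k, a k ≤ r
  hb_lb : ∀ k : Fin f, (k : ℕ) + 1 ≤ b k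
  hb_ub : ∀ k, b k ≤ t

/-- The `Σ_r`-component `s_{f,i_f} ⋯ s_{1,i_1}` of the element of `D^f_{r,t}`. -/
def DElt.pr {r t f : ℕ} (x : DElt r t f) : Equiv.Perm (Fin r) :=
  ((List.finRange f).reverse.map (fun (k : Fin f) => sIJ r ((k : ℕ) + 1) (x.a k))).prod

/-- The `Σ_t`-component `s̄_{f,j_f} ⋯ s̄_{1,j_1}` of the element of `D^f_{r,t}`. -/
def DElt.pt {r t f : ℕ} (x : DElt r t f) : Equiv.Perm (Fin t) :=
  ((List.finRange f).reverse.map (fun (k : Fin f) => sIJ t ((k : ℕ) + 1) (x.b k))).prod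

/-- Index for the basis `{c^α d_1⁻¹ e^f w d_2 c̄^β}` of `BC_{r,t}`; the component
`w ∈ Σ_{r-f} × Σ_{t-f}` is a pair of permutations fixing `1, …, f` pointwise. -/
structure BCIndex (r t : ℕ) : Type where
  α : Fin r → Fin 2
  β : Fin t → Fin 2
  f : ℕ
  hf : f ≤ min r t
  d1 : DElt r t f
  d2 : DElt r t f
  w : Equiv.Perm (Fin r)
  wb : Equiv.Perm (Fin t)
  hw : ∀ i : Fin r, (i : ℕ) < f → w i = i
  hwb : ∀ j : Fin t, (j : ℕ) < f → wb j = j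

/-- The basis element `c^α d_1⁻¹ e^f w d_2 c̄^β` of Theorem 2.4. -/
def WBC.basElt {R A : Type} [CommRing R] [Ring A] [Algebra R A] {r t : ℕ}
    (d : WBC R A r t) (x : BCIndex r t) : A :=
  d.cpow x.α * d.σ (x.d1.pr⁻¹) * d.σb (x.d1.pt⁻¹) * d.epow x.f *
    d.σ x.w * d.σb x.wb * d.σ x.d2.pr * d.σb x.d2.pt * d.cbpow x.β

/-- Data for the presentation of the affine walled Brauer–Clifford superalgebra
`BC^aff_{r,t}` (Definition 3.1) with distinguished parameter `ω_1 ∈ R`.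
`om k` is `ω_k` (with `ω_1` the scalar `ω1` and `ω_{2k} = 0`), `omb k` is `ω̄_k`. -/
structure AWBC (R A : Type) [CommRing R] [Ring A] [Algebra R A] (r t : ℕ) (ω1 : R)
    extends WBC R A r t : Type where
  x1 : A
  xb1 : A
  om : ℕ → A
  omb : ℕ → A
  om_one : om 1 = algebraMap R A ω1
  om_even : ∀ k, om (2 * k) = 0
  omb_zero : omb 0 = 0
  om_comm : ∀ k, (∀ w, om k * σ w = σ w * om k) ∧ (∀ w, om k * σb w = σb w * om k) ∧
    (∀ i, om k * c i = c i * om k) ∧ (∀ j, om k * cb j = cb j * om k) ∧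
    om k * e = e * om k ∧ om k * x1 = x1 * om k ∧ om k * xb1 = xb1 * om k ∧
    (∀ l, om k * om l = om l * om k) ∧ (∀ l, om k * omb l = omb l * om k)
  omb_comm : ∀ k, (∀ w, omb k * σ w = σ w * omb k) ∧ (∀ w, omb k * σb w = σb w * omb k) ∧
    (∀ i, omb k * c i = c i * omb k) ∧ (∀ j, omb k * cb j = cb j * omb k) ∧
    omb k * e = e * omb k ∧ omb k * x1 = x1 * omb k ∧ omb k * xb1 = xb1 * omb k ∧
    (∀ l, omb k * omb l = omb l * omb k)
  x_comm : ∀ h : 1 < r, x1 * (σ (sw r 0 1) * x1 * σ (sw r 0 1)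
      - (1 - c ⟨0, by omega⟩ * c ⟨1, h⟩) * σ (sw r 0 1))
    = (σ (sw r 0 1) * x1 * σ (sw r 0 1)
      - (1 - c ⟨0, by omega⟩ * c ⟨1, h⟩) * σ (sw r 0 1)) * x1
  x1_c1 : ∀ h : 0 < r, x1 * c ⟨0, h⟩ = -(c ⟨0, h⟩ * x1)
  x1_c : ∀ i : Fin r, (i : ℕ) ≠ 0 → x1 * c i = c i * x1
  s_x1 : ∀ i : ℕ, 0 < i → i + 1 < r → σ (sw r i (i + 1)) * x1 = x1 * σ (sw r i (i + 1))
  xb_comm : ∀ h : 1 < t, xb1 * (σb (sw t 0 1) * xb1 * σb (sw t 0 1)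
      - (1 + cb ⟨0, by omega⟩ * cb ⟨1, h⟩) * σb (sw t 0 1))
    = (σb (sw t 0 1) * xb1 * σb (sw t 0 1)
      - (1 + cb ⟨0, by omega⟩ * cb ⟨1, h⟩) * σb (sw t 0 1)) * xb1
  xb1_cb1 : ∀ h : 0 < t, xb1 * cb ⟨0, h⟩ = -(cb ⟨0, h⟩ * xb1)
  xb1_cb : ∀ j : Fin t, (j : ℕ) ≠ 0 → xb1 * cb j = cb j * xb1
  sb_xb1 : ∀ j : ℕ, 0 < j → j + 1 < t → σb (sw t j (j + 1)) * xb1 = xb1 * σb (sw t j (j + 1))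
  e_xsum : e * (x1 + xb1) = 0
  xsum_e : (x1 + xb1) * e = 0
  e_sxs : 1 < r → e * (σ (sw r 0 1) * x1 * σ (sw r 0 1)) = (σ (sw r 0 1) * x1 * σ (sw r 0 1)) * e
  x_mixed : ∀ h : 0 < r, x1 * (e + xb1 - c ⟨0, h⟩ * e * c ⟨0, h⟩)
      = (e - c ⟨0, h⟩ * e * c ⟨0, h⟩ + xb1) * x1
  e_sbxbsb : 1 < t →
    e * (σb (sw t 0 1) * xb1 * σb (sw t 0 1)) = (σb (sw t 0 1) * xb1 * σb (sw t 0 1)) * e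
  e_xodd : ∀ k : ℕ, e * x1 ^ (2 * k + 1) * e = om (2 * k + 1) * e
  e_xeven : ∀ k : ℕ, 1 ≤ k → e * x1 ^ (2 * k) * e = 0
  e_xb : ∀ k : ℕ, 1 ≤ k → e * xb1 ^ k * e = omb k * e
  x1_cb_comm : ∀ j, x1 * cb j = cb j * x1
  xb1_c_comm : ∀ i, xb1 * c i = c i * xb1
  x1_σb : ∀ w, σb w * x1 = x1 * σb w
  xb1_σ : ∀ w, σ w * xb1 = xb1 * σ w

namespace AWBC

variable {R A : Type} [CommRing R] [Ring A] [Algebra R A] {r t : ℕ} {ω1 : R}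

/-- `x'_i = s_{i-1} ⋯ s_1 x_1 s_1 ⋯ s_{i-1}` (1-based). -/
def xp (d : AWBC R A r t ω1) (i : ℕ) : A :=
  ((List.range (i - 1)).reverse.map (fun k => d.toWBC.s (k + 1))).prod * d.x1 *
    ((List.range (i - 1)).map (fun k => d.toWBC.s (k + 1))).prod

/-- `x̄'_j = s̄_{j-1} ⋯ s̄_1 x̄_1 s̄_1 ⋯ s̄_{j-1}` (1-based). -/
def xbp (d : AWBC R A r t ω1) (j : ℕ) : A :=
  ((List.range (j - 1)).reverse.map (fun k => d.toWBC.sb (k + 1))).prod * d.xb1 *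
    ((List.range (j - 1)).map (fun k => d.toWBC.sb (k + 1))).prod

/-- `x_i = x'_i - L_i`. -/
def xv (d : AWBC R A r t ω1) (i : ℕ) : A := d.xp i - d.toWBC.L i

/-- `x̄_j = x̄'_j - L̄_j`. -/
def xbv (d : AWBC R A r t ω1) (j : ℕ) : A := d.xbp j - d.toWBC.Lb j

/-- `x^α = x_1^{α_1} ⋯ x_r^{α_r}`. -/
def xpow (d : AWBC R A r t ω1) (α : Fin r → ℕ) : A :=
  ((List.finRange r).map (fun (i : Fin r) => d.xv ((i : ℕ) + 1) ^ α i)).prod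

/-- `x̄^β = x̄_1^{β_1} ⋯ x̄_t^{β_t}`. -/
def xbpow (d : AWBC R A r t ω1) (β : Fin t → ℕ) : A :=
  ((List.finRange t).map (fun (j : Fin t) => d.xbv ((j : ℕ) + 1) ^ β j)).prod

/-- `∏_{n ∈ ℤ^{>0}} ω_{2n+1}^{a_{2n+1}}`, where `g i` is the exponent of `ω_{2(i+1)+1}`. -/
def ompow (d : AWBC R A r t ω1) (g : ℕ →₀ ℕ) : A :=
  ((g.support.sort (· ≤ ·)).map (fun n => d.om (2 * n + 3) ^ g n)).prod

/-- `z_i = x'_i + y_i`. -/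
def z (d : AWBC R A r t ω1) (i : ℕ) : A := d.xp i + d.toWBC.y i

/-- `z̄_j = x̄'_j + ȳ_j`. -/
def zb (d : AWBC R A r t ω1) (j : ℕ) : A := d.xbp j + d.toWBC.yb j

/-- Generators of the subalgebra `BC_{2,m,m}`-type subalgebra:
`e_1, s_1, …, s_{m-1}, s̄_1, …, s̄_{m-1}, c_1, c̄_1, x_1, x̄_1`. -/
def lowerGensA (d : AWBC R A r t ω1) (m : ℕ) : Set A :=
  d.toWBC.lowerGens m ∪ {x | 1 ≤ m ∧ (x = d.x1 ∨ x = d.xb1)}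

end AWBC

/-- `φ` intertwines two sets of affine walled Brauer–Clifford data. -/
structure AWBCHom {R A B : Type} [CommRing R] [Ring A] [Algebra R A] [Ring B] [Algebra R B]
    {r t : ℕ} {ω1 : R} (d : AWBC R A r t ω1) (d' : AWBC R B r t ω1) (φ : A →ₐ[R] B) : Prop where
  map_σ : ∀ w, φ (d.σ w) = d'.σ w
  map_σb : ∀ w, φ (d.σb w) = d'.σb w
  map_c : ∀ i, φ (d.c i) = d'.c i
  map_cb : ∀ j, φ (d.cb j) = d'.cb j
  map_e : φ d.e = d'.e
  map_x1 : φ d.x1 = d'.x1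
  map_xb1 : φ d.xb1 = d'.xb1
  map_om : ∀ k, φ (d.om k) = d'.om k
  map_omb : ∀ k, φ (d.omb k) = d'.omb k

/-- `A` (with the data `d`) is the affine walled Brauer–Clifford superalgebra
`BC^aff_{r,t}` of Definition 3.1. -/
def AWBC.IsUniversal {R A : Type} [CommRing R] [Ring A] [Algebra R A] {r t : ℕ} {ω1 : R}
    (d : AWBC R A r t ω1) : Prop :=
  ∀ (B : Type) [Ring B] [Algebra R B], ∀ d' : AWBC R B r t ω1,
    ∃! φ : A →ₐ[R] B, AWBCHom d d' φ

/-- Assumption 3.6: the parameters `ω̄` are determined by the `ω`'s as in Corollary 3.5. -/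
def AWBC.Ass36 {R A : Type} [CommRing R] [Ring A] [Algebra R A] {r t : ℕ} {ω1 : R}
    (d : AWBC R A r t ω1) : Prop :=
  (∀ n, d.omb (2 * n) = 0) ∧
  (∀ n, d.omb (2 * n + 1) = ∑ j ∈ Finset.range (n + 1), acoef d.om n j * d.om (2 * j + 1))

/-- `A` (with the data `d`) is the affine walled Brauer–Clifford superalgebra
`BC^aff_{r,t}` subject to Assumption 3.6. -/
def AWBC.IsUniversal36 {R A : Type} [CommRing R] [Ring A] [Algebra R A] {r t : ℕ} {ω1 : R}
    (d : AWBC R A r t ω1) : Prop :=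
  d.Ass36 ∧ ∀ (B : Type) [Ring B] [Algebra R B], ∀ d' : AWBC R B r t ω1,
    d'.Ass36 → ∃! φ : A →ₐ[R] B, AWBCHom d d' φ

/-- The parameters `ω_k`, `ω̄_k` are the scalars `ω k`, `obar ω k` (specialization defining
the algebra `B̃C_{r,t}` of Definition 3.13). -/
def AWBC.IsSpec {R A : Type} [CommRing R] [Ring A] [Algebra R A] {r t : ℕ} {ω1 : R}
    (d : AWBC R A r t ω1) (ω : ℕ → R) : Prop :=
  (∀ k, d.om k = algebraMap R A (ω k)) ∧ (∀ k, 1 ≤ k → d.omb k = algebraMap R A (obar ω k))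

/-- `A` (with the data `d`) is the algebra `B̃C_{r,t}` of Definition 3.13 with parameters
`ω_{2n+1} ∈ R`. -/
def AWBC.IsSpecUniversal {R A : Type} [CommRing R] [Ring A] [Algebra R A] {r t : ℕ} {ω1 : R}
    (d : AWBC R A r t ω1) (ω : ℕ → R) : Prop :=
  d.IsSpec ω ∧ ∀ (B : Type) [Ring B] [Algebra R B], ∀ d' : AWBC R B r t ω1,
    d'.IsSpec ω → ∃! φ : A →ₐ[R] B, AWBCHom d d' φ

/-- The cyclotomic relations `f(x_1) = 0` and `g(x̄_1) = 0`. -/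
def AWBC.IsCyc {R A : Type} [CommRing R] [Ring A] [Algebra R A] {r t : ℕ} {ω1 : R}
    (d : AWBC R A r t ω1) (f g : Polynomial R) : Prop :=
  Polynomial.aeval d.x1 f = 0 ∧ Polynomial.aeval d.xb1 g = 0

/-- `A` (with the data `d`) is the cyclotomic walled Brauer–Clifford superalgebra
`BC_{ℓ,r,t}` of Definition 3.14 attached to `f`, `g` and the scalar parameters `ω`. -/
def AWBC.IsCycUniversal {R A : Type} [CommRing R] [Ring A] [Algebra R A] {r t : ℕ} {ω1 : R}
    (d : AWBC R A r t ω1) (ω : ℕ → R) (f g : Polynomial R) : Prop :=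
  d.IsSpec ω ∧ d.IsCyc f g ∧ ∀ (B : Type) [Ring B] [Algebra R B], ∀ d' : AWBC R B r t ω1,
    d'.IsSpec ω → d'.IsCyc f g → ∃! φ : A →ₐ[R] B, AWBCHom d d' φ

/-- Index of a regular monomial `x^α d x̄^β ∏_{n≥1} ω_{2n+1}^{a_{2n+1}}` of `BC^aff_{r,t}`. -/
structure ARIndex (r t : ℕ) : Type where
  α : Fin r → ℕ
  β : Fin t → ℕ
  dIdx : BCIndex r t
  g : ℕ →₀ ℕ

/-- The regular monomial `x^α d x̄^β ∏_{n≥1} ω_{2n+1}^{a_{2n+1}}` of Definition 3.11. -/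
def AWBC.regElt {R A : Type} [CommRing R] [Ring A] [Algebra R A] {r t : ℕ} {ω1 : R}
    (d : AWBC R A r t ω1) (x : ARIndex r t) : A :=
  d.xpow x.α * d.toWBC.basElt x.dIdx * d.xbpow x.β * d.ompow x.g

/-- Index of a regular monomial `x^α d x̄^β` of `B̃C_{r,t}`. -/
structure SIndex (r t : ℕ) : Type where
  α : Fin r → ℕ
  β : Fin t → ℕ
  dIdx : BCIndex r t

/-- The regular monomial `x^α d x̄^β` of `B̃C_{r,t}`. -/
def AWBC.sregElt {R A : Type} [CommRing R] [Ring A] [Algebra R A] {r t : ℕ} {ω1 : R}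
    (d : AWBC R A r t ω1) (x : SIndex r t) : A :=
  d.xpow x.α * d.toWBC.basElt x.dIdx * d.xbpow x.β

/-- Index of a regular monomial `x^α d x̄^β` of the level `ℓ` algebra `BC_{ℓ,r,t}`,
with exponents in `{0, 1, …, ℓ-1}`. -/
structure CIndex (r t ℓ : ℕ) : Type where
  α : Fin r → Fin ℓ
  β : Fin t → Fin ℓ
  dIdx : BCIndex r t

/-- The regular monomial `x^α d x̄^β` of `BC_{ℓ,r,t}`. -/
def AWBC.cregElt {R A : Type} [CommRing R] [Ring A] [Algebra R A] {r t ℓ : ℕ} {ω1 : R}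
    (d : AWBC R A r t ω1) (x : CIndex r t ℓ) : A :=
  d.xpow (fun i => (x.α i : ℕ)) * d.toWBC.basElt x.dIdx * d.xbpow (fun j => (x.β j : ℕ))

/-- Admissibility (Definition 6.4): writing `f(x) = x^{k+2m} + ∑_{i=1}^{2m} a_i x^{k+2m-i}`,
one has `ω_L = -(a_1 ω_{L-1} + ⋯ + a_{2m} ω_{L-2m})` for all `L ≥ k + 2m`. -/
def AdmissibleParam {R : Type} [CommRing R] (ω : ℕ → R) (f : Polynomial R) (k m : ℕ) : Prop :=
  ∀ L, k + 2 * m ≤ L →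
    ω L = -∑ i ∈ Finset.Icc 1 (2 * m), f.coeff (k + 2 * m - i) * ω (L - i)

/-- The parameters `ω_0 = 0`, `ω_1 = -2m(2p-2m+1)`, `ω_i = p(p+1) ω_{i-2}` of (4.16). -/
def omSeq (m : ℕ) (p : ℂ) : ℕ → ℂ
  | 0 => 0
  | 1 => -2 * (m : ℂ) * (2 * p - 2 * (m : ℂ) + 1)
  | n + 2 => p * (p + 1) * omSeq m p n

/-- Index of a monomial `d_1^{-1} c^α x'^β e^f x̄'^{β̄} c̄^{ᾱ} w d_2` of (4.20). -/
structure L2Index (r t : ℕ) : Type where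
  α : Fin r → Fin 2
  βx : Fin r → Fin 2
  αb : Fin t → Fin 2
  βxb : Fin t → Fin 2
  f : ℕ
  hf : f ≤ min r t
  d1 : DElt r t f
  d2 : DElt r t f
  w : Equiv.Perm (Fin r)
  wb : Equiv.Perm (Fin t)
  hw : ∀ i : Fin r, (i : ℕ) < f → w i = i
  hwb : ∀ j : Fin t, (j : ℕ) < f → wb j = j

/-- The monomial `d_1^{-1} c^α x'^β e^f x̄'^{β̄} c̄^{ᾱ} w d_2` of (4.20), where
`x'^β = x'_r{}^{β_r} ⋯ x'_1{}^{β_1}` and `x̄'^{β̄} = x̄'_t{}^{β̄_t} ⋯ x̄'_1{}^{β̄_1}`. -/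
def AWBC.l2Elt {R A : Type} [CommRing R] [Ring A] [Algebra R A] {r t : ℕ} {ω1 : R}
    (d : AWBC R A r t ω1) (x : L2Index r t) : A :=
  d.toWBC.σ (x.d1.pr⁻¹) * d.toWBC.σb (x.d1.pt⁻¹) * d.toWBC.cpow x.α *
    ((List.finRange r).reverse.map (fun (i : Fin r) => d.xp ((i : ℕ) + 1) ^ (x.βx i : ℕ))).prod *
    d.toWBC.epow x.f *
    ((List.finRange t).reverse.map (fun (j : Fin t) => d.xbp ((j : ℕ) + 1) ^ (x.βxb j : ℕ))).prod *
    d.toWBC.cbpow x.αb *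
    d.toWBC.σ x.w * d.toWBC.σb x.wb * d.toWBC.σ x.d2.pr * d.toWBC.σb x.d2.pt


set_option linter.unusedSectionVars false
set_option linter.unusedVariables false
set_option linter.unusedSimpArgs false
namespace L2
open Equiv

section
/-- Sergeev type data without the mixed relation between the `x`'s. -/
structure PreSD (u : ℂ) (α : Type) [DecidableEq α] (A : Type) [Ring A] [Algebra ℂ A] where
  σ : Perm α →* A
  c : α → A
  x : α → A
  c_sq : ∀ i, c i * c i = -1
  c_anti : ∀ i j, i ≠ j → c i * c j = -(c j * c i)
  σc : ∀ w i, σ w * c i = c (w i) * σ w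
  σx : ∀ w i, σ w * x i = x (w i) * σ w
  xc_same : ∀ i, x i * c i = -(c i * x i)
  xc : ∀ i j, i ≠ j → x i * c j = c j * x i
  x_sq : ∀ i, x i * x i = algebraMap ℂ A u

section
variable {u : ℂ} {α : Type} [DecidableEq α] {A : Type} [Ring A] [Algebra ℂ A]

def PreSD.D (d : PreSD u α A) (i j : α) : A :=
  ((1 + d.c i * d.c j) * d.x i - (1 + d.c j * d.c i) * d.x j) * d.σ (swap i j)

/-- The defect of the mixed relation. -/
def PreSD.Δ (d : PreSD u α A) (i j : α) : A :=
  d.x i * d.x j - d.x j * d.x i - d.D i j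

theorem cl3 (a b c : A) (ha : a * a = -1) (hb : b * b = -1) (hab : a * b = -(b * a))
    (hac : a * c = -(c * a)) (hbc : b * c = -(c * b)) :
    (1 + a * b) * (1 + a * c) = (1 + b * c) * (1 + a * b) := by
  have h1 : a * b * (a * c) = b * c := by
    calc a * b * (a * c) = a * b * a * c := by noncomm_ring
      _ = -(b * a) * a * c := by rw [hab]
      _ = -(b * (a * a) * c) := by noncomm_ring
      _ = b * c := by rw [ha]; noncomm_ring
  have h2 : b * c * (a * b) = a * c := by
    calc b * c * (a * b) = b * (c * a) * b := by noncomm_ring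
      _ = b * (-(a * c)) * b := by rw [hac]; noncomm_ring
      _ = -(b * a) * (c * b) := by noncomm_ring
      _ = a * b * (c * b) := by rw [hab]
      _ = a * b * (-(b * c)) := by rw [hbc]; noncomm_ring
      _ = -(a * (b * b) * c) := by noncomm_ring
      _ = a * c := by rw [hb]; noncomm_ring
  have h3 : (1 + a * b) * (1 + a * c) = 1 + a * b + a * c + a * b * (a * c) := by noncomm_ring
  have h4 : (1 + b * c) * (1 + a * b) = 1 + a * b + b * c + b * c * (a * b) := by noncomm_ring
  rw [h3, h4, h1, h2]; abel

namespace PreSD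
variable (d : PreSD u α A)

theorem A3 {i j k : α} (hij : i ≠ j) (hik : i ≠ k) (hjk : j ≠ k) :
    (1 + d.c i * d.c j) * (1 + d.c i * d.c k) = (1 + d.c j * d.c k) * (1 + d.c i * d.c j) :=
  cl3 _ _ _ (d.c_sq i) (d.c_sq j) (d.c_anti _ _ hij) (d.c_anti _ _ hik) (d.c_anti _ _ hjk)

theorem σσ (w v : Perm α) : d.σ w * d.σ v = d.σ (w * v) := (map_mul _ _ _).symm

theorem ss (i j : α) : d.σ (swap i j) * d.σ (swap i j) = 1 := by
  rw [d.σσ, swap_mul_self, map_one]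

theorem σA (w : Perm α) (i j : α) :
    d.σ w * (1 + d.c i * d.c j) = (1 + d.c (w i) * d.c (w j)) * d.σ w := by
  rw [mul_add, add_mul, ← mul_assoc, d.σc, mul_assoc, d.σc]; simp [mul_assoc]

theorem σD (w : Perm α) (i j : α) : d.σ w * d.D i j = d.D (w i) (w j) * d.σ w := by
  unfold D
  have h : d.σ w * d.σ (swap i j) = d.σ (swap (w i) (w j)) * d.σ w := by
    rw [d.σσ, d.σσ, mul_swap_eq_swap_mul]
  calc _ = (d.σ w * (1 + d.c i * d.c j) * d.x i - d.σ w * (1 + d.c j * d.c i) * d.x j)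
        * d.σ (swap i j) := by noncomm_ring
    _ = ((1 + d.c (w i) * d.c (w j)) * (d.σ w * d.x i) -
          (1 + d.c (w j) * d.c (w i)) * (d.σ w * d.x j)) * d.σ (swap i j) := by
        rw [d.σA, d.σA]; noncomm_ring
    _ = ((1 + d.c (w i) * d.c (w j)) * d.x (w i) -
          (1 + d.c (w j) * d.c (w i)) * d.x (w j)) * (d.σ w * d.σ (swap i j)) := by
        rw [d.σx, d.σx]; noncomm_ring
    _ = _ := by rw [h]; noncomm_ring

theorem σΔ (w : Perm α) (i j : α) : d.σ w * d.Δ i j = d.Δ (w i) (w j) * d.σ w := by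
  unfold Δ
  linear_combination (norm := noncomm_ring) d.σx w i * d.x j + d.x (w i) * d.σx w j
    - d.σx w j * d.x i - d.x (w j) * d.σx w i - d.σD w i j

theorem D_symm (i j : α) : d.D j i = - d.D i j := by
  unfold D; rw [swap_comm j i]; noncomm_ring

theorem Δ_symm (i j : α) : d.Δ j i = - d.Δ i j := by
  unfold Δ; rw [d.D_symm i j]; noncomm_ring

theorem xA_comm {i j k : α} (hij : i ≠ j) (hik : i ≠ k) :
    d.x i * (1 + d.c j * d.c k) = (1 + d.c j * d.c k) * d.x i := by
  rw [mul_add, add_mul, ← mul_assoc, d.xc _ _ hij, mul_assoc, d.xc _ _ hik]; simp [mul_assoc]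

theorem xA_l {i j : α} (hij : i ≠ j) :
    d.x i * (1 + d.c i * d.c j) = (1 + d.c j * d.c i) * d.x i := by
  rw [mul_add, add_mul, ← mul_assoc, d.xc_same, d.c_anti j i hij.symm, neg_mul, mul_assoc,
    d.xc _ _ hij]; simp [mul_assoc]

theorem xA_r {i j : α} (hij : i ≠ j) :
    d.x i * (1 + d.c j * d.c i) = (1 + d.c i * d.c j) * d.x i := by
  rw [mul_add, add_mul, ← mul_assoc, d.xc _ _ hij, mul_assoc, d.xc_same,
    d.c_anti i j hij]; simp [mul_assoc]

theorem xD {i j : α} (hij : i ≠ j) : d.x i * d.D i j + d.D i j * d.x i = 0 := by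
  unfold D
  have h : d.σ (swap i j) * d.x i = d.x j * d.σ (swap i j) := by rw [d.σx]; simp
  have e1 : d.x i * (((1 + d.c i * d.c j) * d.x i - (1 + d.c j * d.c i) * d.x j) * d.σ (swap i j))
     = (d.x i * (1 + d.c i * d.c j) * d.x i - d.x i * (1 + d.c j * d.c i) * d.x j)
        * d.σ (swap i j) := by noncomm_ring
  have e2 : ((1 + d.c i * d.c j) * d.x i - (1 + d.c j * d.c i) * d.x j) * d.σ (swap i j) * d.x i
     = ((1 + d.c i * d.c j) * d.x i * d.x j - (1 + d.c j * d.c i) * (d.x j * d.x j))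
        * d.σ (swap i j) := by
    rw [mul_assoc _ _ (d.x i), h]; noncomm_ring
  rw [e1, e2, d.xA_l hij, d.xA_r hij, d.x_sq j, mul_assoc _ (d.x i) (d.x i), d.x_sq i]
  noncomm_ring

/-- relation of `Δ_{ok}` with `x_o` -/
theorem Δx {o k : α} (h : o ≠ k) : d.Δ o k * d.x o = - (d.x o * d.Δ o k) := by
  have := d.xD h
  have e : d.Δ o k * d.x o + d.x o * d.Δ o k =
    d.x o * d.x o * d.x k - d.x k * (d.x o * d.x o) - (d.x o * d.D o k + d.D o k * d.x o) := by
    unfold Δ; noncomm_ring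
  rw [this, d.x_sq, sub_zero, Algebra.commutes, sub_self] at e
  exact eq_neg_of_add_eq_zero_left e

theorem xDexp {o i k : α} (hoi : o ≠ i) (hok : o ≠ k) :
    d.x o * d.D i k - d.D i k * d.x o =
     ((1 + d.c i * d.c k) * (d.D o i + d.Δ o i) - (1 + d.c k * d.c i) * (d.D o k + d.Δ o k)) *
      d.σ (swap i k) := by
  have h : d.σ (swap i k) * d.x o = d.x o * d.σ (swap i k) := by
    rw [d.σx, swap_apply_of_ne_of_ne hoi hok]
  have e1 : d.D o i + d.Δ o i = d.x o * d.x i - d.x i * d.x o := by unfold Δ; abel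
  have e2 : d.D o k + d.Δ o k = d.x o * d.x k - d.x k * d.x o := by unfold Δ; abel
  rw [e1, e2]
  unfold D
  have e3 : ((1 + d.c i * d.c k) * d.x i - (1 + d.c k * d.c i) * d.x k) * d.σ (swap i k) * d.x o
   = ((1 + d.c i * d.c k) * d.x i - (1 + d.c k * d.c i) * d.x k) * d.x o * d.σ (swap i k) := by
    rw [mul_assoc _ _ (d.x o), h]; noncomm_ring
  rw [e3]
  have e4 : d.x o * (((1 + d.c i * d.c k) * d.x i - (1 + d.c k * d.c i) * d.x k) * d.σ (swap i k))
     = (d.x o * (1 + d.c i * d.c k) * d.x i - d.x o * (1 + d.c k * d.c i) * d.x k)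
        * d.σ (swap i k) := by noncomm_ring
  rw [e4, d.xA_comm hoi hok, d.xA_comm hok hoi]
  noncomm_ring

theorem swap3 {o i k : α} (hok : o ≠ k) (hik : i ≠ k) :
    swap o i * swap i k = swap o k * swap o i := by
  rw [mul_swap_eq_swap_mul (swap o i) i k, swap_apply_right,
      swap_apply_of_ne_of_ne hok.symm hik.symm]

theorem jacD {o i k : α} (hoi : o ≠ i) (hok : o ≠ k) (hik : i ≠ k) :
    ((1 + d.c i * d.c k) * d.D o i - (1 + d.c k * d.c i) * d.D o k) * d.σ (swap i k) +
    ((1 + d.c k * d.c o) * d.D i k - (1 + d.c o * d.c k) * d.D i o) * d.σ (swap k o) +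
    ((1 + d.c o * d.c i) * d.D k o - (1 + d.c i * d.c o) * d.D k i) * d.σ (swap o i) = 0 := by
  -- the six products fall into two three cycles
  set R := d.σ (swap o i * swap i k) with hR
  set S := d.σ (swap o k * swap k i) with hS
  have p1 : d.σ (swap o i) * d.σ (swap i k) = R := d.σσ _ _
  have p2 : d.σ (swap o k) * d.σ (swap i k) = S := by rw [swap_comm i k]; exact d.σσ _ _
  have p3 : d.σ (swap i k) * d.σ (swap k o) = R := by
    rw [d.σσ, hR, swap3 hoi.symm hok.symm, swap_comm i o]
  have p4 : d.σ (swap i o) * d.σ (swap k o) = S := by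
    rw [d.σσ, hS, swap3 hoi hik.symm, swap_comm k o, swap_comm i o]
  have p5 : d.σ (swap k o) * d.σ (swap o i) = R := by
    rw [d.σσ, hR, swap3 hok hik, swap_comm k o]
  have p6 : d.σ (swap k i) * d.σ (swap o i) = S := by
    rw [d.σσ, hS, swap_comm o i, swap3 hok.symm hoi.symm, swap_comm o k]
  have q1 := d.A3 hoi hok hik
  have q2 := d.A3 hok hoi hik.symm
  have q3 := d.A3 hoi.symm hik hok
  have q4 := d.A3 hik hoi.symm hok.symm
  have q5 := d.A3 hok.symm hik.symm hoi
  have q6 := d.A3 hik.symm hok.symm hoi.symm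
  unfold D
  generalize (1 + d.c o * d.c i) = Aoi at *
  generalize (1 + d.c i * d.c o) = Aio at *
  generalize (1 + d.c o * d.c k) = Aok at *
  generalize (1 + d.c k * d.c o) = Ako at *
  generalize (1 + d.c i * d.c k) = Aik at *
  generalize (1 + d.c k * d.c i) = Aki at *
  linear_combination (norm := noncomm_ring) (Aik * (Aoi * d.x o - Aio * d.x i)) * p1
    - Aki * (Aok * d.x o - Ako * d.x k) * p2 + Ako * (Aik * d.x i - Aki * d.x k) * p3
    - Aok * (Aio * d.x i - Aoi * d.x o) * p4 + Aoi * (Ako * d.x k - Aok * d.x o) * p5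
    - Aio * (Aki * d.x k - Aik * d.x i) * p6 - q1 * d.x o * R - q4 * d.x i * R - q5 * d.x k * R
    + q2 * d.x o * S + q6 * d.x k * S + q3 * d.x i * S

theorem jac {o i k : α} (hoi : o ≠ i) (hok : o ≠ k) (hik : i ≠ k) :
    d.Δ i k * d.x o + d.Δ k o * d.x i + d.Δ o i * d.x k =
    d.x o * d.Δ i k + d.x i * d.Δ k o + d.x k * d.Δ o i +
    ((1 + d.c i * d.c k) * d.Δ o i - (1 + d.c k * d.c i) * d.Δ o k) * d.σ (swap i k) +
    ((1 + d.c k * d.c o) * d.Δ i k - (1 + d.c o * d.c k) * d.Δ i o) * d.σ (swap k o) +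
    ((1 + d.c o * d.c i) * d.Δ k o - (1 + d.c i * d.c o) * d.Δ k i) * d.σ (swap o i) := by
  have h := d.jacD hoi hok hik
  have h1 := d.xDexp hoi hok
  have h2 := d.xDexp (o := i) (i := k) (k := o) hik hoi.symm
  have h3 := d.xDexp (o := k) (i := o) (k := i) hok.symm hik.symm
  have e1 : d.D o i + d.Δ o i = d.x o * d.x i - d.x i * d.x o := by unfold Δ; abel
  have e2 : d.D k o + d.Δ k o = d.x k * d.x o - d.x o * d.x k := by unfold Δ; abel
  have e3 : d.D i k + d.Δ i k = d.x i * d.x k - d.x k * d.x i := by unfold Δ; abel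
  linear_combination (norm := noncomm_ring) e3 * d.x o + e2 * d.x i + e1 * d.x k - d.x o * e3
    - d.x i * e2 - d.x k * e1 + h1 + h2 + h3 + h

theorem cD {i j : α} (hij : i ≠ j) : d.c i * d.D i j = - (d.D i j * d.c i) := by
  have h : d.σ (swap i j) * d.c i = d.c j * d.σ (swap i j) := by rw [d.σc]; simp
  have h1 := d.c_anti i j hij
  have h2 := d.c_sq i
  have h2' := d.c_sq j
  have h3 := d.xc_same j
  have h4 := d.xc i j hij
  have e1 : d.c i * (1 + d.c i * d.c j) = - ((1 + d.c i * d.c j) * d.c j) := by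
    linear_combination (norm := noncomm_ring) h2 * d.c j + d.c i * h2'
  have e2 : d.c i * (1 + d.c j * d.c i) = (1 + d.c j * d.c i) * d.c j := by
    linear_combination (norm := noncomm_ring) h1 * d.c i - d.c j * h2 - d.c j * h1 + h2' * d.c i
  unfold D
  generalize (1 + d.c i * d.c j) = Aij at *
  generalize (1 + d.c j * d.c i) = Aji at *
  linear_combination (norm := noncomm_ring) e1 * d.x i * d.σ (swap i j)
    - e2 * d.x j * d.σ (swap i j) + (Aij * d.x i - Aji * d.x j) * h + Aij * h4 * d.σ (swap i j)
    - Aji * h3 * d.σ (swap i j)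

theorem cD' {i j : α} (hij : i ≠ j) : d.c j * d.D i j = - (d.D i j * d.c j) := by
  rw [d.D_symm j i, mul_neg, d.cD hij.symm]; simp

theorem cA {i j l : α} (hi : l ≠ i) (hj : l ≠ j) :
    d.c l * (1 + d.c i * d.c j) = (1 + d.c i * d.c j) * d.c l := by
  linear_combination (norm := noncomm_ring) d.c_anti l i hi * d.c j - d.c i * d.c_anti l j hj

theorem cD_ne {i j l : α} (hi : l ≠ i) (hj : l ≠ j) : d.c l * d.D i j = d.D i j * d.c l := by
  have h : d.σ (swap i j) * d.c l = d.c l * d.σ (swap i j) := by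
    rw [d.σc, swap_apply_of_ne_of_ne hi hj]
  have e1 := d.cA hi hj
  have e2 := d.cA hj hi
  have h1 := d.xc i l hi.symm
  have h2 := d.xc j l hj.symm
  unfold D
  generalize (1 + d.c i * d.c j) = Aij at *
  generalize (1 + d.c j * d.c i) = Aji at *
  linear_combination (norm := noncomm_ring) e1 * d.x i * d.σ (swap i j)
    - e2 * d.x j * d.σ (swap i j) - (Aij * d.x i - Aji * d.x j) * h - Aij * h1 * d.σ (swap i j)
    + Aji * h2 * d.σ (swap i j)

theorem cΔ {i j : α} (hij : i ≠ j) (l : α) :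
    d.Δ i j * d.c l = d.c l * d.Δ i j ∨ d.Δ i j * d.c l = - (d.c l * d.Δ i j) := by
  unfold Δ
  by_cases hi : l = i
  · subst hi
    right
    linear_combination (norm := noncomm_ring) d.x l * d.xc j l hij.symm + d.xc_same l * d.x j
      - d.x j * d.xc_same l + d.xc j l hij.symm * d.x l - d.cD hij
  by_cases hj : l = j
  · subst hj
    right
    linear_combination (norm := noncomm_ring) d.x i * d.xc_same l - d.xc i l hij * d.x l
      - d.x l * d.xc i l hij - d.xc_same l * d.x i - d.cD' hij
  left
  linear_combination (norm := noncomm_ring) d.x i * d.xc j l (Ne.symm hj)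
   + d.xc i l (Ne.symm hi) * d.x j - d.x j * d.xc i l (Ne.symm hi)
   - d.xc j l (Ne.symm hj) * d.x i + d.cD_ne hi hj

end PreSD

/-- Sergeev type data. -/
structure SD (u : ℂ) (α : Type) [DecidableEq α] (A : Type) [Ring A] [Algebra ℂ A]
    extends PreSD u α A where
  xx : ∀ i j, i ≠ j → x i * x j = x j * x i + toPreSD.D i j

/-- generators of the algebra `U` -/
inductive Gen (α : Type) : Type
  | s (w : Perm α) : Gen α
  | c (i : α) : Gen α
  | x (i : α) : Gen α

section
variable (α u)
def fs (w : Perm α) : FreeAlgebra ℂ (Gen α) := FreeAlgebra.ι ℂ (Gen.s w)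
def fc (i : α) : FreeAlgebra ℂ (Gen α) := FreeAlgebra.ι ℂ (Gen.c i)
def fx (i : α) : FreeAlgebra ℂ (Gen α) := FreeAlgebra.ι ℂ (Gen.x i)
end

inductive Rel (u : ℂ) (α : Type) [DecidableEq α] :
    FreeAlgebra ℂ (Gen α) → FreeAlgebra ℂ (Gen α) → Prop
  | one : Rel u α (fs α 1) 1
  | mul (w v) : Rel u α (fs α (w * v)) (fs α w * fs α v)
  | c_sq (i) : Rel u α (fc α i * fc α i) (-1)
  | c_anti (i j) (h : i ≠ j) : Rel u α (fc α i * fc α j) (-(fc α j * fc α i))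
  | σc (w i) : Rel u α (fs α w * fc α i) (fc α (w i) * fs α w)
  | σx (w i) : Rel u α (fs α w * fx α i) (fx α (w i) * fs α w)
  | xc_same (i) : Rel u α (fx α i * fc α i) (-(fc α i * fx α i))
  | xc (i j) (h : i ≠ j) : Rel u α (fx α i * fc α j) (fc α j * fx α i)
  | x_sq (i) : Rel u α (fx α i * fx α i) (algebraMap ℂ _ u)
  | xx (i j) (h : i ≠ j) : Rel u α (fx α i * fx α j) (fx α j * fx α i +
      ((1 + fc α i * fc α j) * fx α i - (1 + fc α j * fc α i) * fx α j) * fs α (swap i j))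

def U (u : ℂ) (α : Type) [DecidableEq α] : Type := RingQuot (Rel u α)

instance (u : ℂ) (α : Type) [DecidableEq α] : Ring (U u α) :=
  inferInstanceAs (Ring (RingQuot (Rel u α)))
instance (u : ℂ) (α : Type) [DecidableEq α] : Algebra ℂ (U u α) :=
  inferInstanceAs (Algebra ℂ (RingQuot (Rel u α)))

def mkU (u : ℂ) (α : Type) [DecidableEq α] : FreeAlgebra ℂ (Gen α) →ₐ[ℂ] U u α :=
  RingQuot.mkAlgHom ℂ (Rel u α)

theorem mkU_rel {a b : FreeAlgebra ℂ (Gen α)} (h : Rel u α a b) : mkU u α a = mkU u α b :=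
  RingQuot.mkAlgHom_rel ℂ h

/-- the universal Sergeev data -/
def sd (u : ℂ) (α : Type) [DecidableEq α] : SD u α (U u α) where
  σ := { toFun := fun w => mkU u α (fs α w)
         map_one' := by rw [mkU_rel Rel.one, map_one]
         map_mul' := fun w v => by rw [mkU_rel (Rel.mul w v), map_mul] }
  c := fun i => mkU u α (fc α i)
  x := fun i => mkU u α (fx α i)
  c_sq := fun i => by simpa using mkU_rel (Rel.c_sq (u := u) i)
  c_anti := fun i j h => by simpa using mkU_rel (Rel.c_anti (u := u) i j h)
  σc := fun w i => by simpa using mkU_rel (Rel.σc (u := u) w i)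
  σx := fun w i => by simpa using mkU_rel (Rel.σx (u := u) w i)
  xc_same := fun i => by simpa using mkU_rel (Rel.xc_same (u := u) i)
  xc := fun i j h => by simpa using mkU_rel (Rel.xc (u := u) i j h)
  x_sq := fun i => by simpa using mkU_rel (Rel.x_sq (u := u) i)
  xx := fun i j h => by simpa [PreSD.D] using mkU_rel (Rel.xx (u := u) i j h)

def genMap (d : PreSD u α A) : Gen α → A
  | Gen.s w => d.σ w
  | Gen.c i => d.c i
  | Gen.x i => d.x i

def liftU (d : SD u α A) : U u α →ₐ[ℂ] A :=
  RingQuot.liftAlgHom ℂ ⟨FreeAlgebra.lift ℂ (genMap d.toPreSD), by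
    intro a b h
    induction h with
    | one => simp [fs, genMap]
    | mul w v => simp [fs, genMap]
    | c_sq i => simpa [fc, genMap] using d.c_sq i
    | c_anti i j h => simpa [fc, genMap] using d.c_anti i j h
    | σc w i => simpa [fc, fs, genMap] using d.σc w i
    | σx w i => simpa [fx, fs, genMap] using d.σx w i
    | xc_same i => simpa [fx, fc, genMap] using d.xc_same i
    | xc i j h => simpa [fx, fc, genMap] using d.xc i j h
    | x_sq i => simpa [fx, genMap] using d.x_sq i
    | xx i j h => simpa [fx, fc, fs, genMap, PreSD.D] using d.xx i j h⟩

@[simp] theorem liftU_σ (d : SD u α A) (w) : liftU d ((sd u α).σ w) = d.σ w := by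
  simp only [liftU, sd, mkU, MonoidHom.coe_mk, OneHom.coe_mk]
  erw [RingQuot.liftAlgHom_mkAlgHom_apply]
  simp [fs, genMap]
@[simp] theorem liftU_c (d : SD u α A) (i) : liftU d ((sd u α).c i) = d.c i := by
  simp only [liftU, sd, mkU]
  erw [RingQuot.liftAlgHom_mkAlgHom_apply]
  simp [fc, genMap]
@[simp] theorem liftU_x (d : SD u α A) (i) : liftU d ((sd u α).x i) = d.x i := by
  simp only [liftU, sd, mkU]
  erw [RingQuot.liftAlgHom_mkAlgHom_apply]
  simp [fx, genMap]

/-- left induction on `U` -/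
theorem U_ind (S : Submodule ℂ (U u α)) (h1 : 1 ∈ S)
    (hs : ∀ w, ∀ h ∈ S, (sd u α).σ w * h ∈ S)
    (hc : ∀ i, ∀ h ∈ S, (sd u α).c i * h ∈ S)
    (hx : ∀ i, ∀ h ∈ S, (sd u α).x i * h ∈ S) (z : U u α) : z ∈ S := by
  obtain ⟨a, rfl⟩ := RingQuot.mkAlgHom_surjective ℂ (Rel u α) z
  have key : ∀ a : FreeAlgebra ℂ (Gen α), ∀ h ∈ S, mkU u α a * h ∈ S := by
    intro a
    induction a using FreeAlgebra.induction with
    | grade0 k => intro h hh; rw [AlgHom.commutes, ← Algebra.smul_def]; exact S.smul_mem _ hh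
    | grade1 g =>
      intro h hh
      cases g with
      | s w => exact hs w h hh
      | c i => exact hc i h hh
      | x i => exact hx i h hh
    | mul a b ha hb => intro h hh; rw [map_mul, mul_assoc]; exact ha _ (hb _ hh)
    | add a b ha hb => intro h hh; rw [map_add, add_mul]; exact S.add_mem (ha _ hh) (hb _ hh)
  have := key a 1 h1
  rwa [mul_one] at this

/-- multiplicative induction on `U` -/
theorem U_ind' (p : U u α → Prop) (ha : ∀ a b, p a → p b → p (a + b))
    (hm : ∀ a b, p a → p b → p (a * b)) (hk : ∀ k : ℂ, p (algebraMap ℂ _ k))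
    (hs : ∀ w, p ((sd u α).σ w)) (hc : ∀ i, p ((sd u α).c i)) (hx : ∀ i, p ((sd u α).x i))
    (z : U u α) : p z := by
  let S : Submodule ℂ (U u α) :=
    { carrier := {z | p z}
      add_mem' := fun h1 h2 => ha _ _ h1 h2
      zero_mem' := by have := hk 0; rwa [map_zero] at this
      smul_mem' := fun k z hz => by rw [Algebra.smul_def]; exact hm _ _ (hk k) hz }
  exact U_ind S (by have := hk 1; rwa [map_one] at this) (fun w h hh => hm _ _ (hs w) hh)
    (fun w h hh => hm _ _ (hc w) hh) (fun w h hh => hm _ _ (hx w) hh) z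

end
end

section
/-- constructing pre-Sergeev data from one `x`. -/
def mkPre {u : ℂ} {α : Type} [DecidableEq α] {A : Type} [Ring A] [Algebra ℂ A]
    (σ : Perm (Option α) →* A) (c : Option α → A) (X : A)
    (c_sq : ∀ i, c i * c i = -1)
    (c_anti : ∀ i j, i ≠ j → c i * c j = -(c j * c i))
    (σc : ∀ w i, σ w * c i = c (w i) * σ w)
    (hX : ∀ v : Perm α, σ (optionCongr v) * X = X * σ (optionCongr v))
    (hXc : X * c none = - (c none * X))
    (hXc' : ∀ k, X * c (some k) = c (some k) * X)
    (hX2 : X * X = algebraMap ℂ A u) : PreSD u (Option α) A :=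
  have hss : ∀ i : Option α, σ (swap none i) * σ (swap none i) = 1 := fun i => by
    rw [← map_mul, swap_mul_self, map_one]
  have hfix : ∀ w : Perm (Option α), w none = none → σ w * X = X * σ w := fun w hw => by
    have : optionCongr (removeNone w) = w := by
      rw [map_equiv_removeNone, hw, swap_self]; exact one_mul w
    rw [← this, hX]
  have hsc : ∀ i j : Option α, σ (swap none i) * c j = c (swap none i j) * σ (swap none i) :=
    fun i j => σc _ _
  { σ := σ
    c := c
    x := fun i => σ (swap none i) * X * σ (swap none i)
    c_sq := c_sq
    c_anti := c_anti
    σc := σc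
    σx := fun w i => by
      have h := hfix (swap none (w i) * w * swap none i) (by simp)
      rw [map_mul, map_mul] at h
      have h1 := hss i
      have h2 := hss (w i)
      linear_combination (norm := noncomm_ring) -h2 * σ w * σ (swap none i) * X * σ (swap none i)
        + σ (swap none (w i)) * h * σ (swap none i)
        + σ (swap none (w i)) * X * σ (swap none (w i)) * σ w * h1
    xc_same := fun i => by
      have h := hsc i i
      have h' := hsc i none
      simp only [swap_apply_right, swap_apply_left] at h h'
      linear_combination (norm := noncomm_ring) σ (swap none i) * X * h
        + σ (swap none i) * hXc * σ (swap none i) - h' * X * σ (swap none i)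
    xc := fun i j hij => by
      have h := hsc i j
      have h' := hsc i (swap none i j)
      rw [swap_apply_self] at h'
      obtain ⟨k, hk⟩ : ∃ k, swap none i j = some k := by
        rw [← Option.ne_none_iff_exists']
        intro h
        have := congrArg (swap none i) h
        rw [swap_apply_self, swap_apply_left] at this
        exact hij this.symm
      rw [hk] at h h'
      linear_combination (norm := noncomm_ring) σ (swap none i) * X * h
        + σ (swap none i) * hXc' k * σ (swap none i) + h' * X * σ (swap none i)
    x_sq := fun i => by
      have h := hss i
      have h' : σ (swap none i) * algebraMap ℂ A u = algebraMap ℂ A u * σ (swap none i) :=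
        (Algebra.commutes _ _).symm
      linear_combination (norm := noncomm_ring) σ (swap none i) * X * h * X * σ (swap none i)
        + σ (swap none i) * hX2 * σ (swap none i) + h' * σ (swap none i)
         + algebraMap ℂ A u * h }

section
variable {α : Type} [DecidableEq α]

def pc (w : Perm (Option α)) (j : Option α) : Perm α :=
  removeNone (swap none (w j) * w * swap none j)

theorem pc_spec (w : Perm (Option α)) (j : Option α) :
    optionCongr (pc w j) = swap none (w j) * w * swap none j := by
  unfold pc
  rw [map_equiv_removeNone]
  simp
  rfl

theorem pc_mul (w v : Perm (Option α)) (j : Option α) : pc (w * v) j = pc w (v j) * pc v j := by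
  apply optionCongr_injective
  have : optionCongr (pc w (v j) * pc v j) = optionCongr (pc w (v j)) * optionCongr (pc v j) := by
    ext x; cases x <;> simp
  rw [this, pc_spec, pc_spec, pc_spec]
  simp only [Perm.mul_apply, mul_assoc]
  rw [← mul_assoc (swap none (v j)), swap_mul_self, one_mul]

theorem pc_one (j : Option α) : pc 1 j = 1 := by
  apply optionCongr_injective
  rw [pc_spec]; simp

theorem pc_opt (v : Perm α) (j : Option α) : pc (optionCongr v) j = v := by
  apply optionCongr_injective
  rw [pc_spec]
  ext1 x
  cases j with
  | none => simp
  | some k =>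
    cases x with
    | none => simp
    | some l =>
      by_cases h : l = k
      · subst h; simp
      · simp [swap_apply_of_ne_of_ne, h]

theorem pc_swap (i : α) : pc (swap none (some i)) (some i) = 1 := by
  apply optionCongr_injective
  rw [pc_spec]; simp; rfl

theorem pc_swap' (i : α) : pc (swap none (some i)) none = 1 := by
  apply optionCongr_injective
  rw [pc_spec]; simp; rfl

theorem pc_swap'' (i k : α) (h : k ≠ i) : pc (swap none (some i)) (some k) = swap i k := by
  apply optionCongr_injective
  rw [pc_spec]
  have hs : some k ≠ some i := by simpa using h
  rw [swap_apply_of_ne_of_ne (by simp) hs, mul_swap_eq_swap_mul (swap none (some k)),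
    swap_apply_left, swap_apply_of_ne_of_ne (by simp) hs.symm, mul_assoc, swap_mul_self, mul_one,
    optionCongr_swap, swap_comm]

/-- the underlying space of the induced module -/
abbrev PM (α : Type) (K : Type) : Type := Option α → Bool → Bool → K

variable {u : ℂ} {K : Type} [Ring K] [Algebra ℂ K]

def Lσ (d : PreSD u α K) (w : Perm (Option α)) : PM α K →ₗ[ℂ] PM α K where
  toFun f := fun j a b => d.σ (pc w (w⁻¹ j)) * f (w⁻¹ j) a b
  map_add' f g := by ext j a b; simp [mul_add]
  map_smul' k f := by ext j a b; simp

def LσHom (d : PreSD u α K) : Perm (Option α) →* Module.End ℂ (PM α K) where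
  toFun := Lσ d
  map_one' := by ext f j a b; simp [Lσ, pc_one]
  map_mul' w v := by
    ext f j a b
    simp [Lσ, pc_mul, mul_assoc]

def cS (d : PreSD u α K) : Option α → K
  | none => 0
  | some i => d.c i

def sgn (a : Bool) : ℂ := if a then -1 else 1

def Lc (d : PreSD u α K) (k : Option α) : PM α K →ₗ[ℂ] PM α K where
  toFun f := fun j a b => if j = k then (if a then f j false b else - f j true b)
    else (if a then -(cS d (swap none j k) * f j a b) else cS d (swap none j k) * f j a b)
  map_add' f g := by ext j a b; by_cases j = k <;> cases a <;> simp [*, mul_add] <;> abel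
  map_smul' k f := by ext j a b; simp only [Pi.smul_apply]; split_ifs <;> simp

theorem swap_some {j k : Option α} (h : j ≠ k) : ∃ i, swap none j k = some i := by
  rw [← Option.ne_none_iff_exists']
  intro h'
  have := congrArg (swap none j) h'
  rw [swap_apply_self, swap_apply_left] at this
  exact h this.symm

theorem cS_sq (d : PreSD u α K) {j k : Option α} (h : j ≠ k) :
    cS d (swap none j k) * cS d (swap none j k) = -1 := by
  obtain ⟨i, hi⟩ := swap_some h
  rw [hi]; exact d.c_sq i

theorem cS_anti (d : PreSD u α K) {j k l : Option α} (h : j ≠ k) (h' : j ≠ l) (hkl : k ≠ l) :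
    cS d (swap none j k) * cS d (swap none j l) = -(cS d (swap none j l) * cS d (swap none j k))
     := by
  obtain ⟨i, hi⟩ := swap_some h
  obtain ⟨i', hi'⟩ := swap_some h'
  rw [hi, hi']; refine d.c_anti i i' ?_
  rintro rfl
  exact hkl ((swap none j).injective (hi.trans hi'.symm))

theorem σcS (d : PreSD u α K) (v : Perm α) (j : Option α) :
    d.σ v * cS d j = cS d (optionCongr v j) * d.σ v := by
  cases j with
  | none => simp [cS]
  | some i => simpa [cS] using d.σc v i

theorem Lc_sq (d : PreSD u α K) (k : Option α) : Lc d k * Lc d k = -1 := by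
  ext f j a b
  by_cases h : j = k
  · cases a <;> simp [Lc, h]
  · cases a <;> simp [Lc, h, ← mul_assoc, cS_sq]

theorem Lc_anti (d : PreSD u α K) (k l : Option α) (hkl : k ≠ l) :
    Lc d k * Lc d l = -(Lc d l * Lc d k) := by
  ext f j a b
  by_cases h : j = k
  · subst h
    cases a <;> simp [Lc, hkl]
  · by_cases h' : j = l
    · subst h'
      cases a <;> simp [Lc, h]
    · cases a <;> simp [Lc, h, h', ← mul_assoc, cS_anti d h h' hkl]

theorem Lσc (d : PreSD u α K) (w : Perm (Option α)) (k : Option α) :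
    Lσ d w * Lc d k = Lc d (w k) * Lσ d w := by
  ext f j a b
  obtain ⟨j, rfl⟩ := w.surjective j
  by_cases h : j = k
  · subst h; cases a <;> simp [Lc, Lσ]
  · have h1 := σcS d (pc w j) (swap none j k)
    have h2 : optionCongr (pc w j) (swap none j k) = swap none (w j) (w k) := by
      rw [pc_spec]; simp
    rw [h2] at h1
    cases a <;> simp [Lc, Lσ, h, ← mul_assoc, h1]

variable [Fintype α]

def LX (d : PreSD u α K) : PM α K →ₗ[ℂ] PM α K where
  toFun f := fun j a b =>
    match j, a, b with
    | some k, a, b => d.x k * f (some k) a b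
    | none, false, true => f none false false +
        ∑ k, (f (some k) false true + d.c k * f (some k) true true)
    | none, true, true => - f none true false +
        ∑ k, (d.c k * f (some k) false true + f (some k) true true)
    | none, false, false => u • f none false true +
        ∑ k, (- (d.x k * f (some k) false true) - d.c k * (d.x k * f (some k) true true))
    | none, true, false => - (u • f none true true) +
        ∑ k, (d.c k * (d.x k * f (some k) false true) + d.x k * f (some k) true true)
  map_add' f g := by
    ext j a b
    rcases j with _ | k
    · cases a <;> cases b <;> simp only [Pi.add_apply, mul_add, Finset.sum_add_distrib,
        Finset.sum_sub_distrib, smul_add, Finset.sum_neg_distrib] <;> abel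
    · simp [mul_add]
  map_smul' r f := by
    ext j a b
    rcases j with _ | k
    · cases a <;> cases b <;> simp [smul_add, Finset.smul_sum, smul_sub, smul_comm r u]
    · simp

theorem pm_ext {S T : Module.End ℂ (PM α K)} (h : ∀ f j a b, S f j a b = T f j a b) : S = T := by
  refine LinearMap.ext fun f => ?_
  funext j a b
  exact h f j a b

theorem LX_σ (d : PreSD u α K) (v : Perm α) :
    Lσ d (optionCongr v) * LX d = LX d * Lσ d (optionCongr v) := by
  have e : (optionCongr v)⁻¹ = optionCongr v⁻¹ := rfl
  have hc : ∀ k, d.c k * d.σ v = d.σ v * d.c (v⁻¹ k) := fun k => by rw [d.σc]; simp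
  have hx : ∀ k, d.x k * d.σ v = d.σ v * d.x (v⁻¹ k) := fun k => by rw [d.σx]; simp
  have hc' : ∀ k z, d.c k * (d.σ v * z) = d.σ v * (d.c (v⁻¹ k) * z) := fun k z => by
    rw [← mul_assoc, hc, mul_assoc]
  have hx' : ∀ k z, d.x k * (d.σ v * z) = d.σ v * (d.x (v⁻¹ k) * z) := fun k z => by
    rw [← mul_assoc, hx, mul_assoc]
  refine pm_ext fun f j a b => ?_
  rcases j with _ | k
  · cases a <;> cases b <;> simp only [Module.End.mul_apply, Lσ, LX, LinearMap.coe_mk,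
      AddHom.coe_mk, e, pc_opt, optionCongr_apply, Option.map_none, Option.map_some, mul_add,
      hx', hc', Finset.mul_sum, mul_sub, mul_neg, mul_smul_comm] <;> congr 1
    · exact (Equiv.sum_comp v⁻¹ (fun k => -(d.σ v * (d.x k * f (some k) false true)) -
        d.σ v * (d.c k * (d.x k * f (some k) true true)))).symm
    · exact (Equiv.sum_comp v⁻¹ (fun k => (d.σ v * (f (some k) false true)) +
        d.σ v * (d.c k * (f (some k) true true)))).symm
    · exact (Equiv.sum_comp v⁻¹ (fun k => (d.σ v * (d.c k * (d.x k * f (some k) false true))) +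
        d.σ v * ((d.x k * f (some k) true true)))).symm
    · exact (Equiv.sum_comp v⁻¹ (fun k => (d.σ v * (d.c k * f (some k) false true)) +
        d.σ v * ((f (some k) true true)))).symm
  · simp only [Module.End.mul_apply, Lσ, LX, LinearMap.coe_mk,
      AddHom.coe_mk, e, pc_opt, optionCongr_apply, Option.map_none, Option.map_some, hx']

theorem LX_c (d : PreSD u α K) : LX d * Lc d none = - (Lc d none * LX d) := by
  have h1 : ∀ k z, d.c k * (d.c k * z) = - z := fun k z => by
    rw [← mul_assoc, d.c_sq]; simp
  have h2 : ∀ k z, d.x k * (d.c k * z) = - (d.c k * (d.x k * z)) := fun k z => by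
    rw [← mul_assoc, d.xc_same]; simp [mul_assoc]
  refine pm_ext fun f j a b => ?_
  rcases j with _ | k
  · cases a <;> cases b <;> simp [LX, Lc, cS, h1, h2, neg_add_eq_sub,
      Finset.sum_add_distrib] <;> try abel_nf
  · cases a <;> simp [LX, Lc, cS, h2]

theorem LX_c' (d : PreSD u α K) (i : α) : LX d * Lc d (some i) = (Lc d (some i) * LX d) := by
  have h1 : ∀ k z, d.c k * (d.c k * z) = - z := fun k z => by
    rw [← mul_assoc, d.c_sq]; simp
  have h2 : ∀ k z, d.x k * (d.c k * z) = - (d.c k * (d.x k * z)) := fun k z => by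
    rw [← mul_assoc, d.xc_same]; simp [mul_assoc]
  have h3 : ∀ k, k ≠ i → ∀ z, d.x k * (d.c i * z) = d.c i * (d.x k * z) := fun k hk z => by
    rw [← mul_assoc, d.xc k i hk, mul_assoc]
  have h4 : ∀ k, k ≠ i → ∀ z, d.c k * (d.c i * z) = - (d.c i * (d.c k * z)) := fun k hk z => by
    rw [← mul_assoc, d.c_anti k i hk, neg_mul, mul_assoc]
  refine pm_ext fun f j a b => ?_
  rcases j with _ | k
  · cases a <;> cases b <;> simp only [Module.End.mul_apply, Lc, LX, LinearMap.coe_mk,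
      AddHom.coe_mk, mul_add, Finset.mul_sum, mul_sub, mul_neg, mul_smul_comm, reduceCtorEq,
      if_false, Bool.false_eq_true, swap_self, refl_apply, cS, if_true, neg_add, neg_neg,
      smul_neg, ← Finset.sum_neg_distrib] <;> congr 1 <;> refine Finset.sum_congr rfl fun k _ => ?_
    all_goals
      by_cases hk : k = i
      · subst hk; simp [h1, h2, cS, add_comm, sub_eq_add_neg]
      · have hs : swap none (some k) (some i) = some i :=
          swap_apply_of_ne_of_ne (by simp) (by simpa using Ne.symm hk)
        simp [hk, hs, cS, h3 k hk, h4 k hk, add_comm, sub_eq_add_neg]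
  · by_cases hk : k = i
    · subst hk; cases a <;> simp [LX, Lc]
    · have hs : swap none (some k) (some i) = some i :=
        swap_apply_of_ne_of_ne (by simp) (by simpa using Ne.symm hk)
      cases a <;> simp [LX, Lc, hk, hs, cS, h3 k hk]

theorem LX_sq (d : PreSD u α K) : LX d * LX d = algebraMap ℂ (Module.End ℂ (PM α K)) u := by
  have h1 : ∀ k z, d.x k * (d.x k * z) = u • z := fun k z => by
    rw [← mul_assoc, d.x_sq, Algebra.smul_def]
  refine pm_ext fun f j a b => ?_
  rcases j with _ | k
  · cases a <;> cases b <;> simp [LX, h1, smul_add, Finset.smul_sum, Finset.sum_add_distrib,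
      smul_sub, Finset.sum_sub_distrib] <;> try abel_nf
  · simp [LX, h1]

def preP (d : PreSD u α K) : PreSD u (Option α) (Module.End ℂ (PM α K)) :=
  mkPre (LσHom d) (Lc d) (LX d) (Lc_sq d) (Lc_anti d) (Lσc d) (LX_σ d) (LX_c d) (LX_c' d) (LX_sq d)

/-- basis vectors of the induced module -/
def Bv (j : Option α) (a b : Bool) : K →ₗ[ℂ] PM α K where
  toFun y := fun j' a' b' => if j' = j ∧ a' = a ∧ b' = b then y else 0
  map_add' y z := by funext j' a' b'; simp only [Pi.add_apply]; split_ifs <;> simp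
  map_smul' r y := by funext j' a' b'; simp only [Pi.smul_apply]; split_ifs <;> simp

theorem Bv_apply (j : Option α) (a b : Bool) (y : K) (j' a' b') :
    Bv j a b y j' a' b' = if j' = j ∧ a' = a ∧ b' = b then y else 0 := rfl

theorem pm_sum (f : PM α K) : f = ∑ j, ∑ a, ∑ b, Bv j a b (f j a b) := by
  funext j a b
  simp only [Finset.sum_apply, Bv_apply]
  rw [Finset.sum_eq_single j, Finset.sum_eq_single a, Finset.sum_eq_single b]
  · simp
  · intro b' _ h; simp [Ne.symm h]
  · simp
  · intro b' _ h; simp [Ne.symm h]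
  · simp
  · intro b' _ h; simp [Ne.symm h]
  · simp

variable (d : PreSD u α K)

theorem preσ_B (w : Perm (Option α)) (j a b) (y : K) :
    (preP d).σ w (Bv j a b y) = Bv (w j) a b (d.σ (pc w j) * y) := by
  funext j' a' b'
  change d.σ (pc w (w⁻¹ j')) * Bv j a b y (w⁻¹ j') a' b' = _
  rw [Bv_apply, Bv_apply]
  by_cases h : j' = w j
  · subst h; simp
  · have h' : w⁻¹ j' ≠ j := fun h' => h (by rw [← h']; simp)
    rw [if_neg (fun H => h' H.1), if_neg (fun H => h H.1), mul_zero]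

theorem prec_B (j b) (y : K) : (preP d).c j (Bv j false b y) = Bv j true b y := by
  funext j' a' b'
  change (Lc d j) _ _ _ _ = _
  by_cases h : j' = j
  · subst h; cases a' <;> simp [Lc, Bv_apply]
  · simp [Lc, Bv_apply, h]

theorem prec_B_ne {j k} (h : j ≠ k) (b) (y : K) :
    (preP d).c k (Bv j false b y) = Bv j false b (cS d (swap none j k) * y) := by
  funext j' a' b'
  change (Lc d k) _ _ _ _ = _
  by_cases h' : j' = j
  · subst h'; cases a' <;> simp [Lc, Bv_apply, h]
  · simp [Lc, Bv_apply, h']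

theorem prec_B_ne' {j k} (h : j ≠ k) (b) (y : K) :
    (preP d).c k (Bv j true b y) = - Bv j true b (cS d (swap none j k) * y) := by
  funext j' a' b'
  change (Lc d k) _ _ _ _ = _
  by_cases h' : j' = j
  · subst h'; cases a' <;> simp [Lc, Bv_apply, h]
  · simp [Lc, Bv_apply, h']

theorem preX : (preP d).x none = LX d := by
  change Lσ d (swap none none) * LX d * Lσ d (swap none none) = _
  have : Lσ d (swap none none) = 1 := by rw [swap_self]; exact (LσHom d).map_one
  rw [this]; simp

theorem preX_σ (j : Option α) : (preP d).x j = (preP d).σ (swap none j) * LX d *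
    (preP d).σ (swap none j) := rfl

theorem LX_B0 (y : K) : LX d (Bv none false false y) = Bv none false true y := by
  funext j' a' b'
  rcases j' with _ | k
  · cases a' <;> cases b' <;> simp [LX, Bv_apply]
  · simp [LX, Bv_apply]

theorem LX_Bk0 (k : α) (y : K) :
    LX d (Bv (some k) false false y) = Bv (some k) false false (d.x k * y) := by
  funext j' a' b'
  rcases j' with _ | l
  · cases a' <;> cases b' <;> simp [LX, Bv_apply]
  · by_cases h : l = k
    · subst h; simp [LX, Bv_apply]
    · simp [LX, Bv_apply, h]

theorem LX_Bk1 (k : α) (y : K) :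
    LX d (Bv (some k) false true y) = Bv (some k) false true (d.x k * y) + Bv none false true y
     + Bv none true true (d.c k * y) - Bv none false false (d.x k * y)
     + Bv none true false (d.c k * (d.x k * y)) := by
  funext j' a' b'
  simp only [Pi.add_apply, Pi.sub_apply]
  rcases j' with _ | l
  · cases a' <;> cases b' <;> simp [LX, Bv_apply]
  · by_cases h : l = k
    · subst h; simp [LX, Bv_apply]
    · simp [LX, Bv_apply, h]

theorem prex_E (k : α) (y : K) : (preP d).x (some k) (Bv none false false y) =
    Bv none false false (d.x k * y) := by
  rw [preX_σ]
  simp only [Module.End.mul_apply, preσ_B, swap_apply_left, pc_swap', pc_swap, LX_Bk0,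
    swap_apply_right, map_one, one_mul]

theorem prec_E (k : α) (y : K) : (preP d).c (some k) (Bv none false false y) =
    Bv none false false (d.c k * y) := by
  rw [prec_B_ne _ (by simp)]; simp [cS]

theorem preσ_E (v : Perm α) (a b) (y : K) : (preP d).σ (optionCongr v) (Bv none a b y) =
    Bv none a b (d.σ v * y) := by
  rw [preσ_B, pc_opt]; simp

theorem preΔ_E0 (k : α) (y : K) : (preP d).Δ none (some k) (Bv none false false y) = 0 := by
  have hs : ∀ a b (y : K), (preP d).σ (swap none (some k)) (Bv none a b y) = Bv (some k) a b y := by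
    intro a b y; simp [preσ_B, pc_swap']
  have hs' : ∀ a b (y : K), (preP d).σ (swap none (some k)) (Bv (some k) a b y) = Bv none a b y := by
    intro a b y; simp [preσ_B, pc_swap]
  have hx1 : (preP d).x (some k) (Bv none false true y) = Bv none false true (d.x k * y) +
      Bv (some k) false true y + Bv (some k) true true (d.c k * y)
      - Bv (some k) false false (d.x k * y) + Bv (some k) true false (d.c k * (d.x k * y)) := by
    rw [preX_σ]
    simp only [Module.End.mul_apply, hs, hs', LX_Bk1, map_add, map_sub]
  have hx2 : (preP d).x (some k) (Bv (some k) false false y) = Bv (some k) false true y := by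
    rw [preX_σ]
    simp only [Module.End.mul_apply, hs, hs', LX_B0]
  have hn : some k ≠ (none : Option α) := by simp
  have hcs : cS d (swap none (some k) none) = d.c k := by rw [swap_apply_left]; rfl
  simp only [PreSD.Δ, PreSD.D, LinearMap.sub_apply, Module.End.mul_apply, preX, prex_E, LX_B0,
    hs, hx1, hx2, LX_Bk0, LinearMap.add_apply, Module.End.one_apply, prec_B, prec_B_ne d hn,
    prec_B_ne' d hn, hcs]
  abel

def VΔ (d : PreSD u α K) : Submodule ℂ (PM α K) where
  carrier := {v | ∀ i j, i ≠ j → (preP d).Δ i j v = 0}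
  add_mem' := fun h1 h2 i j hij => by rw [map_add, h1 i j hij, h2 i j hij, add_zero]
  zero_mem' := fun i j hij => map_zero _
  smul_mem' := fun r v h i j hij => by rw [map_smul, h i j hij, smul_zero]

theorem VΔ_σ (w) {v} (h : v ∈ VΔ d) : (preP d).σ w v ∈ VΔ d := by
  intro i j hij
  have := congrArg (fun T => T v) ((preP d).σΔ w (w⁻¹ i) (w⁻¹ j))
  have h1 : ∀ i, w (w⁻¹ i) = i := fun i => by simp
  simp only [Module.End.mul_apply, h1] at this
  rw [← this, h _ _ (by simpa using hij), map_zero]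

theorem VΔ_c (l) {v} (h : v ∈ VΔ d) : (preP d).c l v ∈ VΔ d := by
  intro i j hij
  rcases (preP d).cΔ hij l with h1 | h1
  all_goals
    have := congrArg (fun T => T v) h1
    simp only [Module.End.mul_apply, LinearMap.neg_apply] at this
    rw [this, h _ _ hij, map_zero]
  rw [neg_zero]

theorem VΔ_E (d : SD u α K) (y : K) : Bv none false false y ∈ VΔ d.toPreSD := by
  intro i j hij
  rcases i with _ | i <;> rcases j with _ | j
  · exact absurd rfl hij
  · exact preΔ_E0 _ _ _
  · rw [PreSD.Δ_symm, LinearMap.neg_apply, preΔ_E0, neg_zero]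
  · have hij' : i ≠ j := by simpa using hij
    have h := d.xx i j hij'
    have e : ∀ w : Perm α, optionCongr w = optionCongr w := fun _ => rfl
    simp only [PreSD.Δ, PreSD.D, LinearMap.sub_apply, LinearMap.add_apply, Module.End.mul_apply,
      ← optionCongr_swap, prex_E, prec_E, preσ_E, Module.End.one_apply, ← map_sub, ← map_add]
    have : d.x i * (d.x j * y) - d.x j * (d.x i * y) - (d.x i * (d.σ (swap i j) * y) +
      d.c i * (d.c j * (d.x i * (d.σ (swap i j) * y))) - (d.x j * (d.σ (swap i j) * y) +
      d.c j * (d.c i * (d.x j * (d.σ (swap i j) * y))))) = 0 := by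
      unfold PreSD.D at h
      linear_combination (norm := noncomm_ring) h * y
    rw [this, map_zero]

theorem VΔ_X (d : SD u α K) (y : K) :
    (preP d.toPreSD).x none (Bv none false false y) ∈ VΔ d.toPreSD := by
  have hE := VΔ_E d
  have h1 : ∀ k : α, (preP d.toPreSD).Δ none (some k) ((preP d.toPreSD).x none (Bv none false false y))
      = 0 := by
    intro k
    have := congrArg (fun T => T (Bv none false false y)) ((preP d.toPreSD).Δx
      (o := none) (k := some k) (by simp))
    simp only [Module.End.mul_apply, LinearMap.neg_apply] at this
    rw [this, hE y _ _ (by simp), map_zero, neg_zero]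
  intro i j hij
  rcases i with _ | i <;> rcases j with _ | j
  · exact absurd rfl hij
  · exact h1 j
  · rw [PreSD.Δ_symm, LinearMap.neg_apply, h1, neg_zero]
  · have := congrArg (fun T => T (Bv none false false y)) ((preP d.toPreSD).jac
      (o := none) (i := some i) (k := some j) (by simp) (by simp) hij)
    have hσ : ∀ w i j, i ≠ j → (preP d.toPreSD).Δ i j ((preP d.toPreSD).σ w (Bv none false false y))
       = 0 := fun w i j hij => VΔ_σ _ w (hE y) i j hij
    simp only [Module.End.mul_apply, LinearMap.neg_apply, LinearMap.add_apply,
      LinearMap.sub_apply, prex_E] at this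
    rw [hE y _ _ hij, hE _ (some j) none (by simp), hE _ none (some i) (by simp),
      hE _ (some j) none (by simp), hE _ none (some i) (by simp), hσ _ _ _ (by simp),
      hσ _ _ _ (by simp), hσ _ _ _ hij, hσ _ _ _ (by simp), hσ _ _ _ (by simp),
      hσ _ _ _ hij.symm] at this
    simpa using this

theorem Bv_gen (k : Option α) (a b : Bool) (y : K) : Bv k a b y =
    ((preP d).c k ^ (a.toNat) * (preP d).x k ^ (b.toNat) * (preP d).σ (swap none k))
      (Bv none false false y) := by
  have hs : ∀ a b (y : K), (preP d).σ (swap none k) (Bv none a b y) = Bv k a b y := by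
    intro a b y
    rcases k with _ | k
    · rw [swap_self]; change (preP d).σ 1 _ = _; simp
    · simp [preσ_B, pc_swap']
  have hx : (preP d).x k (Bv k false false y) = Bv k false true y := by
    have := congrArg (fun T => T (Bv none false false y)) ((preP d).σx (swap none k) none)
    simp only [swap_apply_left, Module.End.mul_apply, hs, preX, LX_B0] at this
    exact this.symm
  cases a <;> cases b <;> simp [hs, hx, prec_B]

theorem VΔ_top (d : SD u α K) (v : PM α K) : v ∈ VΔ d.toPreSD := by
  rw [pm_sum v]
  refine Submodule.sum_mem _ fun k _ => Submodule.sum_mem _ fun a _ => Submodule.sum_mem _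
    fun b _ => ?_
  have hσ : ∀ b y, ((preP d.toPreSD).x k ^ (b : Bool).toNat) ((preP d.toPreSD).σ (swap none k)
      (Bv none false false y)) ∈ VΔ d.toPreSD := by
    intro b y
    cases b
    · simpa using VΔ_σ _ _ (VΔ_E d y)
    · have := congrArg (fun T => T (Bv none false false y))
        ((preP d.toPreSD).σx (swap none k) none)
      simp only [swap_apply_left, Module.End.mul_apply] at this
      simp only [Bool.toNat_true, pow_one, ← this]
      exact VΔ_σ _ _ (VΔ_X d y)
  rw [Bv_gen d.toPreSD, Module.End.mul_apply, Module.End.mul_apply]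
  cases a
  · simpa using hσ b _
  · simpa using VΔ_c _ _ (hσ b _)

/-- Sergeev data on the induced module. -/
def sdP (d : SD u α K) : SD u (Option α) (Module.End ℂ (PM α K)) where
  toPreSD := preP d.toPreSD
  xx := fun i j hij => by
    have : (preP d.toPreSD).Δ i j = 0 := LinearMap.ext fun v => VΔ_top d v i j hij
    unfold PreSD.Δ at this
    rw [sub_sub, sub_eq_zero] at this
    exact this

end
end


local notation "𝐬" => PreSD.σ (SD.toPreSD (sd _ _))
local notation "𝐜" => PreSD.c (SD.toPreSD (sd _ _))
local notation "𝐱" => PreSD.x (SD.toPreSD (sd _ _))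

section
section
variable {u : ℂ} {α : Type} [DecidableEq α]

def optHom (α : Type) : Perm α →* Perm (Option α) where
  toFun := fun v => optionCongr v
  map_one' := by ext1 x; cases x <;> simp
  map_mul' := fun w v => by ext1 x; cases x <;> simp

/-- the standard embedding -/
def inc : U u α →ₐ[ℂ] U u (Option α) := liftU
  { σ := (sd u (Option α)).σ.comp (optHom α)
    c := fun i => 𝐜 (some i)
    x := fun i => 𝐱 (some i)
    c_sq := fun i => (sd u (Option α)).c_sq _
    c_anti := fun i j h => (sd u (Option α)).c_anti _ _ (by simpa using h)
    σc := fun w i => (sd u (Option α)).σc _ _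
    σx := fun w i => (sd u (Option α)).σx _ _
    xc_same := fun i => (sd u (Option α)).xc_same _
    xc := fun i j h => (sd u (Option α)).xc _ _ (by simpa using h)
    x_sq := fun i => (sd u (Option α)).x_sq _
    xx := fun i j h => by
      rw [(sd u (Option α)).xx (some i) (some j) (by simpa using h)]
      simp only [PreSD.D, MonoidHom.comp_apply]
      congr 3
      exact (optionCongr_swap i j).symm }

@[simp] theorem inc_c (i : α) : (inc (𝐜 i) : U u (Option α)) = 𝐜 (some i) := by
  simp [inc]
@[simp] theorem inc_x (i : α) : (inc (𝐱 i) : U u (Option α)) = 𝐱 (some i) := by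
  simp [inc]
theorem inc_s (w : Perm α) : (inc (𝐬 w) : U u (Option α)) = 𝐬 (optionCongr w) := by
  simp [inc]; rfl
@[simp] theorem inc_swap (i j : α) :
    (inc (𝐬 (swap i j)) : U u (Option α)) = 𝐬 (swap (some i) (some j)) := by
  rw [inc_s, optionCongr_swap]

/-- the parity automorphism -/
def par : U u α →ₐ[ℂ] U u α := liftU
  { σ := 𝐬
    c := fun i => - 𝐜 i
    x := fun i => 𝐱 i
    c_sq := fun i => by simp [(sd u α).c_sq]
    c_anti := fun i j h => by simp [(sd u α).c_anti _ _ h]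
    σc := fun w i => by simp [(sd u α).σc]
    σx := fun w i => (sd u α).σx _ _
    xc_same := fun i => by simp [(sd u α).xc_same]
    xc := fun i j h => by simp [(sd u α).xc _ _ h]
    x_sq := fun i => (sd u α).x_sq _
    xx := fun i j h => by
      rw [(sd u α).xx _ _ h]
      simp [PreSD.D] }

@[simp] theorem par_c (i : α) : (par (𝐜 i) : U u α) = - 𝐜 i := by simp [par]
@[simp] theorem par_x (i : α) : (par (𝐱 i) : U u α) = 𝐱 i := by simp [par]
@[simp] theorem par_s (w : Perm α) : (par (𝐬 w) : U u α) = 𝐬 w := by simp [par]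

theorem algHom_ext {A : Type} [Ring A] [Algebra ℂ A] {f g : U u α →ₐ[ℂ] A}
    (hs : ∀ w, f (𝐬 w) = g (𝐬 w)) (hc : ∀ i, f (𝐜 i) = g (𝐜 i))
    (hx : ∀ i, f (𝐱 i) = g (𝐱 i)) : f = g := by
  refine AlgHom.ext fun z => ?_
  refine U_ind' (fun z => f z = g z) ?_ ?_ ?_ hs hc hx z
  · intro a b h1 h2; simp [h1, h2]
  · intro a b h1 h2; simp [h1, h2]
  · intro k; simp

@[simp] theorem par_par (z : U u α) : par (par z) = z := by
  have : (par.comp par : U u α →ₐ[ℂ] U u α) = AlgHom.id ℂ _ := by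
    apply algHom_ext <;> simp
  exact congrArg (fun f => f z) this

theorem par_inc (z : U u α) : par (inc z : U u (Option α)) = inc (par z) := by
  have : (par.comp inc : U u α →ₐ[ℂ] U u (Option α)) = inc.comp par := by
    apply algHom_ext <;> simp [inc_s]
  exact congrArg (fun f => f z) this

theorem inc_par_c (z : U u α) : (inc (par z) * 𝐜 none : U u (Option α)) = 𝐜 none * inc z := by
  refine U_ind' (fun z => (inc (par z) * 𝐜 none : U u (Option α)) = 𝐜 none * inc z)
    ?_ ?_ ?_ ?_ ?_ ?_ z
  · intro a b h1 h2; simp only [map_add, add_mul, mul_add, h1, h2]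
  · intro a b h1 h2; simp only [map_mul]; rw [mul_assoc, h2, ← mul_assoc, h1, mul_assoc]
  · intro k; simp [Algebra.commutes]
  · intro w; rw [par_s, inc_s, (sd u (Option α)).σc]; rfl
  · intro i; simp [(sd u (Option α)).c_anti none (some i)]
  · intro i; simp [(sd u (Option α)).xc (some i) none]

theorem c_inc (z : U u α) : (𝐜 none * inc z : U u (Option α)) = inc (par z) * 𝐜 none :=
  (inc_par_c z).symm

theorem inc_c_none (z : U u α) : (inc z * 𝐜 none : U u (Option α)) = 𝐜 none * inc (par z) := by
  rw [c_inc, par_par]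

/-- the transposition conjugate of the embedding -/
def tau : U u (Option (Option α)) := 𝐬 (swap none (some none))

theorem tau_tau : (tau * tau : U u (Option (Option α))) = 1 := (sd _ _).ss _ _

theorem tau_tau' (z) : (tau * (tau * z) : U u (Option (Option α))) = z := by
  rw [← mul_assoc, tau_tau, one_mul]

def tw : U u (Option α) →ₐ[ℂ] U u (Option (Option α)) where
  toFun z := tau * inc z * tau
  map_one' := by simp [tau_tau]
  map_mul' a b := by
    rw [map_mul]
    linear_combination (norm := noncomm_ring) - tau * inc a * (tau_tau (u := u) (α := α)) *
      inc b * tau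
  map_zero' := by simp
  map_add' a b := by rw [map_add]; noncomm_ring
  commutes' k := by
    rw [AlgHom.commutes, ← Algebra.commutes, mul_assoc, tau_tau, mul_one]

theorem tw_def (z : U u (Option α)) : tw z = tau * inc z * tau := rfl

theorem tau_tw (z : U u (Option α)) : tau * tw z = inc z * tau := by
  rw [tw_def, mul_assoc, tau_tau']

theorem tw_tau (z : U u (Option α)) : tw z * tau = tau * inc z := by
  rw [tw_def, mul_assoc, tau_tau, mul_one]

theorem tau_c (i) : (tau * 𝐜 i : U u (Option (Option α))) = 𝐜 (swap none (some none) i) * tau :=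
  (sd _ _).σc _ _
theorem tau_x (i) : (tau * 𝐱 i : U u (Option (Option α))) = 𝐱 (swap none (some none) i) * tau :=
  (sd _ _).σx _ _

theorem tau_inc_inc (y : U u α) : (tau * inc (inc y) : U u (Option (Option α))) =
    inc (inc y) * tau := by
  refine U_ind' (fun y => (tau * inc (inc y) : U u (Option (Option α))) =
    inc (inc y) * tau) ?_ ?_ ?_ ?_ ?_ ?_ y
  · intro a b h1 h2; simp only [map_add, add_mul, mul_add, h1, h2]
  · intro a b h1 h2; simp only [map_mul]; rw [← mul_assoc, h1, mul_assoc, h2, mul_assoc]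
  · intro k; simp [Algebra.commutes]
  · intro w
    rw [inc_s, inc_s, tau, ← map_mul, ← map_mul, swap_mul_eq_mul_swap]
    rfl
  · intro i; rw [inc_c, inc_c, tau_c, swap_apply_of_ne_of_ne (by simp) (by simp)]
  · intro i; rw [inc_x, inc_x, tau_x, swap_apply_of_ne_of_ne (by simp) (by simp)]

@[simp] theorem tw_inc (y : U u α) : (tw (inc y) : U u (Option (Option α))) = inc (inc y) := by
  rw [tw_def, tau_inc_inc, mul_assoc, tau_tau, mul_one]
@[simp] theorem tw_c : (tw (𝐜 none) : U u (Option (Option α))) = 𝐜 none := by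
  rw [tw_def, inc_c, tau_c, mul_assoc, tau_tau, mul_one]; simp
@[simp] theorem tw_x : (tw (𝐱 none) : U u (Option (Option α))) = 𝐱 none := by
  rw [tw_def, inc_x, tau_x, mul_assoc, tau_tau, mul_one]; simp
@[simp] theorem tw_swap (k : α) : (tw (𝐬 (swap none (some k))) : U u (Option (Option α))) =
    𝐬 (swap none (some (some k))) := by
  rw [tw_def, inc_swap, tau, ← map_mul, ← map_mul]
  congr 1
  rw [mul_swap_eq_swap_mul (swap none (some none)) (some none), mul_assoc, swap_mul_self, mul_one, swap_apply_right,
    swap_apply_of_ne_of_ne] <;> simp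

variable [Fintype α]

def act : U u (Option α) →ₐ[ℂ] Module.End ℂ (PM α (U u α)) := liftU (sdP (sd u α))

@[simp] theorem act_s (w) : act (𝐬 w) = (preP (sd u α).toPreSD).σ w := by
  rw [act, liftU_σ]; rfl
@[simp] theorem act_c (w) : act (𝐜 w) = (preP (sd u α).toPreSD).c w := by
  rw [act, liftU_c]; rfl
@[simp] theorem act_x (w) : act (𝐱 w) = (preP (sd u α).toPreSD).x w := by
  rw [act, liftU_x]; rfl

theorem act_inc (y z : U u α) : act (inc y) (Bv none false false z) =
    Bv none false false (y * z) := by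
  refine U_ind' (fun y => ∀ z, act (inc y) (Bv none false false z) =
    Bv none false false (y * z)) ?_ ?_ ?_ ?_ ?_ ?_ y z
  · intro a b h1 h2 z; simp only [map_add, add_mul, LinearMap.add_apply, h1, h2]
  · intro a b h1 h2 z; rw [map_mul, map_mul, Module.End.mul_apply, h2, h1, mul_assoc]
  · intro k z; rw [AlgHom.commutes, AlgHom.commutes, Module.algebraMap_end_apply,
      ← Algebra.smul_def, map_smul]
  · intro w z; rw [inc_s, act_s, preσ_E]
  · intro i z; rw [inc_c, act_c, prec_E]
  · intro i z; rw [inc_x, act_x, prex_E]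

/-- right multiplication on the induced module -/
def Rm (y : U u α) : Module.End ℂ (PM α (U u α)) where
  toFun f := fun j a b => f j a b * y
  map_add' f g := by funext j a b; simp [add_mul]
  map_smul' k f := by funext j a b; simp

theorem Rm_comm (h : U u (Option α)) (y : U u α) : act h * Rm y = Rm y * act h := by
  have hσ : ∀ w, Lσ (sd u α).toPreSD w * Rm y = Rm y * Lσ (sd u α).toPreSD w := by
    intro w; refine pm_ext fun f j a b => ?_
    simp [Lσ, Rm, mul_assoc]
  refine U_ind' (fun h => act h * Rm y = Rm y * act h) ?_ ?_ ?_ ?_ ?_ ?_ h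
  · intro a b h1 h2; simp only [map_add, add_mul, mul_add, h1, h2]
  · intro a b h1 h2; simp only [map_mul]; rw [mul_assoc, h2, ← mul_assoc, h1, mul_assoc]
  · intro k; simp [Algebra.commutes]
  · intro w; rw [act_s]; exact hσ w
  · intro i; rw [act_c]; change Lc _ _ * _ = _ * Lc _ _
    refine pm_ext fun f j a b => ?_
    simp only [Lc, Rm, Module.End.mul_apply, LinearMap.coe_mk, AddHom.coe_mk]
    split_ifs <;> simp [mul_assoc]
  · intro i; rw [act_x, preX_σ]
    have hX : LX (sd u α).toPreSD * Rm y = Rm y * LX (sd u α).toPreSD := by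
      refine pm_ext fun f j a b => ?_
      rcases j with _ | k
      · cases a <;> cases b <;> simp [LX, Rm, mul_assoc, Finset.sum_mul, add_mul, sub_mul]
      · simp [LX, Rm, mul_assoc]
    have h1 := hσ (swap none i)
    change Lσ _ _ * _ * Lσ _ _ * _ = _ * (Lσ _ _ * _ * Lσ _ _)
    linear_combination (norm := noncomm_ring) Lσ (sd u α).toPreSD (swap none i) *
      LX (sd u α).toPreSD * h1 + Lσ (sd u α).toPreSD (swap none i) * hX *
      Lσ (sd u α).toPreSD (swap none i) + h1 * LX (sd u α).toPreSD *
      Lσ (sd u α).toPreSD (swap none i)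

def ev (h : U u (Option α)) : PM α (U u α) := act h (Bv none false false 1)

theorem ev_mul_inc (h : U u (Option α)) (y : U u α) : ev (h * inc y) = Rm y (ev h) := by
  unfold ev
  rw [map_mul, Module.End.mul_apply, act_inc, mul_one]
  have := congrArg (fun T => T (Bv none false false 1)) (Rm_comm h y)
  simp only [Module.End.mul_apply] at this
  rw [← this]
  congr 1
  funext j a b
  simp [Rm, Bv_apply]

/-- the coset monomials -/
def mc (k : Option α) (a b : Bool) : U u (Option α) :=
  𝐜 k ^ a.toNat * 𝐱 k ^ b.toNat * 𝐬 (swap none k)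

theorem ev_mc (k : Option α) (a b : Bool) (y : U u α) : ev (mc k a b * inc y) = Bv k a b y := by
  unfold ev mc
  rw [map_mul, Module.End.mul_apply, act_inc, mul_one]
  conv_rhs => rw [Bv_gen (sd u α).toPreSD]
  simp

variable (u α) in
def spO : Submodule ℂ (U u (Option α)) :=
  Submodule.span ℂ {z | ∃ k a b y, z = mc k a b * inc y}

theorem mem_spO (k : Option α) (a b : Bool) (y : U u α) : mc k a b * inc y ∈ spO u α :=
  Submodule.subset_span ⟨k, a, b, y, rfl⟩

theorem s_split (w : Perm (Option α)) : (𝐬 w : U u (Option α)) =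
    𝐬 (swap none (w none)) * inc (𝐬 (pc w none)) := by
  rw [inc_s, pc_spec, ← map_mul, ← mul_assoc, ← mul_assoc, swap_mul_self, one_mul,
    swap_self]
  exact congrArg _ (mul_one w).symm

theorem spO_lin {T : U u (Option α) →ₗ[ℂ] U u (Option α)}
    (h : ∀ k a b y, T (mc k a b * inc y) ∈ spO u α) {z} (hz : z ∈ spO u α) : T z ∈ spO u α := by
  have : spO u α ≤ (spO u α).comap T := by
    refine Submodule.span_le.2 ?_
    rintro _ ⟨k, a, b, y, rfl⟩
    exact h k a b y
  exact this hz

theorem mc_inc (k : Option α) (a b) (y y' : U u α) : mc k a b * inc y * inc y' =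
    mc k a b * inc (y * y') := by rw [map_mul, mul_assoc]

theorem spO_s (w) {z : U u (Option α)} (hz : z ∈ spO u α) : 𝐬 w * z ∈ spO u α := by
  refine spO_lin (T := LinearMap.mulLeft ℂ (𝐬 w)) (fun k a b y => ?_) hz
  have : (𝐬 w * mc k a b : U u (Option α)) = mc (w k) a b * inc (𝐬 (pc w k)) := by
    have e : (𝐬 (swap none (w k)) * inc (𝐬 (pc w k)) : U u (Option α)) =
        𝐬 w * 𝐬 (swap none k) := by
      rw [inc_s, pc_spec, ← map_mul, ← mul_assoc, ← mul_assoc, swap_mul_self, one_mul, map_mul]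
    unfold mc
    rw [mul_assoc _ (𝐬 _) (inc _), e]
    cases a <;> cases b <;> simp [← mul_assoc, (sd u (Option α)).σc, (sd u (Option α)).σx]
    rw [mul_assoc _ (𝐬 w), (sd u (Option α)).σx]; simp [← mul_assoc]
  rw [LinearMap.mulLeft_apply, ← mul_assoc, this, mul_assoc, ← map_mul]
  exact mem_spO _ _ _ _

theorem mc_c {k l : Option α} (h : k ≠ l) : ∃ i : α,
    (𝐜 l * 𝐬 (swap none k) : U u (Option α)) = 𝐬 (swap none k) * inc (𝐜 i) ∧
    (𝐱 l * 𝐬 (swap none k) : U u (Option α)) = 𝐬 (swap none k) * inc (𝐱 i) := by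
  obtain ⟨i, hi⟩ := swap_some h
  refine ⟨i, ?_, ?_⟩
  · rw [inc_c, ← hi, (sd u (Option α)).σc, swap_apply_self]
  · rw [inc_x, ← hi, (sd u (Option α)).σx, swap_apply_self]

theorem spO_c (l) {z : U u (Option α)} (hz : z ∈ spO u α) : 𝐜 l * z ∈ spO u α := by
  refine spO_lin (T := LinearMap.mulLeft ℂ (𝐜 l)) (fun k a b y => ?_) hz
  rw [LinearMap.mulLeft_apply]
  by_cases h : k = l
  · subst h
    cases a
    · convert mem_spO k true b y using 1
      simp [mc, mul_assoc]
    · convert (spO u α).neg_mem (mem_spO k false b y) using 1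
      simp [mc, ← mul_assoc, (sd u (Option α)).c_sq]
  · obtain ⟨i, h1, -⟩ := mc_c (u := u) h
    have hx : (𝐜 l * 𝐱 k ^ b.toNat : U u (Option α)) = 𝐱 k ^ b.toNat * 𝐜 l := by
      cases b <;> simp [(sd u (Option α)).xc k l h]
    have hc := (sd u (Option α)).c_anti l k (Ne.symm h)
    cases a
    · convert mem_spO k false b (𝐜 i * y) using 1
      simp only [mc, Bool.toNat_false, pow_zero, one_mul, map_mul]
      linear_combination (norm := noncomm_ring) 𝐱 k ^ b.toNat * h1 * inc y
        + hx * 𝐬 (swap none k) * inc y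
    · convert (spO u α).neg_mem (mem_spO k true b (𝐜 i * y)) using 1
      simp only [mc, Bool.toNat_true, pow_one, one_mul, map_mul]
      linear_combination (norm := noncomm_ring) - 𝐜 k * 𝐱 k ^ b.toNat * h1 * inc y
        - 𝐜 k * hx * 𝐬 (swap none k) * inc y + hc * 𝐱 k ^ b.toNat * 𝐬 (swap none k) * inc y

theorem spO_xs (l) (w : Perm (Option α)) (y : U u α) : 𝐱 l * 𝐬 w * inc y ∈ spO u α := by
  rw [s_split w]
  by_cases h : w none = l
  · subst h
    convert mem_spO (w none) false true (𝐬 (pc w none) * y) using 1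
    simp [mc, mul_assoc]
  · obtain ⟨i, -, h1⟩ := mc_c (u := u) h
    convert mem_spO (w none) false false (𝐱 i * 𝐬 (pc w none) * y) using 1
    rw [← mul_assoc, h1]
    simp [mc, mul_assoc]

theorem spO_x (l) {z : U u (Option α)} (hz : z ∈ spO u α) : 𝐱 l * z ∈ spO u α := by
  refine spO_lin (T := LinearMap.mulLeft ℂ (𝐱 l)) (fun k a b y => ?_) hz
  rw [LinearMap.mulLeft_apply]
  by_cases h : k = l
  · subst h
    cases a <;> cases b
    · convert mem_spO k false true y using 1
      simp [mc, mul_assoc]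
    · convert (spO u α).smul_mem u (mem_spO k false false y) using 1
      simp [mc, ← mul_assoc, (sd u (Option α)).x_sq, Algebra.smul_def]
    · convert (spO u α).neg_mem (mem_spO k true true y) using 1
      simp [mc, ← mul_assoc, (sd u (Option α)).xc_same]
    · convert (spO u α).neg_mem ((spO u α).smul_mem u (mem_spO k true false y)) using 1
      simp only [mc, Bool.toNat_true, Bool.toNat_false, pow_one, pow_zero, mul_one,
        Algebra.smul_def]
      linear_combination (norm := noncomm_ring) (sd u (Option α)).xc_same k * 𝐱 k
        * 𝐬 (swap none k) * inc y - 𝐜 k * (sd u (Option α)).x_sq k * 𝐬 (swap none k) * inc y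
         + Algebra.commutes u (𝐜 k : U u (Option α)) * 𝐬 (swap none k) * inc y
  · obtain ⟨i, -, h1⟩ := mc_c (u := u) h
    have key : ∀ b, 𝐱 l * mc k false b * inc y ∈ spO u α := by
      intro b
      cases b
      · convert mem_spO k false false (𝐱 i * y) using 1
        simp only [mc, Bool.toNat_true, Bool.toNat_false, pow_one, pow_zero, mul_one, one_mul,
          map_mul, h1, mul_assoc]
      · have e : 𝐱 l * mc k false true * inc y = mc k false true * inc (𝐱 i * y) +
          ((𝐱 l * 𝐬 (swap l k * swap none k) * inc y) + 𝐜 l * (𝐜 k * (𝐱 l * 𝐬 (swap l k * swap none k)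
            * inc y)) - (𝐱 k * 𝐬 (swap l k * swap none k) * inc y) - 𝐜 k * (𝐜 l * (𝐱 k *
            𝐬 (swap l k * swap none k) * inc y))) := by
          have := (sd u (Option α)).xx l k (Ne.symm h)
          unfold PreSD.D at this
          simp only [mc, Bool.toNat_true, Bool.toNat_false, pow_one, pow_zero, mul_one, one_mul,
            map_mul]
          linear_combination (norm := noncomm_ring) this * 𝐬 (swap none k) * inc y +
            𝐱 k * h1 * inc y
        rw [e]
        have m1 := spO_xs l (swap l k * swap none k) y
        have m2 := spO_xs k (swap l k * swap none k) y
        exact add_mem (mem_spO _ _ _ _) (sub_mem (sub_mem (add_mem m1 (spO_c _ (spO_c _ m1))) m2)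
          (spO_c _ (spO_c _ m2)))
    cases a
    · rw [← mul_assoc]; exact key b
    · convert spO_c k (key b) using 1
      simp [mc, ← mul_assoc, (sd u (Option α)).xc l k (Ne.symm h)]

theorem spO_top (z : U u (Option α)) : z ∈ spO u α := by
  refine U_ind (spO u α) ?_ (fun w h => spO_s w) (fun w h => spO_c w) (fun w h => spO_x w) z
  convert mem_spO none false false (1 : U u α) using 1
  simp only [mc, Bool.toNat_false, pow_zero, one_mul, swap_self, map_one, mul_one]
  exact ((sd u (Option α)).σ.map_one).symm

theorem swap_none_none : (𝐬 (swap none none) : U u (Option α)) = 1 := by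
  rw [swap_self]; exact (sd u (Option α)).σ.map_one

theorem O_ind (S : Submodule ℂ (U u (Option α))) (h1 : ∀ y, inc y ∈ S)
    (h2 : ∀ y, 𝐜 none * inc y ∈ S) (h3 : ∀ y, 𝐱 none * inc y ∈ S)
    (h4 : ∀ y, 𝐜 none * 𝐱 none * inc y ∈ S)
    (h5 : ∀ a k b, inc a * 𝐬 (swap none (some k)) * inc b ∈ S) (z) : z ∈ S := by
  refine (Submodule.span_le.2 ?_ : spO u α ≤ S) (spO_top z)
  rintro _ ⟨k, a, b, y, rfl⟩
  rcases k with _ | k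
  · cases a <;> cases b <;> simp [mc, -swap_self, swap_none_none, h1, h2, h3, h4]
  · have := h5 (𝐜 k ^ a.toNat * 𝐱 k ^ b.toNat) k y
    simpa [mc] using this

end
end

section
section
variable {u : ℂ} {α : Type} [DecidableEq α] [Fintype α] (κ : ℂ)

def epsP : PM α (U u α) →ₗ[ℂ] U u α where
  toFun f := κ • f none false true + ∑ k, (f (some k) false false + 𝐱 k * f (some k) false true
    + 𝐜 k * f (some k) true false + 𝐜 k * 𝐱 k * f (some k) true true)
  map_add' f g := by
    simp only [Pi.add_apply, mul_add, Finset.sum_add_distrib, smul_add]; abel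
  map_smul' k f := by
    simp [smul_add, Finset.smul_sum, smul_comm k κ]

/-- the partial trace -/
def eps : U u (Option α) →ₗ[ℂ] U u α where
  toFun h := epsP κ (ev h)
  map_add' a b := by simp [ev]
  map_smul' k a := by simp [ev]

theorem eps_def (h : U u (Option α)) : eps κ h = epsP κ (ev h) := rfl

theorem eps_inc_r (h : U u (Option α)) (y : U u α) : eps κ (h * inc y) = eps κ h * y := by
  rw [eps_def, ev_mul_inc, eps_def]
  simp [epsP, Rm, add_mul, Finset.sum_mul, mul_assoc]

theorem eps_mc_none (a b) : eps κ (mc (none : Option α) a b : U u (Option α)) =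
    if a = false ∧ b = true then algebraMap ℂ _ κ else 0 := by
  have := ev_mc (none : Option α) a b (1 : U u α)
  rw [map_one, mul_one] at this
  rw [eps_def, this]
  cases a <;> cases b <;> simp [epsP, Bv_apply, Algebra.algebraMap_eq_smul_one]

theorem eps_mc_some (k a b) : eps κ (mc (some k : Option α) a b : U u (Option α)) =
    𝐜 k ^ a.toNat * 𝐱 k ^ b.toNat := by
  have := ev_mc (some k : Option α) a b (1 : U u α)
  rw [map_one, mul_one] at this
  rw [eps_def, this]
  cases a <;> cases b <;> simp [epsP, Bv_apply, Finset.sum_ite_eq]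

@[simp] theorem eps_one : eps κ (1 : U u (Option α)) = 0 := by
  have := eps_mc_none (u := u) (α := α) κ false false
  simpa [mc, -swap_self, swap_none_none] using this
@[simp] theorem eps_c : eps κ (𝐜 none : U u (Option α)) = 0 := by
  have := eps_mc_none (u := u) (α := α) κ true false
  simpa [mc, -swap_self, swap_none_none] using this
@[simp] theorem eps_x : eps κ (𝐱 none : U u (Option α)) = algebraMap ℂ _ κ := by
  have := eps_mc_none (u := u) (α := α) κ false true
  simpa [mc, -swap_self, swap_none_none] using this
@[simp] theorem eps_cx : eps κ (𝐜 none * 𝐱 none : U u (Option α)) = 0 := by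
  have := eps_mc_none (u := u) (α := α) κ true true
  simpa [mc, -swap_self, swap_none_none] using this
@[simp] theorem eps_s (k : α) : eps κ (𝐬 (swap none (some k)) : U u (Option α)) = 1 := by
  have := eps_mc_some (u := u) (α := α) κ k false false
  simpa [mc] using this

@[simp] theorem eps_inc (y : U u α) : eps κ (inc y) = 0 := by
  have := eps_inc_r κ 1 y
  simpa using this

theorem eps_l_ext {T S : U u (Option α) →ₗ[ℂ] U u α} (hT : ∀ h y, T (h * inc y) = T h * y)
    (hS : ∀ h y, S (h * inc y) = S h * y) (h : ∀ k a b, T (mc k a b) = S (mc k a b)) : T = S := by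
  refine LinearMap.ext fun z => ?_
  have : spO u α ≤ LinearMap.eqLocus T S := by
    refine Submodule.span_le.2 ?_
    rintro _ ⟨k, a, b, y, rfl⟩
    change T _ = S _
    rw [hT, hS, h]
  exact this (spO_top z)

/-- left linearity is tested on coset monomials -/
theorem eps_left_of (g : U u α) (h : ∀ k a b, eps κ (inc g * mc k a b) = g * eps κ (mc k a b))
    (z : U u (Option α)) : eps κ (inc g * z) = g * eps κ z := by
  have := eps_l_ext (T := (eps κ).comp (LinearMap.mulLeft ℂ (inc g)))
    (S := (LinearMap.mulLeft ℂ g).comp (eps κ)) ?_ ?_ h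
  · exact congrArg (fun f => f z) this
  · intro h y; simp [← mul_assoc, eps_inc_r]
  · intro h y; simp [← mul_assoc, eps_inc_r]

theorem eps_left_c (i : α) (z : U u (Option α)) : eps κ (𝐜 (some i) * z) = 𝐜 i * eps κ z := by
  rw [← inc_c]
  refine eps_left_of κ _ (fun k a b => ?_) z
  rw [inc_c]
  rcases k with _ | k
  · have h1 : (𝐜 (some i) * mc none a b : U u (Option α)) =
        (sgn a) • (mc none a b * inc (𝐜 i)) := by
      have h2 := (sd u (Option α)).c_anti (some i) none (by simp)
      have h3 := (sd u (Option α)).xc none (some i) (by simp)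
      rw [inc_c]
      cases a <;> cases b <;> simp [mc, sgn, -swap_self, swap_none_none, h2, h3, ← mul_assoc]
      rw [mul_assoc, mul_assoc, h3]
    rw [h1, map_smul, eps_inc_r, eps_mc_none]
    cases a <;> cases b <;> simp [sgn, Algebra.commutes]
  · by_cases h : k = i
    · subst h
      have h1 : (𝐜 (some k) * mc (some k) a b : U u (Option α)) =
        (sgn a) • (mc (some k) (!a) b) := by
        cases a <;> simp [mc, sgn, ← mul_assoc, (sd u (Option α)).c_sq]
      rw [h1, map_smul, eps_mc_some, eps_mc_some]
      cases a <;> simp [sgn, ← mul_assoc, (sd u α).c_sq]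
    · have h1 : (𝐜 (some i) * mc (some k) a b : U u (Option α)) =
        (sgn a) • (mc (some k) a b * inc (𝐜 i)) := by
        have h2 := (sd u (Option α)).c_anti (some i) (some k) (by simpa using Ne.symm h)
        have h3 := (sd u (Option α)).xc (some k) (some i) (by simpa using h)
        have h4 : (𝐬 (swap none (some k)) * 𝐜 (some i) : U u (Option α)) =
            𝐜 (some i) * 𝐬 (swap none (some k)) := by
          rw [(sd u (Option α)).σc, swap_apply_of_ne_of_ne (by simp) (by simpa using Ne.symm h)]
        rw [inc_c]
        cases a <;> cases b <;> simp [mc, sgn, h2, ← mul_assoc]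
        · rw [h4]
        · linear_combination (norm := noncomm_ring) - 𝐱 (some k) * h4 - h3 * 𝐬 (swap none (some k))
        · linear_combination (norm := noncomm_ring) - 𝐜 (some k) * h4
        · linear_combination (norm := noncomm_ring) - 𝐜 (some k) * 𝐱 (some k) * h4 - 𝐜 (some k)
            * h3 * 𝐬 (swap none (some k))
      rw [h1, map_smul, eps_inc_r, eps_mc_some]
      have h2 := (sd u α).c_anti i k (by simpa using Ne.symm h)
      have h3 := (sd u α).xc k i (by simpa using h)
      cases a <;> cases b <;> simp [sgn, h2, h3, ← mul_assoc]
      rw [mul_assoc, h3, ← mul_assoc]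

theorem eps_left_s (v : Perm α) (z : U u (Option α)) :
    eps κ (inc (𝐬 v) * z) = 𝐬 v * eps κ z := by
  refine eps_left_of κ _ (fun k a b => ?_) z
  have h1 : (inc (𝐬 v) * mc k a b : U u (Option α)) = mc (optionCongr v k) a b * inc (𝐬 v) := by
    rw [inc_s]
    have hs : (𝐬 (optionCongr v) * 𝐬 (swap none k) : U u (Option α)) =
        𝐬 (swap none (optionCongr v k)) * 𝐬 (optionCongr v) := by
      rw [← map_mul, ← map_mul, mul_swap_eq_swap_mul]; rfl
    unfold mc
    rw [mul_assoc _ _ (𝐬 (optionCongr v)), ← hs]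
    cases a <;> cases b <;> simp only [Bool.toNat_false, Bool.toNat_true, pow_zero, pow_one,
      one_mul, mul_one, ← mul_assoc, (sd u (Option α)).σc, (sd u (Option α)).σx]
    rw [mul_assoc _ (𝐬 (optionCongr v)), (sd u (Option α)).σx]; simp only [← mul_assoc]
  rw [h1, eps_inc_r]
  rcases k with _ | k
  · change eps κ (mc none a b) * _ = _
    rw [eps_mc_none]; split_ifs <;> simp [Algebra.commutes]
  · change eps κ (mc (some (v k)) a b) * _ = _
    rw [eps_mc_some, eps_mc_some]
    cases a <;> cases b <;> simp [← mul_assoc, (sd u α).σc, (sd u α).σx]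
    rw [mul_assoc _ (𝐬 v), (sd u α).σx]; simp only [← mul_assoc]

theorem eps_xs (k : α) : eps κ (𝐱 (some k) * 𝐬 (swap none (some k)) : U u (Option α)) = 𝐱 k := by
  have := eps_mc_some (u := u) (α := α) κ k false true
  simpa [mc] using this

theorem eps_left_x (i : α) (z : U u (Option α)) : eps κ (𝐱 (some i) * z) = 𝐱 i * eps κ z := by
  rw [← inc_x]
  refine eps_left_of κ _ (fun k a b => ?_) z
  rw [inc_x]
  rcases k with _ | k
  · have key : ∀ b, eps κ (𝐱 (some i) * mc none false b : U u (Option α)) =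
        𝐱 i * eps κ (mc none false b : U u (Option α)) ∧
        eps κ (𝐜 none * 𝐱 (some i) * mc none false b : U u (Option α)) = 0 := by
      intro b
      cases b
      · simp only [mc, Bool.toNat_false, pow_zero, one_mul, swap_none_none, mul_one, ← inc_x]
        rw [eps_inc_r]; simp [-inc_x]
      · simp only [mc, Bool.toNat_false, Bool.toNat_true, pow_one, pow_zero, one_mul,
          swap_none_none, mul_one]
        have hxx := (sd u (Option α)).xx (some i) none (by simp)
        have hs := (sd u (Option α)).σc (swap none (some i)) (some i)
        have hsx := (sd u (Option α)).σx (swap none (some i)) (some i)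
        rw [swap_apply_right] at hs hsx
        have hcx := (sd u (Option α)).xc (some i) none (by simp)
        have hcc := (sd u (Option α)).c_anti (some i) none (by simp)
        have hc2 := (sd u (Option α)).c_sq none
        unfold PreSD.D at hxx
        rw [swap_comm (some i) none] at hxx
        set s : U u (Option α) := 𝐬 (swap none (some i)) with hs'
        have e1 : (𝐱 (some i) * 𝐱 none : U u (Option α)) = 𝐱 none * inc (𝐱 i) + 𝐱 (some i) * s
           + 𝐜 (some i) * (𝐱 (some i) * s * inc (𝐜 i)) - s * inc (𝐱 i)
           + 𝐜 (some i) * (s * inc (𝐜 i * 𝐱 i)) := by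
          simp only [map_mul, inc_c, inc_x]
          linear_combination (norm := noncomm_ring) hxx - 𝐜 (some i) * hcx * s - 𝐜 (some i) *
            𝐱 (some i) * hs + hsx - 𝐜 (some i) * hs * 𝐱 (some i)
            - 𝐜 (some i) * 𝐜 none * hsx - hcc * 𝐱 none * s
        have e2 : (𝐜 none * 𝐱 (some i) * 𝐱 none : U u (Option α)) = 𝐜 none * 𝐱 none * inc (𝐱 i)
           + 𝐱 (some i) * s * inc (𝐜 i)
           + 𝐜 (some i) * (𝐱 (some i) * s) - s * inc (𝐜 i * 𝐱 i)
           + 𝐜 (some i) * (s * inc (𝐱 i)) := by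
          simp only [map_mul, inc_c, inc_x]
          have hcc' := (sd u (Option α)).c_anti none (some i) (by simp)
          linear_combination (norm := noncomm_ring) 𝐜 none * hxx - hcx * s - 𝐱 (some i) * hs
            + hcc' * 𝐜 none * 𝐱 (some i) * s - 𝐜 (some i) * hc2 * 𝐱 (some i) * s
            + hs * 𝐱 (some i) + 𝐜 none * hsx - 𝐜 (some i) * hsx - hc2 * 𝐜 (some i) * 𝐱 none * s
        rw [e1, e2]
        simp only [map_add, map_sub, eps_left_c, eps_inc_r, eps_x, eps_xs, hs', eps_s, one_mul,
          eps_cx]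
        have h1 := (sd u α).c_sq i
        have h2 := (sd u α).xc_same i
        constructor
        · linear_combination (norm := noncomm_ring) 𝐜 i * h2
            + Algebra.commutes κ (𝐱 i : U u α)
        · linear_combination (norm := noncomm_ring) h2
    cases a
    · exact (key b).1
    · have e : (𝐱 (some i) * mc none true b : U u (Option α)) =
          𝐜 none * 𝐱 (some i) * mc none false b := by
        simp only [mc, Bool.toNat_true, Bool.toNat_false, pow_one, pow_zero, one_mul]
        linear_combination (norm := noncomm_ring) (sd u (Option α)).xc (some i) none (by simp)
          * 𝐱 none ^ b.toNat * 𝐬 (swap none none)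
      rw [e, (key b).2, eps_mc_none]; simp
  · by_cases h : k = i
    · subst h
      have h1 := (sd u (Option α)).xc_same (some k)
      have h2 := (sd u (Option α)).x_sq (some k)
      have h1' := (sd u α).xc_same k
      have h2' := (sd u α).x_sq k
      have e : (𝐱 (some k) * mc (some k) a b : U u (Option α)) = (sgn a) • ((if b then u else 1) •
          mc (some k) a (!b)) := by
        cases a <;> cases b <;> simp [mc, sgn, ← mul_assoc, h1, h2, Algebra.smul_def]
        linear_combination (norm := noncomm_ring) 𝐜 (some k) * h2 * 𝐬 (swap none (some k))
          - Algebra.commutes u (𝐜 (some k) : U u (Option α)) * 𝐬 (swap none (some k))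
      rw [e, map_smul, map_smul, eps_mc_some, eps_mc_some]
      cases a <;> cases b <;> simp [sgn, ← mul_assoc, h1', h2', Algebra.smul_def]
      rw [mul_assoc _ (𝐱 _), h2', ← Algebra.commutes]
    · have hik : some i ≠ some k := by simpa using Ne.symm h
      have hs : (𝐬 (swap none (some k)) * 𝐱 (some i) : U u (Option α)) =
            𝐱 (some i) * 𝐬 (swap none (some k)) := by
          rw [(sd u (Option α)).σx, swap_apply_of_ne_of_ne (by simp) hik]
      have key : eps κ (𝐱 (some i) * mc (some k) false b : U u (Option α)) =
        𝐱 i * eps κ (mc (some k) false b : U u (Option α)) := by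
        rw [eps_mc_some]
        cases b
        · simp only [mc, Bool.toNat_false, pow_zero, one_mul, mul_one]
          rw [← hs, ← inc_x, eps_inc_r]; simp
        · simp only [mc, Bool.toNat_false, Bool.toNat_true, pow_one, pow_zero, one_mul, mul_one]
          have hxx := (sd u (Option α)).xx (some i) (some k) hik
          unfold PreSD.D at hxx
          have hss : (𝐬 (swap (some i) (some k)) * 𝐬 (swap none (some k)) : U u (Option α)) =
              𝐬 (swap none (some i)) * inc (𝐬 (swap i k)) := by
            rw [inc_swap, ← map_mul, ← map_mul, PreSD.swap3 (by simp) hik,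
              swap_mul_eq_mul_swap, swap_inv, swap_apply_right, swap_apply_of_ne_of_ne (by simp) hik,
              swap_comm (some i)]
          have hsx : (𝐱 (some k) * 𝐬 (swap none (some i)) : U u (Option α)) =
              𝐬 (swap none (some i)) * inc (𝐱 k) := by
            rw [inc_x, (sd u (Option α)).σx, swap_apply_of_ne_of_ne (by simp) hik.symm]
          have e : (𝐱 (some i) * (𝐱 (some k) * 𝐬 (swap none (some k))) : U u (Option α)) =
            𝐱 (some k) * 𝐬 (swap none (some k)) * inc (𝐱 i) +
            𝐱 (some i) * 𝐬 (swap none (some i)) * inc (𝐬 (swap i k)) +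
            𝐜 (some i) * (𝐜 (some k) * (𝐱 (some i) * 𝐬 (swap none (some i)) * inc (𝐬 (swap i k))))
            - 𝐬 (swap none (some i)) * inc (𝐱 k * 𝐬 (swap i k)) -
            𝐜 (some k) * (𝐜 (some i) * (𝐬 (swap none (some i)) * inc (𝐱 k * 𝐬 (swap i k)))) := by
            rw [inc_x] at hsx
            simp only [map_mul, inc_x]
            linear_combination (norm := noncomm_ring) hxx * 𝐬 (swap none (some k))
             - 𝐱 (some k) * hs + ((1 + 𝐜 (some i) * 𝐜 (some k)) * 𝐱 (some i) -
               (1 + 𝐜 (some k) * 𝐜 (some i)) * 𝐱 (some k)) * hss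
               - (1 + 𝐜 (some k) * 𝐜 (some i)) * hsx * inc (𝐬 (swap i k))
          rw [e]
          simp only [map_add, map_sub, eps_left_c, eps_inc_r, eps_x, eps_xs, eps_s, one_mul]
          have hxx' := (sd u α).xx i k (Ne.symm h)
          unfold PreSD.D at hxx'
          linear_combination (norm := noncomm_ring) -hxx'
      cases a
      · exact key
      · have e : (𝐱 (some i) * mc (some k) true b : U u (Option α)) =
          𝐜 (some k) * (𝐱 (some i) * mc (some k) false b) := by
          simp only [mc, Bool.toNat_true, Bool.toNat_false, pow_one, pow_zero, one_mul]
          linear_combination (norm := noncomm_ring) (sd u (Option α)).xc _ _ hik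
            * 𝐱 (some k) ^ b.toNat * 𝐬 (swap none (some k))
        rw [e, eps_left_c, key, eps_mc_some, eps_mc_some]
        simp [← mul_assoc, (sd u α).xc i k (Ne.symm h)]

theorem eps_inc_l (y : U u α) (z : U u (Option α)) : eps κ (inc y * z) = y * eps κ z := by
  refine U_ind' (fun y => ∀ z, eps κ (inc y * z) = y * eps κ z) ?_ ?_ ?_ ?_ ?_ ?_ y z
  · intro a b h1 h2 z; simp only [map_add, add_mul, h1, h2]
  · intro a b h1 h2 z; rw [map_mul inc, mul_assoc, h1, h2, mul_assoc]
  · intro k z; rw [AlgHom.commutes, ← Algebra.smul_def, map_smul, Algebra.smul_def]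
  · intro w z; exact eps_left_s κ w z
  · intro i z; rw [inc_c, eps_left_c]
  · intro i z; rw [inc_x, eps_left_x]

theorem eps_asb (a b : U u α) (k : α) :
    eps κ (inc a * 𝐬 (swap none (some k)) * inc b) = a * b := by
  rw [eps_inc_r, eps_inc_l, eps_s, mul_one]

/-- extensionality on the five types of elements -/
theorem O_ext {M : Type} [AddCommGroup M] [Module ℂ M] {S T : U u (Option α) →ₗ[ℂ] M}
    (h1 : ∀ y, S (inc y) = T (inc y))
    (h2 : ∀ y, S (𝐜 none * inc y) = T (𝐜 none * inc y))
    (h3 : ∀ y, S (𝐱 none * inc y) = T (𝐱 none * inc y))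
    (h4 : ∀ y, S (𝐜 none * 𝐱 none * inc y) = T (𝐜 none * 𝐱 none * inc y))
    (h5 : ∀ a k b, S (inc a * 𝐬 (swap none (some k)) * inc b) =
      T (inc a * 𝐬 (swap none (some k)) * inc b)) (z) : S z = T z :=
  O_ind (LinearMap.eqLocus S T) h1 h2 h3 h4 h5 z

theorem eps_par (z : U u (Option α)) : eps κ (par z) = par (eps κ z) := by
  refine O_ext (S := (eps κ).comp par.toLinearMap) (T := par.toLinearMap.comp (eps κ))
    ?_ ?_ ?_ ?_ ?_ z
  · intro y; simp [par_inc]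
  · intro y; simp [par_inc, eps_inc_r]
  · intro y; simp [par_inc, eps_inc_r]
  · intro y; simp [par_inc, eps_inc_r]
  · intro a k b; simp [par_inc, eps_asb]

theorem eps_str (z : U u (Option α)) : eps κ (𝐜 none * z) = eps κ (par z * 𝐜 none) := by
  refine O_ext (S := (eps κ).comp (LinearMap.mulLeft ℂ (𝐜 none)))
    (T := (eps κ).comp ((LinearMap.mulRight ℂ (𝐜 none)).comp par.toLinearMap)) ?_ ?_ ?_ ?_ ?_ z
  all_goals simp only [LinearMap.comp_apply, LinearMap.mulLeft_apply, LinearMap.mulRight_apply,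
    AlgHom.toLinearMap_apply, map_mul, par_c, par_x, par_s, par_inc]
  · intro y; rw [inc_par_c]
  · intro y; rw [mul_assoc (-𝐜 none), inc_par_c, neg_mul, ← mul_assoc, (sd u (Option α)).c_sq]; simp
  · intro y; rw [mul_assoc (𝐱 none), inc_par_c, ← mul_assoc, ← mul_assoc, (sd u (Option α)).xc_same,
      neg_mul, map_neg, eps_inc_r]; simp
  · intro y; rw [mul_assoc _ (inc _), inc_par_c]
    congr 1
    linear_combination (norm := noncomm_ring) 𝐜 none * (sd u (Option α)).xc_same none * inc y
  · intro a k b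
    rw [← mul_assoc, ← mul_assoc, c_inc, mul_assoc _ (𝐜 none), mul_assoc _ _ (𝐜 none), inc_par_c]
    have h1 := (sd u (Option α)).σc (swap none (some k)) (some k)
    have h2 := (sd u (Option α)).σc (swap none (some k)) none
    rw [swap_apply_right] at h1
    rw [swap_apply_left] at h2
    rw [← h1, ← mul_assoc _ (𝐜 none), mul_assoc _ _ (𝐜 none), h2, ← inc_c]
    have e1 : inc (par a) * (𝐬 (swap none (some k)) * inc (𝐜 k)) * inc b =
      inc (par a) * 𝐬 (swap none (some k)) * inc (𝐜 k * b) := by rw [map_mul]; noncomm_ring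
    have e2 : inc (par a) * (inc (𝐜 k) * 𝐬 (swap none (some k))) * inc b =
      inc (par a * 𝐜 k) * 𝐬 (swap none (some k)) * inc b := by rw [map_mul]; noncomm_ring
    rw [e1, e2, eps_asb, eps_asb, mul_assoc]

theorem eps_tw (z : U u (Option α)) : eps κ (tw z) = inc (eps κ z) := by
  refine O_ext (S := (eps κ).comp tw.toLinearMap)
    (T := inc.toLinearMap.comp (eps κ)) ?_ ?_ ?_ ?_ ?_ z
  · intro y; simp
  · intro y; simp [eps_inc_r]
  · intro y; simp [eps_inc_r]
  · intro y; simp [eps_inc_r]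
  · intro a k b; simp [eps_asb]

theorem eps_tau : eps κ (tau : U u (Option (Option α))) = 1 := eps_s κ none

theorem eps_atb (a b : U u (Option α)) : eps κ (inc a * tau * inc b) = a * b := eps_asb κ a b none

/-- trace property, first type -/
theorem tr1 (W V : U u (Option α)) : eps κ (eps κ (tau * (inc W * tau * inc V))) =
    eps κ (eps κ ((inc W * tau * inc V) * tau)) := by
  have e1 : tau * (inc W * tau * inc V) = tw W * inc V := by rw [tw_def]; noncomm_ring
  have e2 : (inc W * tau * inc V) * tau = inc W * tw V := by rw [tw_def]; noncomm_ring
  rw [e1, e2, eps_inc_r, eps_inc_l, eps_tw, eps_tw, eps_inc_l, eps_inc_r]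

theorem tr2 (W V : U u (Option α)) : eps κ (eps κ (tau * (tw W * tau * tw V))) =
    eps κ (eps κ ((tw W * tau * tw V) * tau)) := by
  have e1 : tau * (tw W * tau * tw V) = inc W * tw V := by
    rw [tw_tau, mul_assoc, tau_tau']
  have e2 : (tw W * tau * tw V) * tau = tw W * inc V := by
    rw [mul_assoc (tw W) tau, tau_tw, mul_assoc, mul_assoc, tau_tau, mul_one]
  rw [e1, e2, eps_inc_r, eps_inc_l, eps_tw, eps_tw, eps_inc_l, eps_inc_r]

theorem sw_split (k : α) : (𝐬 (swap none (some (some k))) : U u (Option (Option α))) =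
    inc (𝐬 (swap none (some k))) * tau * inc (𝐬 (swap none (some k))) := by
  rw [inc_swap, tau, ← map_mul, ← map_mul]
  congr 1
  rw [mul_swap_eq_swap_mul (swap (some none) (some (some k))) none, mul_assoc, swap_mul_self,
    mul_one, swap_apply_left, swap_apply_of_ne_of_ne] <;> simp

theorem sw_split' (k : α) : (𝐬 (swap (some none) (some (some k))) : U u (Option (Option α))) =
    tw (𝐬 (swap none (some k))) * tau * tw (𝐬 (swap none (some k))) := by
  rw [tw_swap, tau, ← map_mul, ← map_mul]
  congr 1
  rw [mul_swap_eq_swap_mul (swap none (some (some k))) none, mul_assoc, swap_mul_self,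
    mul_one, swap_apply_left, swap_apply_of_ne_of_ne, swap_comm] <;> simp

/-- supercommuting case -/
theorem tr3 (n n' : U u (Option α)) (r : ℂ) (h : tw n * inc n' = r • (inc n' * tw n))
    (h' : eps κ (n * n') = r • eps κ (n' * n)) (y : U u α) :
    eps κ (eps κ (tau * (tw n * inc (n' * inc y)))) =
    eps κ (eps κ ((tw n * inc (n' * inc y)) * tau)) := by
  have e1 : tau * (tw n * inc (n' * inc y)) = inc n * tau * inc (n' * inc y) := by
    rw [← mul_assoc, tau_tw]
  have e2 : (tw n * inc (n' * inc y)) * tau = r • (inc n' * tau * inc (n * inc y)) := by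
    have : inc (inc y) * tau = tau * inc (inc y) := (tau_inc_inc (u := u) y).symm
    rw [map_mul, map_mul, ← mul_assoc, h, mul_assoc _ (inc (inc y)), this, smul_mul_assoc,
      mul_assoc (inc n'), ← mul_assoc (tw n), tw_tau]
    simp only [mul_assoc]
  rw [e1, e2, map_smul, map_smul, eps_atb, eps_atb, ← mul_assoc, ← mul_assoc, eps_inc_r, eps_inc_r,
    h', smul_mul_assoc]

/-- the case of two `x`'s -/
theorem tr4 (n n' : U u (Option α)) (hn : n = 1 ∨ n = 𝐜 none) (hn' : n' = 1 ∨ n' = 𝐜 none)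
    (y : U u α) :
    eps κ (eps κ (tau * (tw (n * 𝐱 none) * inc (n' * 𝐱 none * inc y)))) =
    eps κ (eps κ ((tw (n * 𝐱 none) * inc (n' * 𝐱 none * inc y)) * tau)) := by
  have hx2 := (sd u (Option α)).x_sq none
  have hxc := (sd u (Option α)).xc_same none
  have hcs := (sd u (Option α)).c_sq none
  have hz : ∀ n n' : U u (Option α), n = 1 ∨ n = 𝐜 none → n' = 1 ∨ n' = 𝐜 none →
      eps κ (n * 𝐱 none * (n' * 𝐱 none)) = 0 := by
    rintro _ _ (rfl | rfl) (rfl | rfl)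
    · simp [hx2, Algebra.algebraMap_eq_smul_one]
    · have : (1 * 𝐱 none * (𝐜 none * 𝐱 none) : U u (Option α)) = - (u • 𝐜 none) := by
        rw [Algebra.smul_def]
        linear_combination (norm := noncomm_ring) hxc * 𝐱 none - 𝐜 none * hx2
          + Algebra.commutes u (𝐜 none : U u (Option α))
      rw [this]; simp
    · have : (𝐜 none * 𝐱 none * (1 * 𝐱 none) : U u (Option α)) = (u • 𝐜 none) := by
        rw [Algebra.smul_def]
        linear_combination (norm := noncomm_ring) 𝐜 none * hx2
          - Algebra.commutes u (𝐜 none : U u (Option α))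
      rw [this]; simp
    · have : (𝐜 none * 𝐱 none * (𝐜 none * 𝐱 none) : U u (Option α)) = (u • 1) := by
        rw [Algebra.smul_def]
        linear_combination (norm := noncomm_ring) 𝐜 none * hxc * 𝐱 none - hcs * 𝐱 none * 𝐱 none
          + hx2
      rw [this]; simp
  have e1 : tau * (tw (n * 𝐱 none) * inc (n' * 𝐱 none * inc y)) =
      inc (n * 𝐱 none) * tau * inc (n' * 𝐱 none * inc y) := by
    rw [← mul_assoc, tau_tw]
  rw [e1, eps_atb, ← mul_assoc, eps_inc_r, hz n n' hn hn', zero_mul]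
  have e2 : (tw (n * 𝐱 none) * inc (n' * 𝐱 none * inc y)) * tau =
      tw (n * 𝐱 none) * inc (n' * 𝐱 none) * tau * inc (inc y) := by
    rw [map_mul inc, mul_assoc, mul_assoc, ← tau_inc_inc]; simp only [mul_assoc]
  rw [e2, eps_inc_r, eps_inc_r]
  have hxx := (sd u (Option (Option α))).xx none (some none) (by simp)
  unfold PreSD.D at hxx
  have ht := tau_tau (u := u) (α := α)
  have hD : (𝐱 none * 𝐱 (some none) * tau : U u (Option (Option α))) =
      𝐱 (some none) * 𝐱 none * tau + (𝐱 none + 𝐜 none * 𝐜 (some none) * 𝐱 none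
        - 𝐱 (some none) - 𝐜 (some none) * 𝐜 none * 𝐱 (some none)) := by
    unfold tau at ht ⊢
    linear_combination (norm := noncomm_ring) hxx * 𝐬 (swap none (some none)) +
      (𝐱 none + 𝐜 none * 𝐜 (some none) * 𝐱 none
        - 𝐱 (some none) - 𝐜 (some none) * 𝐜 none * 𝐱 (some none)) * ht
  have h1 := (sd u (Option (Option α))).c_anti none (some none) (by simp)
  have h2 := (sd u (Option (Option α))).xc none (some none) (by simp)
  have h3 := (sd u (Option (Option α))).xc (some none) none (by simp)
  have h4 := (sd u (Option (Option α))).c_sq none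
  have h5 := (sd u (Option (Option α))).c_sq (some none)
  have h6 : (𝐱 none * tau : U u (Option (Option α))) = tau * inc (𝐱 none) := by
    rw [inc_x, tau_x]; simp
  have h7 : (𝐜 none * tau : U u (Option (Option α))) = tau * inc (𝐜 none) := by
    rw [inc_c, tau_c]; simp
  -- values
  have v1 : ∀ W : U u (Option α), W = 1 ∨ W = 𝐜 none →
      eps κ (eps κ (inc W * 𝐱 none : U u (Option (Option α)))) = 0 := by
    rintro W (rfl | rfl) <;> rw [eps_inc_l, eps_x, ← Algebra.commutes, ← Algebra.smul_def, map_smul]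
      <;> simp
  have v2 : ∀ W : U u (Option α), eps κ (inc W * (𝐜 none * 𝐱 none) : U u (Option (Option α))) = 0 := by
    intro W; rw [eps_inc_l, eps_cx, mul_zero]
  have v3 : ∀ W : U u (Option α), eps κ (𝐜 none * inc W : U u (Option (Option α))) = 0 := by
    intro W; rw [eps_inc_r, eps_c, zero_mul]
  have v4 : ∀ W : U u (Option α), eps κ (inc W * tau * inc (𝐱 none) : U u (Option (Option α))) = 
     W * 𝐱 none := by
    intro W; rw [eps_atb]
  obtain rfl | rfl := hn <;> obtain rfl | rfl := hn'
  · have e : tw (1 * 𝐱 none) * inc (1 * 𝐱 none) * tau =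
      (inc (1 * 𝐱 none) * tau * inc (1 * 𝐱 none) + inc 1 * 𝐱 none -
        inc (𝐜 none) * (𝐜 none * 𝐱 none) - inc (𝐱 none) + 𝐜 none * inc (𝐜 none * 𝐱 none) :
         U u (Option (Option α))) := by
      simp only [one_mul, tw_x, inc_x, inc_c, map_mul, map_one] at h6 h7 ⊢
      linear_combination (norm := noncomm_ring) hD + 𝐱 (some none) * h6 + h1 * 𝐱 none
         - h1 * 𝐱 (some none)
    rw [e]
    simp only [map_add, map_sub, v1 1 (Or.inl rfl), v2, v3, eps_atb, eps_inc,
      hz 1 1 (Or.inl rfl) (Or.inl rfl)]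
    simp
  · have e : tw (1 * 𝐱 none) * inc (𝐜 none * 𝐱 none) * tau =
      (inc (𝐜 none * 𝐱 none) * tau * inc (1 * 𝐱 none) + inc (𝐜 none) * 𝐱 none
        + inc 1 * (𝐜 none * 𝐱 none) - inc (𝐜 none * 𝐱 none) + 𝐜 none * inc (𝐱 none) :
         U u (Option (Option α))) := by
      simp only [one_mul, tw_x, inc_x, inc_c, map_mul, map_one] at h6 h7 ⊢
      linear_combination (norm := noncomm_ring) h2 * 𝐱 (some none) * tau + 𝐜 (some none) * hD
        + 𝐜 (some none) * 𝐱 (some none) * h6 + 𝐜 (some none) * h1 * 𝐱 none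
        - h5 * 𝐜 none * 𝐱 none - h5 * 𝐜 none * 𝐱 (some none)
    rw [e]
    simp only [map_add, map_sub, v1 _ (Or.inr rfl), v2, v3, eps_atb, eps_inc,
      hz _ _ (Or.inr rfl) (Or.inl rfl)]
    simp
  · have e : tw (𝐜 none * 𝐱 none) * inc (1 * 𝐱 none) * tau =
      (inc (1 * 𝐱 none) * tau * inc (𝐜 none * 𝐱 none) + inc 1 * (𝐜 none * 𝐱 none)
        - inc (𝐜 none) * 𝐱 none - 𝐜 none * inc (𝐱 none) - inc (𝐜 none * 𝐱 none) :
         U u (Option (Option α))) := by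
      simp only [one_mul, tw_x, tw_c, inc_x, inc_c, map_mul, map_one] at h6 h7 ⊢
      linear_combination (norm := noncomm_ring) 𝐜 none * hD - h3 * 𝐱 none * tau
        + 𝐱 (some none) * 𝐜 none * h6 + 𝐱 (some none) * h7 * 𝐱 (some none) + h4 * 𝐜 (some none) * 𝐱 none
        - h1 * 𝐜 none * 𝐱 (some none) + 𝐜 (some none) * h4 * 𝐱 (some none)
    rw [e]
    simp only [map_add, map_sub, v1 _ (Or.inr rfl), v2, v3, eps_atb, eps_inc,
      hz _ _ (Or.inl rfl) (Or.inr rfl)]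
    simp
  · have e : tw (𝐜 none * 𝐱 none) * inc (𝐜 none * 𝐱 none) * tau =
      (- (inc (𝐜 none * 𝐱 none) * tau * inc (𝐜 none * 𝐱 none)) - inc (𝐜 none) * (𝐜 none * 𝐱 none)
        - inc 1 * 𝐱 none - 𝐜 none * inc (𝐜 none * 𝐱 none) - inc (𝐱 none) :
         U u (Option (Option α))) := by
      simp only [one_mul, tw_x, tw_c, inc_x, inc_c, map_mul, map_one] at h6 h7 ⊢
      linear_combination (norm := noncomm_ring) 𝐜 none * h2 * 𝐱 (some none) * tau 
        + 𝐜 none * 𝐜 (some none) * hD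
        + h1 * 𝐱 (some none) * 𝐱 none * tau + 𝐜 (some none) * h3 * 𝐱 none * tau
        - 𝐜 (some none) * 𝐱 (some none) * 𝐜 none * h6 - 𝐜 (some none) * 𝐱 (some none) * h7 * 𝐱 (some none)
        + h1 * 𝐱 none + 𝐜 none * 𝐜 (some none) * h1 * 𝐱 none - 𝐜 none * h5 * 𝐜 none * 𝐱 none
        + h4 * 𝐱 none - 𝐜 none * h5 * 𝐜 none * 𝐱 (some none) + h4 * 𝐱 (some none)
    rw [e]
    simp only [map_add, map_sub, map_neg, v1 _ (Or.inl rfl), v2, v3, eps_atb, eps_inc,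
      hz _ _ (Or.inr rfl) (Or.inr rfl)]
    simp

theorem trn (n : U u (Option α)) (h : n = 1 ∨ n = 𝐜 none ∨ n = 𝐱 none ∨ n = 𝐜 none * 𝐱 none)
    (V : U u (Option α)) : eps κ (eps κ (tau * (tw n * inc V))) =
    eps κ (eps κ ((tw n * inc V) * tau)) := by
  refine O_ext
    (S := (eps κ).comp ((eps κ).comp ((LinearMap.mulLeft ℂ (tau * tw n)).comp inc.toLinearMap)))
    (T := (eps κ).comp ((eps κ).comp ((LinearMap.mulRight ℂ tau).comp
      ((LinearMap.mulLeft ℂ (tw n)).comp inc.toLinearMap)))) ?_ ?_ ?_ ?_ ?_ V |>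
        (fun h => by simpa [mul_assoc] using h)
  all_goals simp only [LinearMap.comp_apply, LinearMap.mulLeft_apply, LinearMap.mulRight_apply,
    AlgHom.toLinearMap_apply, mul_assoc tau]
  · intro y
    have := tr3 κ n 1 1 (by simp) (by simp) y
    simpa using this
  · intro y
    have h1 := (sd u (Option (Option α))).c_anti none (some none) (by simp)
    have h3 := (sd u (Option (Option α))).xc none (some none) (by simp)
    have h4 := (sd u (Option α)).xc_same none
    rcases h with rfl | rfl | rfl | rfl
    · exact tr3 κ _ _ 1 (by simp) (by simp) y
    · exact tr3 κ _ _ (-1) (by simp [h1]) (by simp [(sd u (Option α)).c_sq]) y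
    · exact tr3 κ _ _ 1 (by simp [h3]) (by simp [h4]) y
    · refine tr3 κ _ _ (-1) ?_ ?_ y
      · simp only [map_mul, tw_c, tw_x, inc_c, neg_smul, one_smul]
        linear_combination (norm := noncomm_ring) 𝐜 none * h3 + h1 * 𝐱 none
      · rw [← map_smul]
        congr 1
        rw [neg_smul, one_smul]
        linear_combination (norm := noncomm_ring) 𝐜 none * h4
  · intro y
    have h3 := (sd u (Option (Option α))).xc (some none) none (by simp)
    rcases h with rfl | rfl | rfl | rfl
    · exact tr3 κ _ _ 1 (by simp) (by simp) y
    · exact tr3 κ _ _ 1 (by simp [h3]) (by simp [(sd u (Option α)).xc_same]) y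
    · simpa using tr4 κ 1 1 (Or.inl rfl) (Or.inl rfl) y
    · simpa using tr4 κ _ 1 (Or.inr rfl) (Or.inl rfl) y
  · intro y
    have h1 := (sd u (Option (Option α))).c_anti none (some none) (by simp)
    have h3 := (sd u (Option (Option α))).xc (some none) none (by simp)
    have h4 := (sd u (Option α)).xc_same none
    rcases h with rfl | rfl | rfl | rfl
    · exact tr3 κ _ _ 1 (by simp) (by simp) y
    · refine tr3 κ _ _ (-1) ?_ ?_ y
      · simp only [map_mul, tw_c, tw_x, inc_c, inc_x, neg_smul, one_smul]
        linear_combination (norm := noncomm_ring) 𝐜 (some none) * h3 + h1 * 𝐱 (some none)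
      · rw [← map_smul]
        congr 1
        rw [neg_smul, one_smul]
        linear_combination (norm := noncomm_ring) 𝐜 none * h4
    · simpa using tr4 κ 1 _ (Or.inl rfl) (Or.inr rfl) y
    · exact tr4 κ _ _ (Or.inr rfl) (Or.inr rfl) y
  · intro a k b
    have := tr2 κ (n * inc a * 𝐬 (swap none (some k))) (𝐬 (swap none (some k)) * inc b)
    have e : tw (n * inc a * 𝐬 (swap none (some k))) * tau * tw (𝐬 (swap none (some k)) * inc b) =
      tw n * inc (inc a * 𝐬 (swap none (some k)) * inc b) := by
      have h := sw_split' (u := u) k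
      simp only [map_mul, tw_inc] at h ⊢
      rw [inc_swap, h]
      noncomm_ring
    rw [e] at this
    exact this

/-- trace property -/
theorem tr (z : U u (Option (Option α))) : eps κ (eps κ (tau * z)) = eps κ (eps κ (z * tau)) := by
  refine O_ext
    (S := (eps κ).comp ((eps κ).comp (LinearMap.mulLeft ℂ tau)))
    (T := (eps κ).comp ((eps κ).comp (LinearMap.mulRight ℂ tau))) ?_ ?_ ?_ ?_ ?_ z
  all_goals simp only [LinearMap.comp_apply, LinearMap.mulLeft_apply, LinearMap.mulRight_apply]
  · intro y; simpa using trn κ 1 (by simp) y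
  · intro y; simpa using trn κ _ (Or.inr (Or.inl rfl)) y
  · intro y; simpa using trn κ _ (Or.inr (Or.inr (Or.inl rfl))) y
  · intro y; simpa using trn κ _ (Or.inr (Or.inr (Or.inr rfl))) y
  · intro a k b
    rcases k with _ | k
    · exact tr1 κ a b
    · rw [sw_split]
      have := tr1 κ (a * 𝐬 (swap none (some k))) (𝐬 (swap none (some k)) * b)
      simpa only [map_mul, mul_assoc] using this

end
end

section
section
variable {u : ℂ} {α : Type} [DecidableEq α]

abbrev SW (p : α) : U u (Option α) := 𝐬 (swap none (some p))
abbrev TB (p : α) : U u (Option (Option α)) := 𝐬 (swap none (some (some p)))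
abbrev TA (p : α) : U u (Option (Option α)) := 𝐬 (swap (some none) (some (some p)))

theorem inc_SW (p : α) : (inc (SW p) : U u (Option (Option α))) = TA p := inc_swap _ _
theorem tw_SW (p : α) : (tw (SW p) : U u (Option (Option α))) = TB p := tw_swap _

theorem SW_sq (p : α) : (SW p * SW p : U u (Option α)) = 1 := (sd u _).ss _ _

theorem SW_c_some (p : α) : (SW p * 𝐜 (some p) : U u (Option α)) = 𝐜 none * SW p := by
  rw [(sd u _).σc]; simp
theorem SW_c_none (p : α) : (SW p * 𝐜 none : U u (Option α)) = 𝐜 (some p) * SW p := by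
  rw [(sd u _).σc]; simp
theorem SW_x_some (p : α) : (SW p * 𝐱 (some p) : U u (Option α)) = 𝐱 none * SW p := by
  rw [(sd u _).σx]; simp
theorem SW_x_none (p : α) : (SW p * 𝐱 none : U u (Option α)) = 𝐱 (some p) * SW p := by
  rw [(sd u _).σx]; simp
theorem SW_c_ne {p i : α} (h : i ≠ p) : (SW p * 𝐜 (some i) : U u (Option α)) = 𝐜 (some i) * SW p := by
  rw [(sd u _).σc, swap_apply_of_ne_of_ne (by simp) (by simpa using h)]
theorem SW_x_ne {p i : α} (h : i ≠ p) : (SW p * 𝐱 (some i) : U u (Option α)) = 𝐱 (some i) * SW p := by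
  rw [(sd u _).σx, swap_apply_of_ne_of_ne (by simp) (by simpa using h)]
theorem SW_s (p : α) (w : Perm α) : (inc (𝐬 w) * SW p : U u (Option α)) = SW (w p) * inc (𝐬 w) := by
  rw [inc_s, SW, SW, (sd u _).σσ, (sd u _).σσ, mul_swap_eq_swap_mul]; simp

/-- permutation identities -/
theorem pi1 (q : α) : (TB q * TA q : U u (Option (Option α))) = TA q * tau := by
  simp only [tau, TB, TA, (sd u _).σσ]
  congr 1; ext1 z; simp only [Perm.mul_apply, swap_apply_def]; grind
theorem pi2 (p : α) : (tau * TA p * TB p : U u (Option (Option α))) = TA p := by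
  simp only [tau, TB, TA, (sd u _).σσ]
  congr 1; ext1 z; simp only [Perm.mul_apply, swap_apply_def]; grind
theorem pi3 {p p' : α} (h : p ≠ p') : (TA p * TB p' : U u (Option (Option α))) = TB p' * TA p := by
  simp only [tau, TB, TA, (sd u _).σσ]
  congr 1; ext1 z; simp only [Perm.mul_apply, swap_apply_def]; grind
theorem pi4 {p p' : α} (h : p ≠ p') : (TA p * TB p' * inc (inc (𝐬 (swap p p'))) : U u (Option (Option α)))
    = tau * (TA p * TB p') := by
  simp only [inc_swap, tau, TB, TA, (sd u _).σσ]
  congr 1; ext1 z; simp only [Perm.mul_apply, swap_apply_def]; grind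
theorem pi5 {p p' : α} (h : p ≠ p') : (inc (inc (𝐬 (swap p p'))) * (TA p * TB p') : U u (Option (Option α)))
    = (TA p * TB p') * tau := by
  simp only [inc_swap, tau, TB, TA, (sd u _).σσ]
  congr 1; ext1 z; simp only [Perm.mul_apply, swap_apply_def]; grind
theorem pi6 {p p' : α} (h : p ≠ p') : (TA p * inc (inc (𝐬 (swap p p'))) * TB p : U u (Option (Option α)))
    = TA p * TB p' * inc (inc (𝐬 (swap p p'))) := by
  simp only [inc_swap, tau, TB, TA, (sd u _).σσ]
  congr 1; ext1 z; simp only [Perm.mul_apply, swap_apply_def]; grind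
theorem pi7 {p p' : α} (h : p ≠ p') : (TB p * inc (inc (𝐬 (swap p p'))) * TA p : U u (Option (Option α)))
    = inc (inc (𝐬 (swap p p'))) * TA p * TB p' := by
  simp only [inc_swap, tau, TB, TA, (sd u _).σσ]
  congr 1; ext1 z; simp only [Perm.mul_apply, swap_apply_def]; grind
theorem pi8 (p : α) : (tau * TA p : U u (Option (Option α))) = TB p * tau := by
  simp only [tau, TB, TA, (sd u _).σσ]
  congr 1; ext1 z; simp only [Perm.mul_apply, swap_apply_def]; grind
theorem pi9 (p : α) : (tau * TB p : U u (Option (Option α))) = TA p * tau := by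
  simp only [tau, TB, TA, (sd u _).σσ]
  congr 1; ext1 z; simp only [Perm.mul_apply, swap_apply_def]; grind

variable [Fintype α] (κ : ℂ)

def Φ (q : α) (a : U u (Option α)) : Module.End ℂ (U u α) where
  toFun h := eps κ (a * inc h * SW q)
  map_add' x y := by simp [mul_add, add_mul]
  map_smul' x y := by simp

theorem Φ_apply (q : α) (a : U u (Option α)) (h : U u α) : Φ κ q a h = eps κ (a * inc h * SW q) := rfl

theorem Φ_add (q : α) (a b : U u (Option α)) : Φ κ q (a + b) = Φ κ q a + Φ κ q b := by
  ext h; simp [Φ_apply, add_mul]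
theorem Φ_neg (q : α) (a : U u (Option α)) : Φ κ q (-a) = - Φ κ q a := by
  ext h; simp [Φ_apply]
theorem Φ_sub (q : α) (a b : U u (Option α)) : Φ κ q (a - b) = Φ κ q a - Φ κ q b := by
  ext h; simp [Φ_apply, sub_mul]

theorem Φ_one (q : α) : Φ κ q (1 : U u (Option α)) = 1 := by
  ext h; rw [Φ_apply, one_mul, eps_inc_l, eps_s]; simp

def Lm (y : U u α) : Module.End ℂ (U u α) := LinearMap.mulLeft ℂ y
@[simp] theorem Lm_apply (y h : U u α) : Lm y h = y * h := rfl
theorem Lm_mul (a b : U u α) : Lm (a * b) = Lm a * Lm b := by ext; simp [mul_assoc]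
def Rr (y : U u α) : Module.End ℂ (U u α) := LinearMap.mulRight ℂ y
@[simp] theorem Rr_apply (y h : U u α) : Rr y h = h * y := rfl

theorem Φ_Lm (q : α) (a : U u (Option α)) (y : U u α) : Φ κ q a * Lm y = Φ κ q (a * inc y) := by
  ext h; simp [Φ_apply, mul_assoc]
theorem Lm_Φ (q : α) (a : U u (Option α)) (y : U u α) : Lm y * Φ κ q a = Φ κ q (inc y * a) := by
  ext h; simp only [Module.End.mul_apply, Lm_apply, Φ_apply, ← eps_inc_l, mul_assoc]

theorem Φ2 (q1 q2 : α) (a b : U u (Option α)) (h : U u α) :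
    Φ κ q1 a (Φ κ q2 b h) = eps κ (eps κ (inc a * tw b * inc (inc h) * (TB q2 * TA q1))) := by
  rw [Φ_apply, Φ_apply, ← eps_tw, ← eps_inc_l, ← eps_inc_r, inc_SW]
  simp only [map_mul, tw_inc, tw_SW, mul_assoc]

theorem ΦΦ (q : α) (a b : U u (Option α)) :
    Φ κ q a * Φ κ q b = Φ κ q (eps κ (tau * inc a * tw b)) := by
  ext h
  rw [Module.End.mul_apply, Φ2, pi1, ← mul_assoc _ _ tau, ← tr, Φ_apply, mul_assoc, mul_assoc, mul_assoc,
    ← inc_SW, ← map_mul inc, ← mul_assoc, ← mul_assoc, eps_inc_r]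

theorem inc_x_SW (p : α) : (𝐱 (some none) * TB p : U u (Option (Option α))) = TB p * 𝐱 (some none) := by
  rw [TB, (sd u _).σx, swap_apply_of_ne_of_ne] <;> simp
theorem inc_c_SW (p : α) : (𝐜 (some none) * TB p : U u (Option (Option α))) = TB p * 𝐜 (some none) := by
  rw [TB, (sd u _).σc, swap_apply_of_ne_of_ne] <;> simp
theorem TA_x (p : α) : (TA p * 𝐱 none : U u (Option (Option α))) = 𝐱 none * TA p := by
  rw [TA, (sd u _).σx, swap_apply_of_ne_of_ne] <;> simp
theorem TA_c (p : α) : (TA p * 𝐜 none : U u (Option (Option α))) = 𝐜 none * TA p := by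
  rw [TA, (sd u _).σc, swap_apply_of_ne_of_ne] <;> simp
theorem TB_x (p : α) : (TB p * 𝐱 none : U u (Option (Option α))) = 𝐱 (some (some p)) * TB p := by
  rw [TB, (sd u _).σx]; simp
theorem TB_c (p : α) : (TB p * 𝐜 none : U u (Option (Option α))) = 𝐜 (some (some p)) * TB p := by
  rw [TB, (sd u _).σc]; simp

/-- `e * e = 0` -/
theorem e_sq' (p q : α) : Φ κ q (SW p : U u _) * Φ κ q (SW p) = 0 := by
  rw [ΦΦ, inc_SW, tw_SW, pi2, ← inc_SW, eps_inc]; ext; simp [Φ_apply]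

theorem Φ_zero (q : α) : Φ κ q (0 : U u _) = 0 := by ext; simp [Φ_apply]

theorem e_c_e' (p q : α) : Φ κ q (SW p : U u _) * Lm (𝐜 p) * Φ κ q (SW p) = 0 := by
  rw [mul_assoc, Lm_Φ, ΦΦ, inc_SW, map_mul tw, tw_inc, tw_SW, inc_c, inc_c, ← TB_c, ← mul_assoc, pi2,
    ← inc_SW, eps_inc_l, eps_c, mul_zero, Φ_zero]

theorem e_x_e' (p q : α) : Φ κ q (SW p : U u _) * Lm (𝐱 p) * Φ κ q (SW p) =
    algebraMap ℂ _ κ * Φ κ q (SW p) := by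
  rw [mul_assoc, Lm_Φ, ΦΦ, inc_SW, map_mul tw, tw_inc, tw_SW, inc_x, inc_x, ← TB_x, ← mul_assoc, pi2,
    ← inc_SW, eps_inc_l, eps_x, ← Algebra.commutes]
  ext h
  simp [Φ_apply, Algebra.algebraMap_eq_smul_one]

theorem e_s_e' {p p' : α} (hp : p ≠ p') (q : α) :
    Φ κ q (SW p : U u _) * Lm (𝐬 (swap p p')) * Φ κ q (SW p) = Φ κ q (SW p) := by
  have h : (tau * TA p * (inc (inc (𝐬 (swap p p'))) * TB p) : U u (Option (Option α)))
      = TA p * TB p' := by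
    rw [mul_assoc, ← mul_assoc (TA p), pi6 hp, pi4 hp, tau_tau']
  rw [mul_assoc, Lm_Φ, ΦΦ, inc_SW, map_mul tw, tw_inc, tw_SW, h, ← inc_SW, eps_inc_l, eps_s, mul_one]

theorem tauh (h : U u α) (z) : (tau * (inc (inc h) * z) : U u (Option (Option α))) = inc (inc h) * (tau * z) := by
  rw [← mul_assoc, tau_inc_inc, mul_assoc]

/-- `e * e'` for the right transposition -/
theorem e_sb_e' {q q' : α} (hq : q ≠ q') (p : α) :
    Φ κ q (SW p : U u _) * Rr (𝐬 (swap q q')) * Φ κ q (SW p) = Φ κ q (SW p) := by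
  ext h
  have h0 : Rr (𝐬 (swap q q')) (Φ κ q (SW p : U u _) h) = 
      eps κ (SW p * inc h * (SW q * inc (𝐬 (swap q q')))) := by
    rw [← mul_assoc, eps_inc_r]; rfl
  have h1 : (TA p * TB p : U u (Option (Option α))) = tau * TA p := by
    rw [← pi2 p, ← mul_assoc, ← mul_assoc, tau_tau, one_mul, pi2]
  have h2 : (TB q * inc (inc (𝐬 (swap q q'))) * TA q * tau : U u (Option (Option α))) = TA q * TB q' := by
    rw [pi7 hq, mul_assoc, mul_assoc, ← mul_assoc (TA q), ← pi5 hq, ← mul_assoc, ← map_mul, ← map_mul, 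
      (sd u _).ss]; simp
  rw [mul_assoc, Module.End.mul_apply, Module.End.mul_apply, h0, Φ_apply, ← eps_tw, ← eps_inc_l, ← eps_inc_r, inc_SW, inc_SW]
  simp only [map_mul, tw_inc, tw_SW]
  calc _ = eps κ (eps κ (tau * (TA p * inc (inc h) * (TB q * inc (inc (𝐬 (swap q q'))) * TA q)))) := by
        congr 2
        linear_combination (norm := noncomm_ring) h1 * inc (inc h) * TB q * inc (inc (𝐬 (swap q q'))) * TA q
    _ = eps κ (eps κ (TA p * inc (inc h) * (TA q * TB q'))) := by
        rw [tr, mul_assoc, h2]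
    _ = _ := by
        rw [← inc_SW, ← inc_SW, ← mul_assoc, ← map_mul inc, ← map_mul inc, eps_inc_l, eps_s, mul_one, Φ_apply]

def Cb (q : α) : Module.End ℂ (U u α) := Rr (𝐜 q) * par.toLinearMap
theorem Cb_apply (q : α) (h : U u α) : Cb q h = par h * 𝐜 q := rfl

theorem par_SW (q : α) : (par (SW q) : U u (Option α)) = SW q := par_s _

theorem e_c1' (p q : α) : Φ κ q (SW p : U u _) * Lm (𝐜 p) = Φ κ q (SW p) * Cb q := by
  ext h
  rw [Module.End.mul_apply, Module.End.mul_apply, Φ_apply, Φ_apply, Cb_apply, Lm_apply, map_mul inc, map_mul inc,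
    inc_c, inc_c, ← mul_assoc, SW_c_some, mul_assoc, mul_assoc, eps_str, map_mul par, map_mul par, par_SW, par_SW,
    par_inc, mul_assoc, mul_assoc, SW_c_none]
  simp only [mul_assoc]

theorem c1_e' (p q : α) : Lm (𝐜 p) * Φ κ q (SW p : U u _) = Cb q * Φ κ q (SW p) := by
  ext h
  rw [Module.End.mul_apply, Module.End.mul_apply, Φ_apply, Cb_apply, Lm_apply, ← eps_par, ← eps_inc_l,
    ← eps_inc_r, map_mul par, map_mul par, par_SW, par_SW, par_inc, inc_c, inc_c]
  congr 1
  have h3 := c_inc h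
  have h4 := SW_c_some (u := u) q
  have h5 := SW_c_none (u := u) p
  linear_combination (norm := noncomm_ring) - h5 * (inc h * SW q) + SW p * h3 * SW q - SW p * inc (par h) * h4

theorem Cb_Φ (q j : α) (a : U u (Option α)) (h : U u α) : (Cb j * Φ κ q a : Module.End ℂ (U u α)) h = eps κ (par a * inc (par h) * SW q * 𝐜 (some j)) := by
  rw [Module.End.mul_apply, Cb_apply, Φ_apply, ← eps_par, ← eps_inc_r, map_mul par, map_mul par, par_SW, par_inc, inc_c]

theorem Φ_Cb (q j : α) (a : U u (Option α)) (h : U u α) : (Φ κ q a * Cb j : Module.End ℂ (U u α)) h = eps κ (a * inc (par h) * 𝐜 (some j) * SW q) := by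
  rw [Module.End.mul_apply, Cb_apply, Φ_apply, map_mul inc, inc_c, ← mul_assoc a]

theorem Cb_e_comm {q j : α} (hj : j ≠ q) (a : U u (Option α)) (ha : par a = a) :
    Cb j * Φ κ q a = Φ κ q a * Cb j := by
  ext h
  rw [Cb_Φ, Φ_Cb, ha, mul_assoc _ (SW q), SW_c_ne hj, ← mul_assoc]

/-- the double contraction -/
def F2 (p p' q q' : α) (h : U u α) : U u α :=
  eps κ (eps κ (TA p * TB p' * inc (inc h) * (TA q * TB q')))

theorem F2_eq {p p' q q' : α} (hp : p ≠ p') (hq : q ≠ q') (h : U u α) :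
    (Φ κ q (SW p) * Lm (𝐬 (swap p p')) * Rr (𝐬 (swap q q')) * Φ κ q (SW p) : Module.End ℂ (U u α)) h
      = F2 κ p p' q q' (𝐬 (swap p p') * h * 𝐬 (swap q q')) := by
  have h0 : Rr (𝐬 (swap q q')) (Φ κ q (SW p : U u _) h) = 
      eps κ (SW p * inc h * (SW q * inc (𝐬 (swap q q')))) := by
    rw [← mul_assoc, eps_inc_r]; rfl
  simp only [Module.End.mul_apply]
  rw [h0, Lm_apply, Φ_apply, map_mul inc, ← eps_tw, ← mul_assoc, ← eps_inc_l, ← eps_inc_r, inc_SW, F2]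
  simp only [map_mul, tw_inc, tw_SW, inc_SW]
  congr 2
  have e1 := pi6 (u := u) hp
  have e2 := pi7 (u := u) hq
  linear_combination (norm := noncomm_ring) e1 * (inc (inc h) * TB q * inc (inc (𝐬 (swap q q'))) * TA q)
    + (TA p * TB p' * inc (inc (𝐬 (swap p p'))) * inc (inc h)) * e2

theorem F2_1 {p p' q q' : α} (hp : p ≠ p') (hq : q ≠ q') (h : U u α) :
    F2 κ p p' q q' (𝐬 (swap p p') * h) = F2 κ p p' q q' (h * 𝐬 (swap q q')) := by
  have e1 := pi4 (u := u) hp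
  have e2 := pi5 (u := u) hq
  unfold F2
  simp only [map_mul]
  calc _ = eps κ (eps κ (tau * (TA p * TB p' * inc (inc h) * (TA q * TB q')))) := by
        congr 2
        linear_combination (norm := noncomm_ring) e1 * (inc (inc h) * (TA q * TB q'))
    _ = _ := by
        rw [tr]; congr 2
        linear_combination (norm := noncomm_ring) - (TA p * TB p' * inc (inc h)) * e2

theorem F2_2 {p p' q q' : α} (hp : p ≠ p') (hq : q ≠ q') (h : U u α) :
    𝐬 (swap p p') * F2 κ p p' q q' h = F2 κ p p' q q' h * 𝐬 (swap q q') := by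
  have e1 := pi5 (u := u) hp
  have e2 := pi4 (u := u) hq
  unfold F2
  rw [← eps_inc_l, ← eps_inc_l, ← eps_inc_r, ← eps_inc_r]
  congr 2
  linear_combination (norm := noncomm_ring) e1 * (inc (inc h) * (TA q * TB q')) - (TA p * TB p' * inc (inc h)) * e2
    + (TA p * TB p') * tau_inc_inc h * (TA q * TB q')

theorem e_xsum' (p q : α) : Φ κ q (SW p : U u _) * (Lm (𝐱 p) - Φ κ q (𝐱 none)) = 0 := by
  rw [mul_sub, ΦΦ, Φ_Lm, ← Φ_sub, tw_x, inc_SW, mul_assoc, TA_x, ← mul_assoc, tau_x, swap_apply_left,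
    ← inc_SW, ← inc_x, eps_atb, inc_x, SW_x_some, sub_self, Φ_zero]

theorem xsum_e' (p q : α) : (Lm (𝐱 p) - Φ κ q (𝐱 none)) * Φ κ q (SW p : U u _) = 0 := by
  have e : (tau * inc (𝐱 none) * tw (SW p) : U u (Option (Option α))) = inc (SW p) * tau * inc (𝐱 none) := by
    rw [tw_SW, inc_x, inc_SW, mul_assoc, inc_x_SW, ← mul_assoc, pi9]
  rw [sub_mul, ΦΦ, Lm_Φ, ← Φ_sub, e, eps_atb, inc_x, SW_x_none, sub_self, Φ_zero]

theorem e_xp_comm {p i : α} (h : i ≠ p) (q : α) : Φ κ q (SW p : U u _) * Lm (𝐱 i) = Lm (𝐱 i) * Φ κ q (SW p) := by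
  rw [Φ_Lm, Lm_Φ, inc_x, SW_x_ne h]
theorem e_cp_comm {p i : α} (h : i ≠ p) (q : α) : Lm (𝐜 i) * Φ κ q (SW p : U u _) = Φ κ q (SW p) * Lm (𝐜 i) := by
  rw [Φ_Lm, Lm_Φ, inc_c, SW_c_ne h]
theorem e_s_comm {p : α} {w : Perm α} (h : w p = p) (q : α) : 
    Lm (𝐬 w) * Φ κ q (SW p : U u _) = Φ κ q (SW p) * Lm (𝐬 w) := by
  rw [Φ_Lm, Lm_Φ, SW_s, h]
theorem Φ_sb_comm {q : α} {w : Perm α} (h : w q = q) (a : U u (Option α)) : 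
    Rr (𝐬 w) * Φ κ q a = Φ κ q a * Rr (𝐬 w) := by
  ext z
  rw [Module.End.mul_apply, Module.End.mul_apply, Φ_apply, Φ_apply, Rr_apply, Rr_apply, ← eps_inc_r,
    map_mul inc, mul_assoc _ _ (inc (𝐬 w)), ← mul_assoc a, mul_assoc _ (inc (𝐬 w)), SW_s, h]
theorem Φ_sb_conj {q q' : α} (a : U u (Option α)) : 
    Rr (𝐬 (swap q q')) * Φ κ q a * Rr (𝐬 (swap q q')) = Φ κ q' a := by
  ext z
  rw [Module.End.mul_apply, Module.End.mul_apply, Φ_apply, Φ_apply, Rr_apply, Rr_apply, ← eps_inc_r,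
    map_mul inc, ← mul_assoc a, mul_assoc _ (inc (𝐬 _)), SW_s, mul_assoc, mul_assoc, mul_assoc, ← map_mul inc, (sd u _).ss,
    swap_apply_left, map_one, mul_one, mul_assoc]

theorem x_comm_gen {β : Type} [DecidableEq β] {a b : β} (h : a ≠ b) : (𝐱 a * (𝐱 b - (1 - 𝐜 a * 𝐜 b) * 𝐬 (swap a b)) : U u β) =
    (𝐱 b - (1 - 𝐜 a * 𝐜 b) * 𝐬 (swap a b)) * 𝐱 a := by
  have e1 := (sd u β).xx a b h
  have e2 := (sd u β).xA_r h
  have e3 := (sd u β).c_anti b a h.symm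
  have e4 : (𝐬 (swap a b) * 𝐱 a : U u β) = 𝐱 b * 𝐬 (swap a b) := by rw [(sd u _).σx]; simp
  unfold PreSD.D at e1
  linear_combination (norm := noncomm_ring) e1 - e2 * 𝐬 (swap a b) + (1 - 𝐜 a * 𝐜 b) * e4
    - e3 * 𝐱 b * 𝐬 (swap a b) + 𝐱 a * e3 * 𝐬 (swap a b)

theorem x_mixed' (p q : α) : Lm (𝐱 p) * (Φ κ q (SW p : U u _) - Φ κ q (𝐱 none) - Lm (𝐜 p) * Φ κ q (SW p) * Lm (𝐜 p))
    = (Φ κ q (SW p) - Lm (𝐜 p) * Φ κ q (SW p) * Lm (𝐜 p) - Φ κ q (𝐱 none)) * Lm (𝐱 p) := by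
  have h := x_comm_gen (u := u) (a := some p) (b := none) (by simp)
  have h2 := SW_c_some (u := u) p
  rw [Lm_Φ, Φ_Lm, ← Φ_sub, ← Φ_sub, Lm_Φ, ← Φ_sub, ← Φ_sub, Φ_Lm]
  congr 1
  rw [swap_comm] at h
  simp only [inc_c, inc_x, mul_assoc, h2]
  linear_combination (norm := noncomm_ring) - h

theorem xb_sq' (q : α) : Φ κ q (𝐱 none : U u (Option α)) * Φ κ q (𝐱 none) = algebraMap ℂ _ (u + κ) := by
  have hD : ((sd u (Option (Option α))).D (some none) none) = ((1 + 𝐜 (some none) * 𝐜 none) * 𝐱 (some none) -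
     (1 + 𝐜 none * 𝐜 (some none)) * 𝐱 none) * tau := by
    unfold PreSD.D tau; rw [swap_comm]
  have e1 := (sd u (Option (Option α))).xx (some none) none (by simp)
  have e2 : (tau * 𝐱 none : U u (Option (Option α))) = 𝐱 (some none) * tau := by simp [tau_x]
  have e3 : (tau * 𝐱 (some none) : U u (Option (Option α))) = 𝐱 none * tau := by simp [tau_x]
  have e4 : (tau * 𝐜 none : U u (Option (Option α))) = 𝐜 (some none) * tau := by simp [tau_c]
  have e5 : (tau * 𝐜 (some none) : U u (Option (Option α))) = 𝐜 none * tau := by simp [tau_c]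
  have e6 := (sd u (Option (Option α))).c_anti none (some none) (by simp)
  have key : (tau * 𝐱 (some none) * 𝐱 none : U u (Option (Option α))) = inc (𝐱 none) * tau * inc (𝐱 none) + (𝐱 none - 
     inc (𝐜 none) * (𝐜 none * 𝐱 none)) - inc (𝐱 none) - inc (𝐜 none) * (𝐜 none * inc (𝐱 none)) := by
    rw [hD] at e1
    simp only [inc_x, inc_c]
    linear_combination (norm := noncomm_ring) tau * e1 + e2 * 𝐱 (some none) + e3 * tau - e2 * tau
      + e5 * 𝐜 none * 𝐱 (some none) * tau + 𝐜 none * e4 * 𝐱 (some none) * tau + 𝐜 none * 𝐜 (some none) * e3 * tau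
      - e4 * 𝐜 (some none) * 𝐱 none * tau - 𝐜 (some none) * e5 * 𝐱 none * tau - 𝐜 (some none) * 𝐜 none * e2 * tau
      + (𝐱 none - 𝐱 (some none) + 𝐜 none * 𝐜 (some none) * 𝐱 none - 𝐜 (some none) * 𝐜 none * 𝐱 (some none)) * tau_tau (u := u) (α := α)
      + e6 * 𝐱 none
  rw [ΦΦ, tw_x, inc_x, key]
  rw [map_sub, map_sub, map_add, map_sub, eps_atb, eps_inc, eps_x, eps_inc_l, eps_cx, eps_inc_l, eps_inc_r, eps_c,
    (sd u _).x_sq]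
  simp only [mul_zero, zero_mul, sub_zero, ← map_add]
  ext h; rw [Φ_apply, Algebra.algebraMap_eq_smul_one, smul_mul_assoc, smul_mul_assoc, one_mul, map_smul,
    eps_inc_l, eps_s, mul_one]; simp [Algebra.algebraMap_eq_smul_one]

theorem xb_cb_same (q : α) : Φ κ q (𝐱 none : U u (Option α)) * Cb q = - (Cb q * Φ κ q (𝐱 none)) := by
  ext h
  rw [LinearMap.neg_apply, Cb_Φ, Φ_Cb, par_x]
  have h1 : (𝐱 none * inc (par h) * 𝐜 (some q) * SW q : U u (Option α)) = par (𝐱 none * inc h * SW q) * 𝐜 none := by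
    rw [map_mul, map_mul, par_SW, par_x, par_inc, mul_assoc _ _ (SW q), ← SW_c_none]; simp only [mul_assoc]
  rw [h1, ← eps_str, ← map_neg]; congr 1
  have h2 := (sd u (Option α)).xc_same none
  have h3 := c_inc h
  have h4 := SW_c_some (u := u) q
  linear_combination (norm := noncomm_ring) h2 * inc h * SW q - 𝐱 none * h3 * SW q + 𝐱 none * inc (par h) * h4

theorem e_xbb {q q' : α} (hq : q ≠ q') (p : α) : Φ κ q (SW p : U u _) * Φ κ q' (𝐱 none) = Φ κ q' (𝐱 none) * Φ κ q (SW p) := by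
  ext h
  rw [Module.End.mul_apply, Module.End.mul_apply, Φ2, Φ2, tw_x, tw_SW, inc_SW, inc_x]
  have e3 : (tau * 𝐱 (some none) : U u (Option (Option α))) = 𝐱 none * tau := by simp [tau_x]
  calc _ = eps κ (eps κ (tau * (𝐱 (some none) * TB p * inc (inc h) * (TB q * TA q') * tau))) := by
        congr 2
        linear_combination (norm := noncomm_ring) - e3 * (TB p * inc (inc h) * (TB q * TA q') * tau)
          - 𝐱 none * pi9 p * (inc (inc h) * (TB q * TA q') * tau)
          - 𝐱 none * TA p * tau_inc_inc h * (TB q * TA q') * tau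
          - 𝐱 none * TA p * inc (inc h) * pi9 q * TA q' * tau
          - 𝐱 none * TA p * inc (inc h) * TA q * pi8 q' * tau
          - 𝐱 none * TA p * inc (inc h) * TA q * TB q' * tau_tau (u := u) (α := α)
          + TA_x p * inc (inc h) * (TB q' * TA q) - 𝐱 none * TA p * inc (inc h) * pi3 hq
    _ = _ := by rw [tr, mul_assoc _ tau tau, tau_tau, mul_one]

theorem xb_T0 {q q' : α} (hq : q ≠ q') (h : U u α) :
    Φ κ q' (𝐱 none) (Φ κ q (𝐱 none) h) =
      eps κ (eps κ (𝐱 none * 𝐱 (some none) * inc (inc h) * (TA q * TB q'))) := by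
  rw [Φ2, tw_x, inc_x]
  have e3 : (tau * 𝐱 (some none) : U u (Option (Option α))) = 𝐱 none * tau := by simp [tau_x]
  have e4 : (tau * 𝐱 none : U u (Option (Option α))) = 𝐱 (some none) * tau := by simp [tau_x]
  symm
  calc _ = eps κ (eps κ (tau * (𝐱 (some none) * 𝐱 none * inc (inc h) * (TB q * TA q') * tau))) := by
        congr 2
        linear_combination (norm := noncomm_ring) - e3 * (𝐱 none * inc (inc h) * (TB q * TA q') * tau)
          - 𝐱 none * e4 * (inc (inc h) * (TB q * TA q') * tau)
          - 𝐱 none * 𝐱 (some none) * tau_inc_inc h * (TB q * TA q') * tau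
          - 𝐱 none * 𝐱 (some none) * inc (inc h) * pi9 q * TA q' * tau
          - 𝐱 none * 𝐱 (some none) * inc (inc h) * TA q * pi8 q' * tau
          - 𝐱 none * 𝐱 (some none) * inc (inc h) * TA q * TB q' * tau_tau (u := u) (α := α)
    _ = _ := by rw [tr, mul_assoc _ tau tau, tau_tau, mul_one]

theorem inc_x_none : (inc (𝐱 none) : U u (Option (Option α))) = 𝐱 (some none) := inc_x _
theorem inc_c_none' : (inc (𝐜 none) : U u (Option (Option α))) = 𝐜 (some none) := inc_c _

theorem cc_move {q q' : α} (hq : q ≠ q') (h : U u α) :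
    ((1 + 𝐜 (some none) * 𝐜 none) * 𝐱 (some none) * inc (inc h) * (TA q * TB q') : U u (Option (Option α)))
     = 𝐱 (some none) * inc (inc h) * (TA q * TB q') * inc (inc (1 - 𝐜 q * 𝐜 q')) := by
  have h1 := (sd u (Option (Option α))).xc_same (some none)
  have h2 := (sd u (Option (Option α))).xc (some none) none (by simp)
  have h3 : (𝐜 none * inc (inc h) : U u (Option (Option α))) = inc (inc (par h)) * 𝐜 none := by
    rw [c_inc, par_inc]
  have h4 : (𝐜 (some none) * inc (inc (par h)) : U u (Option (Option α))) = inc (inc h) * 𝐜 (some none) := by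
    rw [← inc_c_none', ← map_mul inc, c_inc, par_par, map_mul]
  have h5 : (TB q' * 𝐜 (some (some q')) : U u (Option (Option α))) = 𝐜 none * TB q' := SW_c_some _
  have h6 : (TB q' * 𝐜 (some (some q)) : U u (Option (Option α))) = 𝐜 (some (some q)) * TB q' :=
    SW_c_ne (by simpa using hq)
  have h7 : (TA q * 𝐜 (some (some q)) : U u (Option (Option α))) = 𝐜 (some none) * TA q := by
    rw [TA, (sd u _).σc]; simp
  have h8 := TA_c (u := u) q
  simp only [map_sub, map_one, map_mul, inc_c]
  linear_combination (norm := noncomm_ring) 𝐜 (some none) * (- h2) * (inc (inc h) * (TA q * TB q'))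
    + h1 * 𝐜 none * (inc (inc h) * (TA q * TB q'))
    - 𝐱 (some none) * 𝐜 (some none) * h3 * (TA q * TB q')
    - 𝐱 (some none) * h4 * 𝐜 none * (TA q * TB q')
    + 𝐱 (some none) * inc (inc h) * 𝐜 (some none) * h8 * TB q'
    + 𝐱 (some none) * inc (inc h) * TA q * h6 * 𝐜 (some (some q'))
    + 𝐱 (some none) * inc (inc h) * h7 * TB q' * 𝐜 (some (some q'))
    + 𝐱 (some none) * inc (inc h) * 𝐜 (some none) * TA q * h5

theorem eps_ATB (q q' : α) (A : U u (Option α)) (B : U u α) (hq : q ≠ q') :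
    eps κ (eps κ (inc A * (TA q * TB q') * inc (inc B))) = eps κ (A * SW q) * B := by
  rw [eps_inc_r, eps_inc_r, pi3 hq, ← inc_SW, ← mul_assoc]
  rw [← eps_asb κ A (SW q) (some q')]

theorem K_apply (q q' : α) (hq : q ≠ q') (h : U u α) :
    ((1 + Cb q * Cb q') * Rr (𝐬 (swap q q')) : Module.End ℂ (U u α)) h =
      h * 𝐬 (swap q q') * (1 + 𝐜 q * 𝐜 q') := by
  have := (sd u α).c_anti q q' hq
  simp only [Module.End.mul_apply, LinearMap.add_apply, Module.End.one_apply, Cb_apply, Rr_apply, map_mul, par_par,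
    par_s, par_c]
  linear_combination (norm := noncomm_ring) - h * 𝐬 (swap q q') * this

theorem xb_str {q q' : α} (hq : q ≠ q') (g : U u α) :
    eps κ (𝐱 none * inc (g * (1 + 𝐜 q * 𝐜 q')) * SW q) = eps κ (𝐱 none * inc g * SW q) * (1 - 𝐜 q * 𝐜 q') := by
  have h1 := congrArg (fun T : Module.End ℂ (U u α) => T (par g)) (xb_cb_same (u := u) κ q)
  simp only [LinearMap.neg_apply] at h1
  rw [Φ_Cb, Cb_Φ, par_par, par_x, ← inc_c, eps_inc_r] at h1
  have h2 : (𝐱 none * inc (g * (1 + 𝐜 q * 𝐜 q')) * SW q : U u (Option α)) =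
     𝐱 none * inc g * SW q + 𝐱 none * inc g * inc (𝐜 q) * SW q * inc (𝐜 q') := by
    have := SW_c_ne (u := u) hq.symm
    simp only [map_mul, map_add, map_one, inc_c]
    linear_combination (norm := noncomm_ring) - 𝐱 none * inc g * 𝐜 (some q) * this
  rw [h2, map_add, eps_inc_r, h1]
  noncomm_ring

theorem ring_neg_aux {R : Type} [Ring R] {a b k : R} (h : a * b + a * k = b * a + k * a) :
    (-a) * (-b - k) = (-b - k) * (-a) := by
  linear_combination (norm := noncomm_ring) h

theorem xb_comm' {q q' : α} (hq : q ≠ q') : (- Φ κ q (𝐱 none : U u (Option α))) *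
      (- Φ κ q' (𝐱 none) - (1 + Cb q * Cb q') * Rr (𝐬 (swap q q'))) =
     (- Φ κ q' (𝐱 none) - (1 + Cb q * Cb q') * Rr (𝐬 (swap q q'))) * (- Φ κ q (𝐱 none)) := by
  suffices H : ∀ h : U u α, Φ κ q (𝐱 none) (Φ κ q' (𝐱 none) h) + Φ κ q (𝐱 none) (((1 + Cb q * Cb q') * Rr (𝐬 (swap q q')) : Module.End ℂ (U u α)) h)
     = Φ κ q' (𝐱 none) (Φ κ q (𝐱 none) h) + ((1 + Cb q * Cb q') * Rr (𝐬 (swap q q')) : Module.End ℂ (U u α)) (Φ κ q (𝐱 none) h) by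
    have H' : Φ κ q (𝐱 none) * Φ κ q' (𝐱 none) + Φ κ q (𝐱 none) * ((1 + Cb q * Cb q') * Rr (𝐬 (swap q q')))
      = Φ κ q' (𝐱 none) * Φ κ q (𝐱 none) + ((1 + Cb q * Cb q') * Rr (𝐬 (swap q q'))) * Φ κ q (𝐱 none : U u (Option α)) := by
      ext h; exact H h
    exact ring_neg_aux H'
  intro h
  rw [K_apply _ _ hq, K_apply _ _ hq, xb_T0 κ hq, Φ2, tw_x, inc_x_none, ← pi3 hq, Φ_apply κ q (𝐱 none) (_ * _), xb_str κ hq]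
  have hD : ((sd u (Option (Option α))).D (some none) none) = ((1 + 𝐜 (some none) * 𝐜 none) * 𝐱 (some none) -
     (1 + 𝐜 none * 𝐜 (some none)) * 𝐱 none) * tau := by
    unfold PreSD.D tau; rw [swap_comm]
  have e1 := (sd u (Option (Option α))).xx (some none) none (by simp)
  rw [hD] at e1
  have e2 : (tau * 𝐱 none : U u (Option (Option α))) = 𝐱 (some none) * tau := by simp [tau_x]
  have e3 : (tau * 𝐱 (some none) : U u (Option (Option α))) = 𝐱 none * tau := by simp [tau_x]
  have e4 : (tau * 𝐜 none : U u (Option (Option α))) = 𝐜 (some none) * tau := by simp [tau_c]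
  have e5 : (tau * 𝐜 (some none) : U u (Option (Option α))) = 𝐜 none * tau := by simp [tau_c]
  have T1 : ((1 + 𝐜 (some none) * 𝐜 none) * 𝐱 (some none) * tau * inc (inc h) * (TA q * TB q') : U u (Option (Option α)))
     = inc (𝐱 none * inc h) * (TA q * TB q') * inc (inc ((1 - 𝐜 q * 𝐜 q') * 𝐬 (swap q q'))) := by
    have := cc_move (u := u) hq h
    have h9 := pi4 (u := u) hq
    simp only [map_mul inc, inc_x_none]
    linear_combination (norm := noncomm_ring) this * inc (inc (𝐬 (swap q q'))) + 
      ((1 + 𝐜 (some none) * 𝐜 none) * 𝐱 (some none)) * tau_inc_inc h * (TA q * TB q')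
      - ((1 + 𝐜 (some none) * 𝐜 none) * 𝐱 (some none)) * inc (inc h) * h9
  have T2 : ((1 + 𝐜 none * 𝐜 (some none)) * 𝐱 none * tau * inc (inc h) * (TA q * TB q') : U u (Option (Option α)))
     = tau * ((1 + 𝐜 (some none) * 𝐜 none) * 𝐱 (some none) * inc (inc h) * (TA q * TB q')) := by
    linear_combination (norm := noncomm_ring) (- (e3 + e5 * 𝐜 none * 𝐱 (some none) + 𝐜 none * e4 * 𝐱 (some none) + 
       𝐜 none * 𝐜 (some none) * e3)) * (inc (inc h) * (TA q * TB q'))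
  have T3 : ((1 + 𝐜 (some none) * 𝐜 none) * 𝐱 (some none) * inc (inc h) * (TA q * TB q') * tau : U u (Option (Option α)))
     = inc (𝐱 none * inc (h * 𝐬 (swap q q'))) * (TA q * TB q') * inc (inc (1 - 𝐜 q * 𝐜 q')) := by
    rw [mul_assoc, ← pi5 hq, ← mul_assoc, mul_assoc _ (inc (inc h)), ← map_mul, ← map_mul, cc_move hq]
    simp only [map_mul, inc_x_none]
  have key : (𝐱 (some none) * 𝐱 none * inc (inc h) * (TA q * TB q') : U u (Option (Option α))) =
     𝐱 none * 𝐱 (some none) * inc (inc h) * (TA q * TB q') + 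
      inc (𝐱 none * inc h) * (TA q * TB q') * inc (inc ((1 - 𝐜 q * 𝐜 q') * 𝐬 (swap q q')))
      - tau * ((1 + 𝐜 (some none) * 𝐜 none) * 𝐱 (some none) * inc (inc h) * (TA q * TB q')) := by
    rw [← T1, ← T2]
    linear_combination (norm := noncomm_ring) e1 * (inc (inc h) * (TA q * TB q'))
  rw [key, map_sub, map_sub, map_add, map_add, tr, T3, eps_ATB κ _ _ _ _ hq, eps_ATB κ _ _ _ _ hq, Φ_apply]
  have f1 : (𝐬 (swap q q') * 𝐜 q : U u α) = 𝐜 q' * 𝐬 (swap q q') := by rw [(sd u _).σc]; simp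
  have f2 : (𝐬 (swap q q') * 𝐜 q' : U u α) = 𝐜 q * 𝐬 (swap q q') := by rw [(sd u _).σc]; simp
  have f3 := (sd u α).c_anti q q' hq
  have f4 : (𝐬 (swap q q') * (1 + 𝐜 q * 𝐜 q') : U u α) = (1 - 𝐜 q * 𝐜 q') * 𝐬 (swap q q') := by
    linear_combination (norm := noncomm_ring) f1 * 𝐜 q' + 𝐜 q' * f2 + f3 * 𝐬 (swap q q')
  rw [mul_assoc (eps _ _) (𝐬 _), f4]
  noncomm_ring

end
end

section
section
variable {r t : ℕ}

def pl (w : Perm (Fin r)) : Perm (Fin r ⊕ Fin t) := Equiv.sumCongr w 1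
def pb (w : Perm (Fin t)) : Perm (Fin r ⊕ Fin t) := Equiv.sumCongr 1 w
@[simp] theorem pl_inl (w : Perm (Fin r)) (i) : (pl w : Perm (Fin r ⊕ Fin t)) (Sum.inl i) = Sum.inl (w i) := rfl
@[simp] theorem pl_inr (w : Perm (Fin r)) (i) : (pl w : Perm (Fin r ⊕ Fin t)) (Sum.inr i) = Sum.inr i := rfl
@[simp] theorem pb_inl (w : Perm (Fin t)) (i) : (pb w : Perm (Fin r ⊕ Fin t)) (Sum.inl i) = Sum.inl i := rfl
@[simp] theorem pb_inr (w : Perm (Fin t)) (i) : (pb w : Perm (Fin r ⊕ Fin t)) (Sum.inr i) = Sum.inr (w i) := rfl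
theorem pl_mul (v w : Perm (Fin r)) : (pl (v * w) : Perm (Fin r ⊕ Fin t)) = pl v * pl w := by
  ext z; cases z <;> rfl
theorem pb_mul (v w : Perm (Fin t)) : (pb (v * w) : Perm (Fin r ⊕ Fin t)) = pb v * pb w := by
  ext z; cases z <;> rfl
@[simp] theorem pl_one : (pl 1 : Perm (Fin r ⊕ Fin t)) = 1 := by ext z; cases z <;> rfl
@[simp] theorem pb_one : (pb 1 : Perm (Fin r ⊕ Fin t)) = 1 := by ext z; cases z <;> rfl
theorem pl_swap (a b : Fin r) : (pl (swap a b) : Perm (Fin r ⊕ Fin t)) = swap (Sum.inl a) (Sum.inl b) := by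
  ext1 z; cases z <;> simp [swap_apply_def] <;> grind
theorem pb_swap (a b : Fin t) : (pb (swap a b) : Perm (Fin r ⊕ Fin t)) = swap (Sum.inr a) (Sum.inr b) := by
  ext1 z; cases z <;> simp [swap_apply_def] <;> grind
theorem pl_inv (v : Perm (Fin r)) : (pl v⁻¹ : Perm (Fin r ⊕ Fin t)) = (pl v)⁻¹ := by
  rw [eq_inv_iff_mul_eq_one, ← pl_mul]; simp
theorem pb_inv (v : Perm (Fin t)) : (pb v⁻¹ : Perm (Fin r ⊕ Fin t)) = (pb v)⁻¹ := by
  rw [eq_inv_iff_mul_eq_one, ← pb_mul]; simp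

theorem sw_eq {n a b : ℕ} (ha : a < n) (hb : b < n) : sw n a b = swap ⟨a, ha⟩ ⟨b, hb⟩ := by
  simp [sw, ha, hb]
theorem sw_inv (n a b : ℕ) : (sw n a b)⁻¹ = sw n a b := by
  unfold sw; split_ifs <;> simp
end

theorem algebraMap_comm {A : Type} [Ring A] [Algebra ℂ A] (k : ℂ) (a : A) :
   algebraMap ℂ A k * a = a * algebraMap ℂ A k := Algebra.commutes _ _

section
variable {u : ℂ} {α : Type} [DecidableEq α] [Fintype α] (κ : ℂ)

theorem Lm_one : Lm (1 : U u α) = 1 := by ext; simp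
theorem Rr_one : Rr (1 : U u α) = 1 := by ext; simp
theorem Rr_mul (a b : U u α) : Rr (a * b) = Rr b * Rr a := by ext; simp [mul_assoc]
theorem Lm_neg (a : U u α) : Lm (-a) = - Lm a := by ext; simp
theorem Lm_sub (a b : U u α) : Lm (a-b) = Lm a - Lm b := by ext; simp [sub_mul]
theorem Lm_alg (k : ℂ) : Lm (algebraMap ℂ (U u α) k) = algebraMap ℂ _ k := by
  ext; simp [Algebra.smul_def]
theorem Lm_Rr (a b : U u α) : Lm a * Rr b = Rr b * Lm a := by ext; simp [mul_assoc]
theorem Lm_pow (a : U u α) (k : ℕ) : Lm (a^k) = Lm a ^ k := by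
  induction k with
  | zero => simp [Lm_one]
  | succ k ih => rw [pow_succ, pow_succ, Lm_mul, ih]

theorem Lm_sq (p : α) : (Lm (𝐱 p : U u α)) * Lm (𝐱 p) = algebraMap ℂ _ u := by
  rw [← Lm_mul, (sd u α).x_sq, Lm_alg]

theorem pow_even {A : Type} [Ring A] [Algebra ℂ A] {a : A} {v : ℂ} (h : a * a = algebraMap ℂ A v) (k : ℕ) :
    a ^ (2 * k) = algebraMap ℂ A (v^k) := by rw [pow_mul, pow_two, h, map_pow]
theorem pow_odd {A : Type} [Ring A] [Algebra ℂ A] {a : A} {v : ℂ} (h : a * a = algebraMap ℂ A v) (k : ℕ) :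
    a ^ (2 * k+1) = algebraMap ℂ A (v^k) * a := by rw [pow_succ, pow_even h]

theorem ring_aux1 {R : Type} [Ring R] {e x y k : R} (h : e * (x - y) = 0) (h2 : e * x * e = k * e) :
    e * (-y) * e = - k * e := by
  have : e * y = e * x := by rw [mul_sub, sub_eq_zero] at h; exact h.symm
  rw [mul_neg, this, neg_mul, h2, neg_mul]

theorem ring_assoc5 {R : Type} [Ring R] (a e l b f : R) : a * e * l * b * f = a * (e * l * b * f) := by
  simp only [mul_assoc]
theorem ring_neg1 {R : Type} [Ring R] (a b c : R) : a * (-b) * c = - (a * b * c) := by simp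
theorem ring_nc {R : Type} [Ring R] {a b : R} (h : a * b = b * a) : (-a) * b = b * (-a) := by simp [h]
theorem ring_nc' {R : Type} [Ring R] {a b : R} (h : a * b = b * a) : b * (-a) = (-a) * b:= by simp [h]
theorem ring_na {R : Type} [Ring R] {a b : R} (h : a * b = - (b * a)) : (-a) * b = -(b * (-a)) := by simp [h]
theorem ring_nn {R : Type} [Ring R] {a b : R} (h : a * a = b) : (-a) * (-a) = b := by simp [h]
theorem cong_mul1 {R : Type} [Ring R] {a b c d: R} (h : a = b) : c * a * d = c * b * d := by rw [h]

end

section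
variable (u κ : ℂ) (r t : ℕ) (hr : 0 < r) (ht : 0 < t) 

def repW : WBC ℂ (Module.End ℂ (U u (Fin r ⊕ Fin t))) r t where
  σ := { toFun := fun w => Lm (𝐬 (pl w)), map_one' := by simp [Lm_one], map_mul' := by 
            intro x y; rw [pl_mul, map_mul, Lm_mul] }
  σb := { toFun := fun w => Rr (𝐬 (pb w⁻¹)), map_one' := by simp [Rr_one], map_mul' := by 
            intro x y; rw [mul_inv_rev, pb_mul, map_mul, Rr_mul] }
  c := fun i => Lm (𝐜 (Sum.inl i))
  cb := fun i => Cb (Sum.inr i)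
  e := Φ κ (Sum.inr ⟨0, ht⟩) (SW (Sum.inl ⟨0,hr⟩))
  c_sq := by intro i; rw [← Lm_mul, (sd u _).c_sq, Lm_neg, Lm_one]
  c_anti := by intro i j h; rw [← Lm_mul, ← Lm_mul, (sd u _).c_anti _ _ (by simpa using h), Lm_neg]
  c_conj := by 
    intro w i
    show Lm _ * Lm _ * Lm _ = _
    rw [← Lm_mul, ← Lm_mul, (sd u _).σc, mul_assoc, ← map_mul, ← pl_mul]; simp
  cb_sq := by
    intro i; ext h
    simp [Module.End.mul_apply, Cb_apply, mul_assoc, (sd u _).c_sq]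
  cb_anti := by
    intro i j h; ext z
    have := (sd u (Fin r ⊕ Fin t)).c_anti (Sum.inr i) (Sum.inr j) (by simpa using h)
    simp [Module.End.mul_apply, Cb_apply, mul_assoc, this]
  cb_conj := by
    intro w i; ext h
    show (Rr _ * Cb _ * Rr _ : Module.End ℂ (U u (Fin r ⊕ Fin t))) _ = _
    simp only [Module.End.mul_apply, Cb_apply, Rr_apply, map_mul, par_s, mul_assoc]
    rw [← mul_assoc (𝐬 _), (sd u _).σc, mul_assoc, ← map_mul, ← pb_mul]; simp
  comm_σσb := by intro w v; exact Lm_Rr _ _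
  comm_σcb := by
    intro w j; ext h
    show (Lm _ * Cb _ : Module.End ℂ (U u (Fin r ⊕ Fin t))) _ = (Cb _ * Lm _ : Module.End ℂ (U u (Fin r ⊕ Fin t))) _
    simp [Module.End.mul_apply, Cb_apply, mul_assoc]
  comm_σbc := by intro w v; exact (Lm_Rr _ _).symm
  anti_ccb := by
    intro w j; ext h
    simp [Module.End.mul_apply, Cb_apply, mul_assoc]
  e_c1 := by intro _ _; exact e_c1' _ _ _
  c1_e := by intro _ _; exact c1_e' _ _ _
  e_sq := e_sq' _ _ _
  e_s_e := by
    intro h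
    show _ * Lm _ * _ = _
    rw [sw_eq hr h, pl_swap, e_s_e' _ (by simp)]
  e_sb_e := by
    intro h
    show _ * Rr _ * _ = _
    rw [sw_inv, sw_eq ht h, pb_swap, e_sb_e' _ (by simp)]
  s_e_comm := by
    intro i hi h
    refine e_s_comm _ ?_ _
    rw [sw_eq (by omega) h, pl_inl, swap_apply_of_ne_of_ne] <;> simp; omega
  sb_e_comm := by
    intro i hi h
    refine Φ_sb_comm _ ?_ _
    rw [sw_inv, sw_eq (by omega) h, pb_inr, swap_apply_of_ne_of_ne] <;> simp; omega
  braid1 := by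
    intro h1 h2
    ext h
    show ((_ * Lm _ * Rr _ * _) * Lm _ : Module.End ℂ (U u (Fin r ⊕ Fin t))) _ = ((_ * Lm _ * Rr _ * _) * Rr _ : Module.End ℂ (U u (Fin r ⊕ Fin t))) _
    rw [sw_inv, sw_eq hr h1, sw_eq ht h2, pl_swap, pb_swap, Module.End.mul_apply, F2_eq _ (by simp) (by simp),
      Module.End.mul_apply, F2_eq _ (by simp) (by simp), Lm_apply, Rr_apply, ← mul_assoc, (sd u _).ss]
    rw [mul_assoc (𝐬 _) _ (𝐬 _), mul_assoc h (𝐬 _) (𝐬 _), (sd u _).ss, F2_1 _ (by simp) (by simp), one_mul, mul_one]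
  braid2 := by
    intro h1 h2
    ext h
    show (Lm _ * _ * Lm _ * Rr _ * _: Module.End ℂ (U u (Fin r ⊕ Fin t))) _ = (Rr _ * _ * Lm _ * Rr _ * _ : Module.End ℂ (U u (Fin r ⊕ Fin t))) _
    rw [sw_inv, sw_eq hr h1, sw_eq ht h2, pl_swap, pb_swap]
    rw [ring_assoc5, ring_assoc5 (Rr _), Module.End.mul_apply (Lm _), Module.End.mul_apply (Rr _), F2_eq _ (by simp) (by simp), Lm_apply, Rr_apply, F2_2 _ (by simp) (by simp)]
  c_e_comm := by
    intro i h
    refine e_cp_comm _ ?_ _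
    simp [Fin.ext_iff, h]
  cb_e_comm := by
    intro i h
    refine Cb_e_comm _ ?_ _ (par_SW _)
    simp [Fin.ext_iff, h]
  e_c_e := by intro _; exact e_c_e' _ _ _
  e_cb_e := by intro _; rw [← e_c1', e_c_e']

variable (om omb : ℕ → ℂ)

def rep (h1 : om 1 = κ) (h2 : ∀ k, om (2 * k) = 0) (h3 : ∀ k, om (2*k+1) = u^k*κ) 
   (h4 : ∀ k, omb (2 * k) = 0) (h5 : ∀ k, omb (2*k+1) = -((u+κ)^k*κ)) : 
    AWBC ℂ (Module.End ℂ (U u (Fin r ⊕ Fin t))) r t κ where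
  toWBC := repW u κ r t hr ht
  x1 := Lm (𝐱 (Sum.inl ⟨0,hr⟩))
  xb1 := - Φ κ (Sum.inr ⟨0,ht⟩) (𝐱 none)
  om k := algebraMap ℂ _ (om k)
  omb k := algebraMap ℂ _ (omb k)
  om_one := by rw [h1]
  om_even := by intro k; rw [h2, map_zero]
  omb_zero := by have := h4 0; simp at this; simp [this]
  om_comm := by
    intro k; refine ⟨?_, ?_, ?_, ?_, ?_, ?_, ?_, ?_, ?_⟩ <;> intros <;> exact algebraMap_comm _ _
  omb_comm := by
    intro k; refine ⟨?_, ?_, ?_, ?_, ?_, ?_, ?_, ?_⟩ <;> intros <;> exact algebraMap_comm _ _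
  x_comm := by
    intro h
    show Lm _ * (Lm _ * Lm _ * Lm _ - (1 - Lm _ * Lm _) * Lm _) = (Lm _ * Lm _ * Lm _ - (1 - Lm _ * Lm _) * Lm _) * Lm _
    have hp : (Sum.inl ⟨0, hr⟩ : Fin r ⊕ Fin t) ≠ Sum.inl ⟨1, h⟩ := by simp
    simp only [← Lm_mul, ← Lm_one, ← Lm_sub]
    rw [sw_eq hr h, pl_swap, (sd u _).σx, swap_apply_left, mul_assoc (𝐱 _) (𝐬 _), (sd u _).ss, mul_one, x_comm_gen hp]
  x1_c1 := by
    intro _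
    show Lm _ * Lm _ = -(Lm _ * Lm _)
    rw [← Lm_mul, (sd u _).xc_same, Lm_neg, Lm_mul]
  x1_c := by
    intro i hi
    show Lm _ * Lm _ = (Lm _ * Lm _)
    rw [← Lm_mul, (sd u _).xc, Lm_mul]
    simp [Fin.ext_iff]; omega
  s_x1 := by
    intro i hi h
    show Lm _ * Lm _ = (Lm _ * Lm _)
    rw [← Lm_mul, (sd u _).σx, Lm_mul, sw_eq (by omega) h, pl_inl, swap_apply_of_ne_of_ne] <;> simp; omega
  xb_comm := by
    intro h
    show (_ * (Rr _ * _ * Rr _ - (1 + Cb _ * Cb _) * Rr _) : Module.End ℂ (U u (Fin r ⊕ Fin t))) = (Rr _ * _ * Rr _ - (1 + Cb _ * Cb _) * Rr _) * _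
    have hp : (Sum.inr ⟨0, ht⟩ : Fin r ⊕ Fin t) ≠ Sum.inr ⟨1, h⟩ := by simp
    rw [sw_inv, sw_eq ht h, pb_swap, ring_neg1 (Rr _), Φ_sb_conj, xb_comm' _ hp]
  xb1_cb1 := by
    intro _
    show _ * Cb _ = - (Cb _ * _)
    exact ring_na (xb_cb_same _ _)
  xb1_cb := by
    intro j h
    show _ * Cb _ = (Cb _ * _)
    refine ring_nc (Cb_e_comm _ ?_ _ (par_x _)).symm
    simp [Fin.ext_iff]; omega
  sb_xb1 := by
    intro i hi h
    show Rr _ * _ = _ * Rr _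
    refine ring_nc' (Φ_sb_comm _ ?_ _).symm
    rw [sw_inv, sw_eq (by omega) h, pb_inr, swap_apply_of_ne_of_ne] <;> simp; omega
  e_xsum := by
    rw [← sub_eq_add_neg]; exact e_xsum' _ _ _
  xsum_e := by
    rw [← sub_eq_add_neg]; exact xsum_e' _ _ _
  e_sxs := by
    intro h
    show _ * (Lm _ * Lm _ * Lm _) = (Lm _ * Lm _ * Lm _) * _
    rw [sw_eq hr h, pl_swap, ← Lm_mul, (sd u _).σx, swap_apply_left, ← Lm_mul, mul_assoc (𝐱 _) (𝐬 _), (sd u _).ss, mul_one]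
    exact e_xp_comm _ (by simp) _
  x_mixed := by
    intro _
    have := x_mixed' (u := u) κ (Sum.inl ⟨0,hr⟩ : Fin r ⊕ Fin t) (Sum.inr ⟨0,ht⟩)
    rw [sub_eq_add_neg (Φ _ _ (SW _)), sub_eq_add_neg _ (Φ _ _ (𝐱 none))] at this
    exact this
  e_sbxbsb := by
    intro h
    show _ * (Rr _ * _ * Rr _) = (Rr _ * _ * Rr _) * _
    have hp : (Sum.inr ⟨0, ht⟩ : Fin r ⊕ Fin t) ≠ Sum.inr ⟨1, h⟩ := by simp
    rw [sw_inv, sw_eq ht h, pb_swap, ring_neg1 (Rr _), Φ_sb_conj]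
    exact ring_nc' (e_xbb _ hp _).symm
  e_xodd := by
    intro k
    rw [pow_odd (Lm_sq _), ← mul_assoc, ← algebraMap_comm, mul_assoc, mul_assoc, ← mul_assoc _ (Lm _)]
    refine (congrArg _ (e_x_e' _ _ _)).trans ?_
    rw [h3, ← mul_assoc, map_mul]; rfl
  e_xeven := by
    intro k h
    rw [pow_even (Lm_sq _), ← algebraMap_comm, mul_assoc]
    exact (congrArg _ (e_sq' _ _ _)).trans (mul_zero _)
  e_xb := by
    intro k h
    have H : (-Φ κ (Sum.inr ⟨0,ht⟩) (𝐱 none : U u (Option (Fin r ⊕ Fin t)))) * (-Φ κ (Sum.inr ⟨0,ht⟩) (𝐱 none)) = algebraMap ℂ _ (u+κ) := by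
      exact ring_nn (xb_sq' _ _)
    rcases Nat.even_or_odd' k with ⟨l, rfl | rfl⟩
    · rw [pow_even H, h4, ← algebraMap_comm, mul_assoc, map_zero, zero_mul]
      exact (congrArg _ (e_sq' _ _ _)).trans (mul_zero _)
    · rw [pow_odd H, ← mul_assoc, ← algebraMap_comm, mul_assoc, mul_assoc]
      refine (congrArg _ ((mul_assoc _ _ _).symm.trans (ring_aux1 (e_xsum' _ _ _) (e_x_e' _ _ _)))).trans ?_
      rw [h5, ← mul_assoc, ← map_neg, ← map_mul, mul_neg]; rfl
  x1_cb_comm := by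
    intro j; ext h
    show (Lm _ * Cb _ : Module.End ℂ (U u (Fin r ⊕ Fin t))) _ = (Cb _ * Lm _ : Module.End ℂ (U u (Fin r ⊕ Fin t))) _
    simp [Module.End.mul_apply, Cb_apply, mul_assoc]
  xb1_c_comm := by
    intro i
    show _ * Lm _ = Lm _ * _
    refine ring_nc ?_
    rw [Φ_Lm, Lm_Φ, inc_c, (sd u _).xc _ _ (by simp)]
  x1_σb := by intro w; exact (Lm_Rr _ _).symm
  xb1_σ := by
    intro w
    show Lm _ * _ = _ * Lm _
    refine ring_nc' ?_
    rw [Φ_Lm, Lm_Φ, inc_s, (sd u _).σx]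
    simp
end

section
variable (ω : ℕ → ℂ) (u : ℂ)
theorem obar_one : obar ω 1 = - ω 1 := by simp [obar, acoef]
theorem obar_rec (n : ℕ) (h : ∀ k, ω (k+2) = u * ω k) : 
   obar ω (2 * (n+1) + 1) = obar ω (2*n+1) * (ω 1 + u) := by
  have e1 : (2 * (n+1) + 1) % 2 = 1 := by omega
  have e2 : (2 * (n+1) + 1) / 2 = n + 1 := by omega
  have e3 : (2 * n + 1) % 2 = 1 := by omega
  have e4 : (2 * n + 1) / 2 = n := by omega
  simp only [obar, e1, e2, e3, e4]
  rw [Finset.sum_range_succ' _ (n+1)]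
  simp only [acoef, one_ne_zero, if_false]
  rw [Finset.sum_mul, show 2 * 0 + 1 = 1 from rfl, Finset.sum_mul, ← Finset.sum_add_distrib]
  refine Finset.sum_congr rfl fun j _ => ?_
  rw [show 2 * (j+1) + 1 = 2 * j + 1 + 2 by ring, h (2*j+1)]; ring
end

def omP (m : ℕ) (p : ℂ) : ℂ := p * (p+1)

theorem omSeq_even (m : ℕ) (p : ℂ) (k : ℕ) : omSeq m p (2*k) = 0 := by
  induction k with
  | zero => rfl
  | succ k ih => 
    show p*(p+1) * omSeq m p (2*k) = 0
    rw [ih, mul_zero]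
theorem omSeq_odd (m : ℕ) (p : ℂ) (k : ℕ) : omSeq m p (2*k+1) = (p*(p+1))^k * omSeq m p 1 := by
  induction k with
  | zero => simp
  | succ k ih => 
    show p*(p+1) * omSeq m p (2*k+1) = _
    rw [ih]; ring
theorem obar_odd (m : ℕ) (p : ℂ) (k : ℕ) : obar (omSeq m p) (2*k+1) = -((p*(p+1)+omSeq m p 1)^k * omSeq m p 1) := by
  induction k with
  | zero => simp [obar_one]
  | succ k ih => 
    rw [obar_rec _ (p*(p+1)) _ (fun k => rfl), ih]; ring
theorem obar_even (m : ℕ) (p : ℂ) (k : ℕ) : obar (omSeq m p) (2*k) = 0 := by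
  simp [obar]

def repF (m : ℕ) (p : ℂ) (r t : ℕ) (hr : 0 < r) (ht : 0 < t) : 
    AWBC ℂ (Module.End ℂ (U (p*(p+1)) (Fin r ⊕ Fin t))) r t (omSeq m p 1) :=
  rep (p*(p+1)) (omSeq m p 1) r t hr ht (omSeq m p) (obar (omSeq m p)) rfl (omSeq_even m p) (omSeq_odd m p)
    (obar_even m p) (obar_odd m p)

theorem repF_spec (m : ℕ) (p : ℂ) (r t : ℕ) (hr : 0 < r) (ht : 0 < t) : (repF m p r t hr ht).IsSpec (omSeq m p) :=
  ⟨fun k => rfl, fun k _ => rfl⟩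

theorem repF_cyc (m : ℕ) (p : ℂ) (r t : ℕ) (hr : 0 < r) (ht : 0 < t) : (repF m p r t hr ht).IsCyc 
      (Polynomial.X ^ 2 - Polynomial.C (p * (p + 1)))
      (Polynomial.X ^ 2 - Polynomial.C ((p - 2 * (m : ℂ) + 1) * (p - 2 * (m : ℂ)))) := by
  constructor
  · rw [map_sub, map_pow, aeval_X, aeval_C, pow_two, sub_eq_zero]
    exact Lm_sq _
  · rw [map_sub, map_pow, aeval_X, aeval_C, pow_two, sub_eq_zero]
    show (-Φ _ _ _) * (-Φ _ _ _) = _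
    refine (ring_nn (xb_sq' _ _)).trans ?_
    congr 1
    show p*(p+1) + -2 * (m : ℂ) * (2 * p - 2 * (m : ℂ) + 1) = _
    ring
end

section
section
variable {u : ℂ} {α : Type} [DecidableEq α]

variable (u α) in
def Bs : Submonoid (U u α) := Submonoid.closure (Set.range 𝐬 ∪ Set.range 𝐜 ∪ {-1})

theorem Bs_s (w : Perm α) : 𝐬 w ∈ Bs u α := Submonoid.subset_closure (Or.inl (Or.inl ⟨w, rfl⟩))
theorem Bs_c (i : α) : 𝐜 i ∈ Bs u α := Submonoid.subset_closure (Or.inl (Or.inr ⟨i, rfl⟩))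
theorem Bs_neg {b : U u α} (h : b ∈ Bs u α) : -b ∈ Bs u α := by
  rw [neg_eq_neg_one_mul]
  exact mul_mem (Submonoid.subset_closure (Or.inr rfl)) h

theorem Bs_ind {P : U u α → Prop} (h1 : P 1) (hs : ∀ w b, b ∈ Bs u α → P b → P (𝐬 w * b))
    (hc : ∀ i b, b ∈ Bs u α → P b → P (𝐜 i * b)) (hn : ∀ b, b ∈ Bs u α → P b → P (-b)) {b} (hb : b ∈ Bs u α) : P b := by
  refine Submonoid.closure_induction_left (motive := fun b _ => P b) h1 ?_ hb
  rintro x ((⟨w, rfl⟩ | ⟨i, rfl⟩) | rfl) y hy h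
  · exact hs _ _ hy h
  · exact hc _ _ hy h
  · rw [← neg_eq_neg_one_mul]; exact hn _ hy h

theorem Bs_ind_r {P : U u α → Prop} (h1 : P 1) (hs : ∀ w b, b ∈ Bs u α → P b → P (b * 𝐬 w))
    (hc : ∀ i b, b ∈ Bs u α → P b → P (b * 𝐜 i)) (hn : ∀ b, b ∈ Bs u α → P b → P (-b)) {b} (hb : b ∈ Bs u α) : P b := by
  refine Submonoid.closure_induction_right (motive := fun b _ => P b) h1 ?_ hb
  rintro y hy x ((⟨w, rfl⟩ | ⟨i, rfl⟩) | rfl) h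
  · exact hs _ _ hy h
  · exact hc _ _ hy h
  · rw [mul_neg, mul_one]; exact hn _ hy h

theorem c_x (i j : α) : ∃ b ∈ Bs u α, (𝐜 i * 𝐱 j : U u α) = 𝐱 j * b := by
  by_cases h : j = i
  · subst h
    exact ⟨_, Bs_neg (Bs_c j), by rw [mul_neg, (sd u α).xc_same, neg_neg]⟩
  · exact ⟨_, Bs_c i, by rw [(sd u α).xc _ _ h]⟩

theorem Bs_x {b : U u α} (hb : b ∈ Bs u α) : ∀ i, ∃ j, ∃ b' ∈ Bs u α, b * 𝐱 i = 𝐱 j * b' := by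
  refine Bs_ind (P := fun b => ∀ i, ∃ j, ∃ b' ∈ Bs u α, b * 𝐱 i = 𝐱 j * b') ?_ ?_ ?_ ?_ hb
  · intro i; exact ⟨i, 1, one_mem _, by simp⟩
  · intro w b hb h i
    obtain ⟨j, b', hb', e⟩ := h i
    exact ⟨w j, 𝐬 w * b', mul_mem (Bs_s _) hb', by rw [mul_assoc, e, ← mul_assoc, (sd u α).σx, mul_assoc]⟩
  · intro k b hb h i
    obtain ⟨j, b', hb', e⟩ := h i
    obtain ⟨b2, hb2, e2⟩ := c_x (u := u) k j
    exact ⟨j, b2 * b', mul_mem hb2 hb', by rw [mul_assoc, e, ← mul_assoc, e2, mul_assoc]⟩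
  · intro b hb h i
    obtain ⟨j, b', hb', e⟩ := h i
    exact ⟨j, -b', Bs_neg hb', by rw [neg_mul, e, mul_neg]⟩

variable (u) in
def Xl (l : List α) : U u α := (l.map 𝐱).prod
@[simp] theorem Xl_nil : Xl u ([] : List α) = 1 := rfl
@[simp] theorem Xl_cons (i : α) (l : List α) : Xl u (i :: l) = 𝐱 i * Xl u l := by simp [Xl]
@[simp] theorem Xl_append (l l' : List α) : Xl u (l ++ l') = Xl u l * Xl u l' := by simp [Xl]

theorem Bs_Xl (l : List α) : ∀ {b : U u α} (hb : b ∈ Bs u α), ∃ l' : List α, l'.length = l.length ∧ 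
    ∃ b' ∈ Bs u α, b * Xl u l = Xl u l' * b' := by
  induction l with
  | nil => intro b hb; exact ⟨[], rfl, b, hb, by simp⟩
  | cons i l ih =>
    intro b hb
    obtain ⟨j, b', hb', e⟩ := Bs_x hb i
    obtain ⟨l', hl', b2, hb2, e2⟩ := ih hb'
    exact ⟨j :: l', by simp [hl'], b2, hb2, by rw [Xl_cons, ← mul_assoc, e, mul_assoc, e2, Xl_cons, mul_assoc]⟩

variable (u α) in
def F (n : ℕ) : Submodule ℂ (U u α) :=
  Submodule.span ℂ {z | ∃ l : List α, ∃ b ∈ Bs u α, l.length < n ∧ z = Xl u l * b}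

theorem F_word {n : ℕ} {l : List α} (h : l.length < n) {b : U u α} (hb : b ∈ Bs u α) : Xl u l * b ∈ F u α n :=
  Submodule.subset_span ⟨l, b, hb, h, rfl⟩

theorem F_mono {m n : ℕ} (h : m ≤ n) : F u α m ≤ F u α n := by
  refine Submodule.span_mono ?_
  rintro z ⟨l, b, hb, hl, rfl⟩
  exact ⟨l, b, hb, by omega, rfl⟩

theorem F_ind {n : ℕ} {S : Submodule ℂ (U u α)} (h : ∀ l : List α, ∀ b ∈ Bs u α, l.length < n → Xl u l * b ∈ S) :
    F u α n ≤ S := by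
  refine Submodule.span_le.2 ?_
  rintro z ⟨l, b, hb, hl, rfl⟩
  exact h l b hb hl

theorem F_lin {β : Type} [DecidableEq β] {n m : ℕ} (T : U u α →ₗ[ℂ] U u β) 
    (h : ∀ l : List α, ∀ b ∈ Bs u α, l.length < n → T (Xl u l * b) ∈ F u β m) {z} (hz : z ∈ F u α n) : T z ∈ F u β m :=
  F_ind (S := (F u β m).comap T) h hz

theorem word_mul (l l' : List α) {b b' : U u α} (hb : b ∈ Bs u α) (hb' : b' ∈ Bs u α) :
    ∃ l2 : List α, l2.length = l.length + l'.length ∧ ∃ b2 ∈ Bs u α, (Xl u l * b) * (Xl u l' * b') = Xl u l2 * b2 := by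
  obtain ⟨l2, hl2, b2, hb2, e⟩ := Bs_Xl l' hb
  refine ⟨l ++ l2, by simp [hl2], b2 * b', mul_mem hb2 hb', ?_⟩
  rw [mul_assoc, ← mul_assoc b, e, Xl_append]; simp only [mul_assoc]

theorem F_mul_word {n : ℕ} {z : U u α} (hz : z ∈ F u α n) (l : List α) {b : U u α} (hb : b ∈ Bs u α) :
    z * (Xl u l * b) ∈ F u α (n + l.length) := by
  refine F_lin (LinearMap.mulRight ℂ (Xl u l * b)) ?_ hz
  intro l' b' hb' h
  obtain ⟨l2, h2, b2, hb2, e⟩ := word_mul l' l hb' hb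
  rw [LinearMap.mulRight_apply, e]
  exact F_word (by omega) hb2

theorem word_mul_F {n : ℕ} {z : U u α} (hz : z ∈ F u α n) (l : List α) {b : U u α} (hb : b ∈ Bs u α) :
    (Xl u l * b) * z ∈ F u α (n + l.length) := by
  refine F_lin (LinearMap.mulLeft ℂ (Xl u l * b)) ?_ hz
  intro l' b' hb' h
  obtain ⟨l2, h2, b2, hb2, e⟩ := word_mul l l' hb hb'
  rw [LinearMap.mulLeft_apply, e]
  exact F_word (by omega) hb2

theorem F_mul_b {n : ℕ} {z : U u α} (hz : z ∈ F u α n) {b : U u α} (hb : b ∈ Bs u α) : z * b ∈ F u α n := by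
  simpa using F_mul_word hz [] hb
theorem b_mul_F {n : ℕ} {z : U u α} (hz : z ∈ F u α n) {b : U u α} (hb : b ∈ Bs u α) : b * z ∈ F u α n := by
  simpa using word_mul_F hz [] hb
theorem F_mul_Xl {n : ℕ} {z : U u α} (hz : z ∈ F u α n) (l : List α) : z * Xl u l ∈ F u α (n + l.length) := by
  simpa using F_mul_word hz l (one_mem _)
theorem Xl_mul_F {n : ℕ} {z : U u α} (hz : z ∈ F u α n) (l : List α) : Xl u l * z ∈ F u α (n + l.length) := by
  simpa using word_mul_F hz l (one_mem _)
theorem F_mul_x {n : ℕ} {z : U u α} (hz : z ∈ F u α n) (i : α) : z * 𝐱 i ∈ F u α (n + 1) := by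
  simpa using F_mul_Xl hz [i]
theorem x_mul_F {n : ℕ} {z : U u α} (hz : z ∈ F u α n) (i : α) : 𝐱 i * z ∈ F u α (n + 1) := by
  simpa using Xl_mul_F hz [i]
theorem b_F {b : U u α} (hb : b ∈ Bs u α) : b ∈ F u α 1 := by
  simpa using F_word (l := []) (n := 1) (by simp) hb
theorem x_F (i : α) : 𝐱 i ∈ F u α 2 := by
  simpa using F_word (u := u) (l := [i]) (n := 2) (by simp) (one_mem _)

theorem D_F (i j : α) : (sd u α).D i j ∈ F u α 2 := by
  unfold PreSD.D
  refine F_mul_b (Submodule.sub_mem _ ?_ ?_) (Bs_s _)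
  · rw [add_mul, one_mul]
    exact add_mem (x_F _) (b_mul_F (x_F _) (mul_mem (Bs_c _) (Bs_c _)))
  · rw [add_mul, one_mul]
    exact add_mem (x_F _) (b_mul_F (x_F _) (mul_mem (Bs_c _) (Bs_c _)))

theorem Xl_perm {l l' : List α} (h : l.Perm l') : Xl u l - Xl u l' ∈ F u α l.length := by
  induction h with
  | nil => simp
  | cons i _ ih => rw [Xl_cons, Xl_cons, ← mul_sub]; exact x_mul_F ih i
  | swap i j l => 
    simp only [Xl_cons, ← mul_assoc]
    rw [← sub_mul]
    by_cases hij : j = i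
    · subst hij; simp
    · rw [(sd u α).xx _ _ hij, add_sub_cancel_left]
      have := F_mul_Xl (D_F (u := u) j i) l
      rwa [add_comm] at this
  | trans h1 h2 ih1 ih2 =>
    rw [← sub_add_sub_cancel]
    exact add_mem ih1 (by rw [h1.length_eq]; exact ih2)

theorem Xl_not_nodup {l : List α} (h : ¬ l.Nodup) : Xl u l ∈ F u α l.length := by
  obtain ⟨i, hi⟩ : ∃ i, 2 ≤ l.count i := by
    by_contra hh
    push Not at hh
    exact h (List.nodup_iff_count_le_one.2 fun a => by have := hh a; omega)
  obtain ⟨l1, e1⟩ : ∃ l1, l.Perm (i :: l1) := ⟨_, List.perm_cons_erase (List.count_pos_iff.1 (by omega))⟩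
  obtain ⟨l2, e2⟩ : ∃ l2, l1.Perm (i :: l2) := by
    refine ⟨_, List.perm_cons_erase (List.count_pos_iff.1 ?_)⟩
    have := e1.count_eq i; rw [List.count_cons_self] at this; omega
  have e3 : l.Perm (i :: i :: l2) := e1.trans (e2.cons i)
  have := Xl_perm (u := u) e3
  have h2 : Xl u (i :: i :: l2) ∈ F u α l.length := by
    rw [Xl_cons, Xl_cons, ← mul_assoc, (sd u α).x_sq, ← Algebra.smul_def]
    refine Submodule.smul_mem _ _ ?_
    have := F_word (u := u) (l := l2) (n := l.length) (by rw [e3.length_eq]; simp) (one_mem _)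
    simpa using this
  simpa using add_mem this h2

/-! ### inc, par, eps -/

theorem Bs_par {b : U u α} (hb : b ∈ Bs u α) : par b ∈ Bs u α := by
  refine Bs_ind (P := fun b => par b ∈ Bs u α) ?_ ?_ ?_ ?_ hb
  · simp [one_mem]
  · intro w b _ h; rw [map_mul, par_s]; exact mul_mem (Bs_s _) h
  · intro w b _ h; rw [map_mul, par_c, neg_mul]; exact Bs_neg (mul_mem (Bs_c _) h)
  · intro b _ h; rw [map_neg]; exact Bs_neg h

theorem Bs_inc {b : U u α} (hb : b ∈ Bs u α) : inc b ∈ Bs u (Option α) := by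
  refine Bs_ind (P := fun b => inc b ∈ Bs u (Option α)) ?_ ?_ ?_ ?_ hb
  · simp [one_mem]
  · intro w b _ h; rw [map_mul, inc_s]; exact mul_mem (Bs_s _) h
  · intro w b _ h; rw [map_mul, inc_c]; exact (mul_mem (Bs_c _) h)
  · intro b _ h; rw [map_neg]; exact Bs_neg h

theorem inc_Xl (l : List α) : inc (Xl u l) = Xl u (l.map some) := by
  induction l with
  | nil => simp
  | cons i l ih => simp [ih]

theorem par_Xl (l : List α) : par (Xl u l) = Xl u l := by
  induction l with
  | nil => simp
  | cons i l ih => simp [ih]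

theorem F_inc {n : ℕ} {z : U u α} (hz : z ∈ F u α n) : inc z ∈ F u (Option α) n := by
  refine F_lin inc.toLinearMap ?_ hz
  intro l b hb h
  rw [AlgHom.toLinearMap_apply, map_mul, inc_Xl]
  exact F_word (by simpa using h) (Bs_inc hb)

theorem F_par {n : ℕ} {z : U u α} (hz : z ∈ F u α n) : par z ∈ F u α n := by
  refine F_lin par.toLinearMap ?_ hz
  intro l b hb h
  rw [AlgHom.toLinearMap_apply, map_mul, par_Xl]
  exact F_word (by simpa using h) (Bs_par hb)

theorem x_inc_b {b : U u α} (hb : b ∈ Bs u α) : (𝐱 none * inc b : U u (Option α)) = inc b * 𝐱 none := by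
  refine Bs_ind (P := fun b => (𝐱 none * inc b : U u (Option α)) = inc b * 𝐱 none) ?_ ?_ ?_ ?_ hb
  · simp
  · intro w b _ h; rw [map_mul, mul_assoc, ← h, inc_s, ← mul_assoc, ← mul_assoc, (sd u _).σx]; simp
  · intro i b _ h; rw [map_mul, mul_assoc, ← h, inc_c, ← mul_assoc, ← mul_assoc, (sd u _).xc _ _ (by simp)]
  · intro b _ h; rw [map_neg, mul_neg, neg_mul, h]

theorem x_inc {n : ℕ} {z : U u α} (hz : z ∈ F u α n) : (𝐱 none * inc z - inc z * 𝐱 none : U u (Option α)) ∈ F u (Option α) n := by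
  refine F_lin (LinearMap.mulLeft ℂ (𝐱 none) ∘ₗ inc.toLinearMap - LinearMap.mulRight ℂ (𝐱 none) ∘ₗ inc.toLinearMap) ?_ hz
  intro l b hb h
  simp only [LinearMap.sub_apply, LinearMap.comp_apply, AlgHom.toLinearMap_apply, LinearMap.mulLeft_apply, LinearMap.mulRight_apply,
    map_mul, inc_Xl]
  rw [mul_assoc, ← x_inc_b hb, ← mul_assoc, ← mul_assoc, ← sub_mul]
  refine F_mul_b ?_ (Bs_inc hb)
  have := Xl_perm (u := u) (l := none :: l.map some) (l' := l.map some ++ [none]) (List.perm_append_singleton _ _).symm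
  simp at this
  exact F_mono h this

theorem Bs_opt {b : U u (Option α)} (hb : b ∈ Bs u (Option α)) : ∃ b1 ∈ Bs u α, ∃ w, 
    b = inc b1 * 𝐬 w ∨ b = inc b1 * 𝐜 none * 𝐬 w := by
  refine Bs_ind_r (P := fun b => ∃ b1 ∈ Bs u α, ∃ w, b = inc b1 * 𝐬 w ∨ b = inc b1 * 𝐜 none * 𝐬 w) ?_ ?_ ?_ ?_ hb
  · exact ⟨1, one_mem _, 1, by simp⟩
  · rintro w b _ ⟨b1, hb1, v, h | h⟩
    · exact ⟨b1, hb1, v * w, Or.inl (by rw [h, map_mul, mul_assoc])⟩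
    · exact ⟨b1, hb1, v * w, Or.inr (by rw [h, map_mul]; simp only [mul_assoc])⟩
  · rintro i b _ ⟨b1, hb1, v, h | h⟩
    · cases hv : v i with
      | none => exact ⟨b1, hb1, v, Or.inr (by rw [h, mul_assoc, (sd u _).σc, hv, mul_assoc])⟩
      | some j => exact ⟨b1 * 𝐜 j, mul_mem hb1 (Bs_c _), v, Or.inl (by 
          rw [h, mul_assoc, (sd u _).σc, hv, map_mul, inc_c, mul_assoc])⟩
    · cases hv : v i with
      | none => exact ⟨-b1, Bs_neg hb1, v, Or.inl (by 
          rw [h, mul_assoc, (sd u _).σc, hv, mul_assoc, ← mul_assoc (𝐜 _), (sd u _).c_sq]; simp)⟩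
      | some j => exact ⟨-(b1 * 𝐜 j), Bs_neg (mul_mem hb1 (Bs_c _)), v, Or.inr (by 
          rw [h, mul_assoc, (sd u _).σc, hv, map_neg, map_mul, inc_c, mul_assoc, ← mul_assoc (𝐜 _),
            (sd u _).c_anti none (some j) (by simp)]
          simp [mul_assoc])⟩
  · rintro b _ ⟨b1, hb1, v, h | h⟩
    · exact ⟨-b1, Bs_neg hb1, v, Or.inl (by rw [h]; simp)⟩
    · exact ⟨-b1, Bs_neg hb1, v, Or.inr (by rw [h]; simp)⟩

variable [Fintype α] (κ : ℂ)

theorem eps_F_b {b : U u (Option α)} (hb : b ∈ Bs u (Option α)) : eps κ b ∈ F u α 1 := by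
  obtain ⟨b1, hb1, w, rfl | rfl⟩ := Bs_opt hb
  · rw [eps_inc_l, s_split, eps_inc_r]
    refine b_mul_F (F_mul_b ?_ (Bs_s _)) hb1
    cases w none with
    | none => rw [swap_none_none]; simp
    | some j => rw [eps_s]; exact b_F (one_mem _)
  · rw [mul_assoc, eps_inc_l, s_split, ← mul_assoc, eps_inc_r]
    refine b_mul_F (F_mul_b ?_ (Bs_s _)) hb1
    cases w none with
    | none => rw [swap_none_none]; simp
    | some j => 
      rw [← SW_c_some, ← inc_c, eps_inc_r, eps_s, one_mul]; exact b_F (Bs_c _)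

theorem eps_F_xb {b : U u (Option α)} (hb : b ∈ Bs u (Option α)) : eps κ (𝐱 none * b) ∈ F u α 2 := by
  obtain ⟨b1, hb1, w, rfl | rfl⟩ := Bs_opt hb
  · rw [← mul_assoc, x_inc_b hb1, mul_assoc, eps_inc_l, s_split, ← mul_assoc, eps_inc_r]
    refine b_mul_F (F_mul_b ?_ (Bs_s _)) hb1
    cases w none with
    | none => 
      rw [swap_none_none, mul_one, eps_x, Algebra.algebraMap_eq_smul_one]
      exact F_mono (by norm_num) (Submodule.smul_mem _ _ (b_F (one_mem _)))
    | some j => rw [← SW_x_some, ← inc_x, eps_inc_r, eps_s, one_mul]; exact x_F _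
  · rw [mul_assoc, ← mul_assoc, x_inc_b hb1, mul_assoc, eps_inc_l, s_split, ← mul_assoc, ← mul_assoc, eps_inc_r, (sd u _).xc_same]
    refine b_mul_F (F_mul_b ?_ (Bs_s _)) hb1
    cases w none with
    | none => rw [swap_none_none]; simp
    | some j => 
      rw [neg_mul, mul_assoc, ← SW_x_some, ← mul_assoc, ← SW_c_some, ← inc_c, ← inc_x, mul_assoc, ← map_mul, map_neg, eps_inc_r, eps_s, one_mul]
      exact Submodule.neg_mem _ (b_mul_F (x_F _) (Bs_c _))

theorem list_some {l : List (Option α)} (h : none ∉ l) : ∃ l' : List α, l = l'.map some := by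
  induction l with
  | nil => exact ⟨[], rfl⟩
  | cons a l ih => 
    simp at h
    obtain ⟨l', rfl⟩ := ih h.2
    obtain ⟨b, rfl⟩ := Option.ne_none_iff_exists'.1 (Ne.symm h.1)
    exact ⟨b :: l', rfl⟩

theorem F_eps {n : ℕ} : ∀ {z : U u (Option α)}, z ∈ F u (Option α) n → eps κ z ∈ F u α n := by
  induction n with
  | zero => 
    intro z hz
    refine F_lin (eps κ) ?_ hz
    intro l b hb h; omega
  | succ n ih =>
    intro z hz
    refine F_lin (eps κ) ?_ hz
    intro l b hb h
    by_cases hl : l.length < n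
    · exact F_mono (by omega) (ih (F_word hl hb))
    have hl : l.length = n := by omega
    by_cases hnd : l.Nodup
    swap
    · exact F_mono (by omega) (ih (hl ▸ F_mul_b (Xl_not_nodup hnd) hb))
    by_cases hnone : none ∈ l
    swap
    · obtain ⟨l', rfl⟩ := list_some hnone
      rw [← inc_Xl, eps_inc_l]
      have := Xl_mul_F (eps_F_b κ hb) l'
      simp at hl
      rwa [hl, add_comm] at this
    · have hp := List.perm_cons_erase hnone
      have hno : none ∉ l.erase none := (hp.nodup_iff.1 hnd |> List.nodup_cons.1).1
      obtain ⟨l', hl'⟩ := list_some hno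
      rw [hl'] at hp
      have hp2 : l.Perm (l'.map some ++ [none]) := hp.trans (List.perm_append_singleton _ _).symm
      have h1 := ih (hl ▸ F_mul_b (Xl_perm hp2) hb)
      have h2 : eps κ (Xl u (l'.map some ++ [none]) * b) ∈ F u α (n+1) := by
        rw [Xl_append, ← inc_Xl, mul_assoc, eps_inc_l]
        have := Xl_mul_F (eps_F_xb κ hb) l'
        have e : n + 1 = 2 + l'.length := by rw [← hl, hp2.length_eq]; simp; omega
        rw [e]; simpa using this
      rw [sub_mul, map_sub] at h1
      have := add_mem (F_mono (Nat.le_succ n) h1) h2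
      simpa using this

/-- leading term of the right dot -/
theorem xb_lead {n : ℕ} {z : U u α} (hz : z ∈ F u α n) (q : α) : Φ κ q (𝐱 none) z - z * 𝐱 q ∈ F u α n := by
  have h1 := F_eps κ (F_mul_b (x_inc hz) (Bs_s (swap none (some q))))
  rw [sub_mul, map_sub, mul_assoc (inc z), ← SW_x_some, ← mul_assoc (inc z), ← inc_x, eps_inc_r, eps_inc_l, eps_s, mul_one] at h1
  exact h1

theorem xb_F {n : ℕ} {z : U u α} (hz : z ∈ F u α n) (q : α) : Φ κ q (𝐱 none) z ∈ F u α (n+1) := by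
  have := add_mem (F_mono (Nat.le_succ n) (xb_lead κ hz q)) (F_mul_x hz q)
  simpa using this

theorem e_F {n : ℕ} {z : U u α} (hz : z ∈ F u α n) (p q : α) : Φ κ q (SW p) z ∈ F u α n := by
  rw [Φ_apply]
  exact F_eps κ (F_mul_b (b_mul_F (F_inc hz) (Bs_s _)) (Bs_s _))

theorem SW_comm_list {l : List α} {k : α} (h : k ∉ l) : (SW k * inc (Xl u l) : U u (Option α)) = inc (Xl u l) * SW k := by
  induction l with
  | nil => simp
  | cons i l ih =>
    simp at h
    rw [Xl_cons, map_mul, ← mul_assoc, inc_x, SW_x_ne (Ne.symm h.1), mul_assoc, ih h.2, mul_assoc]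

end
end

section
section
/-- equality up to sign -/
def Pm {A : Type} [Ring A] (a b : A) : Prop := a = b ∨ a = -b
section
variable {A : Type} [Ring A] {a b c : A}
theorem Pm.refl (a : A) : Pm a a := Or.inl rfl
theorem Pm.symm (h : Pm a b) : Pm b a := by
  rcases h with rfl | rfl
  · exact Or.inl rfl
  · exact Or.inr (neg_neg _).symm
theorem Pm.trans (h : Pm a b) (h' : Pm b c) : Pm a c := by
  rcases h with rfl | rfl
  · exact h'
  · rcases h' with rfl | rfl
    · exact Or.inr rfl
    · exact Or.inl (neg_neg _)
theorem Pm.mul_left (h : Pm a b) (c : A) : Pm (c * a) (c * b) := by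
  rcases h with rfl | rfl
  · exact Or.inl rfl
  · exact Or.inr (mul_neg _ _)
theorem Pm.mul_right (h : Pm a b) (c : A) : Pm (a * c) (b * c) := by
  rcases h with rfl | rfl
  · exact Or.inl rfl
  · exact Or.inr (neg_mul _ _)
theorem Pm.neg (h : Pm a b) : Pm (-a) b := by
  rcases h with rfl | rfl
  · exact Or.inr rfl
  · exact Or.inl (neg_neg _)
end

variable {u : ℂ} {α : Type} [DecidableEq α]

variable (u) in
def Cl (l : List α) : U u α := (l.map 𝐜).prod
@[simp] theorem Cl_nil : Cl u ([] : List α) = 1 := rfl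
@[simp] theorem Cl_cons (i : α) (l : List α) : Cl u (i :: l) = 𝐜 i * Cl u l := by simp [Cl]
@[simp] theorem Cl_append (l l' : List α) : Cl u (l ++ l') = Cl u l * Cl u l' := by simp [Cl]

theorem Bs_Cl (l : List α) : Cl u l ∈ Bs u α := by
  induction l with
  | nil => exact one_mem _
  | cons i l ih => rw [Cl_cons]; exact mul_mem (Bs_c _) ih

theorem Cl_perm {l l' : List α} (h : l.Perm l') : Pm (Cl u l) (Cl u l') := by
  induction h with
  | nil => exact Pm.refl _
  | cons i _ ih => simp only [Cl_cons]; exact ih.mul_left _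
  | swap i j l =>
    simp only [Cl_cons, ← mul_assoc]
    refine Pm.mul_right ?_ _
    by_cases hij : j = i
    · subst hij; exact Pm.refl _
    · exact Or.inr ((sd u α).c_anti _ _ hij)
  | trans _ _ ih1 ih2 => exact ih1.trans ih2

theorem Cl_norm (l : List α) : ∃ T : Finset α, Pm (Cl u l) (Cl u T.toList) := by
  induction l with
  | nil => exact ⟨∅, by simpa using Pm.refl _⟩
  | cons i l ih =>
    obtain ⟨T, hT⟩ := ih
    have h1 := hT.mul_left (𝐜 i)
    by_cases hi : i ∈ T
    · refine ⟨T.erase i, ?_⟩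
      rw [Cl_cons]
      refine h1.trans ?_
      have hp : T.toList.Perm (i :: (T.erase i).toList) := by
        have := Finset.toList_insert (Finset.notMem_erase i T)
        rwa [Finset.insert_erase hi] at this
      have h2 := (Cl_perm (u := u) hp).mul_left (𝐜 i)
      refine h2.trans ?_
      rw [Cl_cons, ← mul_assoc, (sd u α).c_sq, neg_one_mul]
      exact (Pm.refl _).neg
    · refine ⟨insert i T, ?_⟩
      rw [Cl_cons]
      refine h1.trans ?_
      have h2 := (Cl_perm (u := u) (Finset.toList_insert hi)).symm
      rwa [Cl_cons] at h2

theorem Bs_norm {b : U u α} (hb : b ∈ Bs u α) : ∃ l : List α, ∃ w, Pm b (Cl u l * 𝐬 w) := by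
  refine Bs_ind_r (P := fun b => ∃ l : List α, ∃ w, Pm b (Cl u l * 𝐬 w)) ?_ ?_ ?_ ?_ hb
  · exact ⟨[], 1, by simpa using Pm.refl _⟩
  · rintro w b - ⟨l, v, h⟩
    exact ⟨l, v * w, by simpa [mul_assoc] using h.mul_right (𝐬 w)⟩
  · rintro i b - ⟨l, v, h⟩
    refine ⟨l ++ [v i], v, ?_⟩
    have := h.mul_right (𝐜 i)
    rw [mul_assoc, (sd u α).σc, ← mul_assoc] at this
    simpa using this
  · rintro b - ⟨l, v, h⟩
    exact ⟨l, v, h.neg⟩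

variable (u) in
def mon (z : Finset α × Finset α × Perm α) : U u α := Xl u z.1.toList * (Cl u z.2.1.toList * 𝐬 z.2.2)

theorem Pm_mem {S : Submodule ℂ (U u α)} {a b : U u α} (h : Pm a b) (hb : b ∈ S) : a ∈ S := by
  rcases h with rfl | rfl
  · exact hb
  · exact Submodule.neg_mem _ hb

theorem F_mon (n : ℕ) : F u α n ≤ Submodule.span ℂ (mon u '' {z : Finset α × Finset α × Perm α | z.1.card < n}) := by
  induction n with
  | zero => exact F_ind (fun l b hb h => by omega)
  | succ n ih =>
    have hmono : Submodule.span ℂ (mon u '' {z : Finset α × Finset α × Perm α | z.1.card < n}) ≤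
      Submodule.span ℂ (mon u '' {z : Finset α × Finset α × Perm α | z.1.card < n + 1}) :=
      Submodule.span_mono (Set.image_mono fun z hz => Nat.lt_succ_of_lt hz)
    refine F_ind fun l b hb h => ?_
    by_cases hl : l.length < n
    · exact hmono (ih (F_word hl hb))
    have hl : l.length = n := by omega
    by_cases hnd : l.Nodup
    swap
    · exact hmono (ih (hl ▸ F_mul_b (Xl_not_nodup hnd) hb))
    obtain ⟨l', w, h1⟩ := Bs_norm hb
    obtain ⟨T, hT⟩ := Cl_norm (u := u) l'
    have h2 : Pm (Xl u l.toFinset.toList * b) (mon u (l.toFinset, T, w)) :=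
      (h1.trans (hT.mul_right _)).mul_left _
    have h3 : mon u (l.toFinset, T, w) ∈ Submodule.span ℂ (mon u '' {z : Finset α × Finset α × Perm α | z.1.card < n + 1}) := by
      refine Submodule.subset_span ⟨_, ?_, rfl⟩
      show l.toFinset.card < n + 1
      rw [List.toFinset_card_of_nodup hnd]; omega
    have h4 : l.Perm l.toFinset.toList := by
      refine (List.perm_ext_iff_of_nodup hnd (Finset.nodup_toList _)).2 fun a => by simp
    have h5 := hmono (ih (hl ▸ F_mul_b (Xl_perm (u := u) h4) hb))
    rw [sub_mul] at h5
    simpa using add_mem h5 (Pm_mem h2 h3)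

theorem F_all (z : U u α) : ∃ n, z ∈ F u α n := by
  have key := U_ind (⨆ n, F u α n) (u := u) (α := α)
  have mono : Directed (· ≤ ·) (fun n => F u α n) := fun a b => ⟨max a b, F_mono (le_max_left _ _), F_mono (le_max_right _ _)⟩
  have := key ?_ ?_ ?_ ?_ z
  · exact (Submodule.mem_iSup_of_directed _ mono).1 this
  · exact Submodule.mem_iSup_of_mem 1 (b_F (one_mem _))
  · intro w h hh
    obtain ⟨n, hn⟩ := (Submodule.mem_iSup_of_directed _ mono).1 hh
    exact Submodule.mem_iSup_of_mem n (b_mul_F hn (Bs_s _))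
  · intro w h hh
    obtain ⟨n, hn⟩ := (Submodule.mem_iSup_of_directed _ mono).1 hh
    exact Submodule.mem_iSup_of_mem n (b_mul_F hn (Bs_c _))
  · intro w h hh
    obtain ⟨n, hn⟩ := (Submodule.mem_iSup_of_directed _ mono).1 hh
    exact Submodule.mem_iSup_of_mem (n+1) (x_mul_F hn _)

theorem mon_span : (⊤ : Submodule ℂ (U u α)) ≤ Submodule.span ℂ (Set.range (mon u)) := by
  intro z _
  obtain ⟨n, hn⟩ := F_all z
  exact Submodule.span_mono (Set.image_subset_range _ _) (F_mon n hn)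

instance [Fintype α] : Module.Finite ℂ (U u α) :=
  ⟨⟨(Set.finite_range (mon u)).toFinset, by simpa using top_le_iff.1 mon_span⟩⟩

/-! dimension -/

def trU {β : Type} [DecidableEq β] (e : α ≃ β) : U u α →ₐ[ℂ] U u β := liftU
  { σ := (sd u β).σ.comp e.permCongrHom.toMonoidHom
    c := fun i => 𝐜 (e i)
    x := fun i => 𝐱 (e i)
    c_sq := fun i => (sd u β).c_sq _
    c_anti := fun i j h => (sd u β).c_anti _ _ (by simpa using h)
    σc := fun w i => by simpa using (sd u β).σc (e.permCongrHom w) (e i)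
    σx := fun w i => by simpa using (sd u β).σx (e.permCongrHom w) (e i)
    xc_same := fun i => (sd u β).xc_same _
    xc := fun i j h => (sd u β).xc _ _ (by simpa using h)
    x_sq := fun i => (sd u β).x_sq _
    xx := fun i j h => by
      rw [(sd u β).xx (e i) (e j) (by simpa using h)]
      simp only [PreSD.D, MonoidHom.comp_apply]
      congr 3
      ext z
      simp [swap_apply_def, Equiv.eq_symm_apply]
      grind }

theorem trU_surj {β : Type} [DecidableEq β] (e : α ≃ β) : Function.Surjective (trU (u := u) e) := by
  intro z
  suffices z ∈ LinearMap.range (trU (u := u) e).toLinearMap by simpa using this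
  refine U_ind (LinearMap.range (trU (u := u) e).toLinearMap) ⟨1, by simp⟩ ?_ ?_ ?_ z
  · rintro w _ ⟨h, rfl⟩
    refine ⟨𝐬 (e.permCongrHom.symm w) * h, ?_⟩
    simp [trU]
    congr 2
    ext; simp
  · rintro w _ ⟨h, rfl⟩
    refine ⟨𝐜 (e.symm w) * h, ?_⟩
    simp [trU]
  · rintro w _ ⟨h, rfl⟩
    refine ⟨𝐱 (e.symm w) * h, ?_⟩
    simp [trU]

theorem ev_surj [Fintype α] : ∃ T : U u (Option α) →ₗ[ℂ] PM α (U u α), Function.Surjective T := by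
  let T : U u (Option α) →ₗ[ℂ] PM α (U u α) := (LinearMap.applyₗ (R := ℂ) (Bv none false false (1 : U u α))) ∘ₗ (act (u := u) (α := α)).toLinearMap
  have hT : ∀ h, T h = ev h := fun h => rfl
  refine ⟨T, fun f => ?_⟩
  refine ⟨∑ j, ∑ a, ∑ b, mc j a b * inc (f j a b), ?_⟩
  simp only [map_sum]
  simp only [hT, ev_mc]
  exact (pm_sum f).symm

theorem dim_opt [Fintype α] (h : 4 ^ Fintype.card α * (Fintype.card α).factorial ≤ Module.finrank ℂ (U u α)) :
    4 ^ Fintype.card (Option α) * (Fintype.card (Option α)).factorial ≤ Module.finrank ℂ (U u (Option α)) := by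
  obtain ⟨T, hT⟩ := ev_surj (u := u) (α := α)
  have h1 := LinearMap.finrank_le_finrank_of_surjective hT
  have h2 : Module.finrank ℂ (PM α (U u α)) = (Fintype.card α + 1) * (2 * (2 * Module.finrank ℂ (U u α))) := by
    unfold PM
    simp [Module.finrank_pi_fintype]
  rw [h2] at h1
  have h3 : (Fintype.card (Option α)) = Fintype.card α + 1 := by simp
  rw [h3, Nat.factorial_succ, pow_succ]
  nlinarith

theorem dim_ge (u : ℂ) (α : Type) [Finite α] : ∀ [DecidableEq α] [Fintype α], 4 ^ Fintype.card α * (Fintype.card α).factorial ≤ 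
    Module.finrank ℂ (U u α) := by
  refine Finite.induction_empty_option (P := fun α => ∀ [DecidableEq α] [Fintype α], 4 ^ Fintype.card α * (Fintype.card α).factorial ≤ 
    Module.finrank ℂ (U u α)) ?_ ?_ ?_ α
  · intro α β e h _ _
    classical
    let _ : Fintype α := Fintype.ofEquiv _ e.symm
    rw [← Fintype.card_congr e]
    refine h.trans ?_
    exact LinearMap.finrank_le_finrank_of_surjective (f := (trU (u := u) e.symm).toLinearMap) (trU_surj e.symm)
  · intro _ _
    let d : SD u PEmpty ℂ :=
     { σ := 1
       c := fun i => i.elim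
       x := fun i => i.elim
       c_sq := fun i => i.elim
       c_anti := fun i => i.elim
       σc := fun _ i => i.elim
       σx := fun _ i => i.elim
       xc_same := fun i => i.elim
       xc := fun i => i.elim
       x_sq := fun i => i.elim
       xx := fun i => i.elim }
    have : Nontrivial (U u PEmpty) := ⟨0, 1, fun h => by
      have := congrArg (liftU d) h
      simp at this⟩
    have := Module.finrank_pos (R := ℂ) (M := U u PEmpty)
    rw [Fintype.card_eq_zero]; simpa using Nat.succ_le_of_lt this
  · intro α _ h _ _
    classical
    have h' := dim_opt (u := u) (α := α) h
    have key : ∀ i1 i2 : DecidableEq (Option α), Module.finrank ℂ (@U u (Option α) i1) = Module.finrank ℂ (@U u (Option α) i2) := by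
      intro i1 i2
      have : i1 = i2 := Subsingleton.elim _ _
      subst this; rfl
    rw [key _ _]
    convert h'

theorem mon_li [Fintype α] : LinearIndependent ℂ (mon u : Finset α × Finset α × Perm α → U u α) := by
  refine linearIndependent_of_top_le_span_of_card_le_finrank mon_span ?_
  refine le_trans (le_of_eq ?_) (dim_ge u α)
  simp only [Fintype.card_prod, Fintype.card_finset, Fintype.card_perm]
  rw [← mul_assoc, ← mul_pow]; norm_num

end
end

section
section
variable {u : ℂ} {α : Type} [DecidableEq α]

/-- `z` has leading term (up to sign) the monomial attached to the lists `l`, `l'` and `w`. -/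
def Lead (z : U u α) (l l' : List α) (w : Perm α) : Prop :=
  ∃ y, Pm y (Xl u l * (Cl u l' * 𝐬 w)) ∧ z - y ∈ F u α l.length

theorem Lead_one : Lead (1 : U u α) [] [] 1 := ⟨1, by simpa using Pm.refl _, by simp⟩

theorem Pm_map {A B : Type} [Ring A] [Ring B] [Algebra ℂ A] [Algebra ℂ B] (T : A →ₗ[ℂ] B) {a b : A} (h : Pm a b) : Pm (T a) (T b) := by
  rcases h with rfl | rfl
  · exact Or.inl rfl
  · exact Or.inr (map_neg _ _)

theorem Lead.neg {z : U u α} {l l' : List α} {w : Perm α} (h : Lead z l l' w) : Lead (-z) l l' w := by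
  obtain ⟨y, hy, h⟩ := h
  exact ⟨-y, hy.neg, by rw [neg_sub_neg, ← neg_sub]; exact Submodule.neg_mem _ h⟩

theorem Lead.perm_x {z : U u α} {l₁ l₂ l' : List α} {w : Perm α} (h : Lead z l₁ l' w) (hp : l₁.Perm l₂) : Lead z l₂ l' w := by
  obtain ⟨y, hy, h⟩ := h
  have hF := F_mul_b (Xl_perm (u := u) hp) (mul_mem (Bs_Cl l') (Bs_s w))
  rw [sub_mul] at hF
  rw [hp.length_eq] at h hF
  rcases hy with rfl | rfl
  · exact ⟨_, Pm.refl _, by simpa using add_mem h hF⟩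
  · refine ⟨_, Or.inr rfl, ?_⟩
    have := sub_mem h hF
    convert this using 1
    abel

theorem Lead.perm_c {z : U u α} {l l₁ l₂ : List α} {w : Perm α} (h : Lead z l l₁ w) (hp : l₁.Perm l₂) : Lead z l l₂ w := by
  obtain ⟨y, hy, h⟩ := h
  exact ⟨y, hy.trans (((Cl_perm hp).mul_right _).mul_left _), h⟩

theorem s_Xl (w : Perm α) (l : List α) : 𝐬 w * Xl u l = Xl u (l.map w) * 𝐬 w := by
  induction l with
  | nil => simp
  | cons i l ih => simp only [Xl_cons, List.map_cons]; rw [← mul_assoc, (sd u α).σx, mul_assoc, ih, mul_assoc]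
theorem s_Cl (w : Perm α) (l : List α) : 𝐬 w * Cl u l = Cl u (l.map w) * 𝐬 w := by
  induction l with
  | nil => simp
  | cons i l ih => simp only [Cl_cons, List.map_cons]; rw [← mul_assoc, (sd u α).σc, mul_assoc, ih, mul_assoc]

theorem c_x_pm (i j : α) : Pm (𝐜 i * 𝐱 j : U u α) (𝐱 j * 𝐜 i) := by
  by_cases h : j = i
  · subst h; rw [(sd u α).xc_same]; exact (Pm.refl _).neg.symm
  · rw [(sd u α).xc _ _ h]; exact Pm.refl _
theorem c_Xl_pm (i : α) (l : List α) : Pm (𝐜 i * Xl u l : U u α) (Xl u l * 𝐜 i) := by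
  induction l with
  | nil => simpa using Pm.refl _
  | cons j l ih =>
    rw [Xl_cons, ← mul_assoc]
    refine ((c_x_pm i j).mul_right _).trans ?_
    rw [mul_assoc, mul_assoc]
    exact ih.mul_left _
theorem Cl_x_pm (j : α) (l : List α) : Pm (Cl u l * 𝐱 j : U u α) (𝐱 j * Cl u l) := by
  induction l with
  | nil => simpa using Pm.refl _
  | cons i l ih =>
    rw [Cl_cons, mul_assoc]
    refine (ih.mul_left _).trans ?_
    rw [← mul_assoc, ← mul_assoc]
    exact (c_x_pm _ _).mul_right _
theorem par_Cl_pm (l : List α) : Pm (par (Cl u l)) (Cl u l) := by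
  induction l with
  | nil => simpa using Pm.refl _
  | cons i l ih => 
    rw [Cl_cons, map_mul, par_c, neg_mul]
    exact (ih.mul_left _).neg

theorem Lead.s_left {z : U u α} {l l' : List α} {w : Perm α} (h : Lead z l l' w) (v : Perm α) : 
    Lead (𝐬 v * z) (l.map v) (l'.map v) (v * w) := by
  obtain ⟨y, hy, h⟩ := h
  refine ⟨𝐬 v * y, ?_, ?_⟩
  · have := hy.mul_left (𝐬 v)
    rwa [← mul_assoc, s_Xl, mul_assoc, ← mul_assoc (𝐬 v), s_Cl, mul_assoc, ← map_mul] at this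
  · rw [← mul_sub, List.length_map]; exact b_mul_F h (Bs_s _)

theorem Lead.s_right {z : U u α} {l l' : List α} {w : Perm α} (h : Lead z l l' w) (v : Perm α) : 
    Lead (z * 𝐬 v) l l' (w * v) := by
  obtain ⟨y, hy, h⟩ := h
  refine ⟨y * 𝐬 v, ?_, ?_⟩
  · have := hy.mul_right (𝐬 v)
    rwa [mul_assoc, mul_assoc, ← map_mul] at this
  · rw [← sub_mul]; exact F_mul_b h (Bs_s _)

theorem Lead.x_left {z : U u α} {l l' : List α} {w : Perm α} (h : Lead z l l' w) (i : α) : 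
    Lead (𝐱 i * z) (i :: l) l' w := by
  obtain ⟨y, hy, h⟩ := h
  refine ⟨𝐱 i * y, ?_, ?_⟩
  · rw [Xl_cons, mul_assoc]; exact hy.mul_left _
  · rw [← mul_sub]; exact x_mul_F h _

theorem Lead.c_left {z : U u α} {l l' : List α} {w : Perm α} (h : Lead z l l' w) (i : α) : 
    Lead (𝐜 i * z) l (i :: l') w := by
  obtain ⟨y, hy, h⟩ := h
  refine ⟨𝐜 i * y, ?_, ?_⟩
  · refine (hy.mul_left _).trans ?_
    rw [Cl_cons, ← mul_assoc, mul_assoc (𝐜 i) (Cl u l'), ← mul_assoc (Xl u l)]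
    exact (c_Xl_pm i l).mul_right _
  · rw [← mul_sub]; exact b_mul_F h (Bs_c _)

theorem Lead.par {z : U u α} {l l' : List α} {w : Perm α} (h : Lead z l l' w) : 
    Lead (par z) l l' w := by
  obtain ⟨y, hy, h⟩ := h
  refine ⟨L2.par y, ?_, ?_⟩
  · refine (Pm_map (L2.par (u := u) (α := α)).toLinearMap hy).trans ?_
    rw [AlgHom.toLinearMap_apply, map_mul, map_mul, par_Xl, par_s]
    exact ((par_Cl_pm l').mul_right _).mul_left _
  · rw [← map_sub]; exact F_par h

theorem Lead.c_right {z : U u α} {l l' : List α} {w : Perm α} (h : Lead z l l' w) (q : α) : 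
    Lead (z * 𝐜 q) l (w q :: l') w := by
  have : Lead (z * 𝐜 q) l (l' ++ [w q]) w := by
    obtain ⟨y, hy, h⟩ := h
    refine ⟨y * 𝐜 q, ?_, ?_⟩
    · refine (hy.mul_right _).trans ?_
      rw [mul_assoc, mul_assoc, (sd u α).σc, Cl_append, Cl_cons, Cl_nil, mul_one, mul_assoc]
      exact Pm.refl _
    · rw [← sub_mul]; exact F_mul_b h (Bs_c _)
  exact this.perm_c (List.perm_append_singleton _ _)

theorem Lead.Cb {z : U u α} {l l' : List α} {w : Perm α} (h : Lead z l l' w) (q : α) : 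
    Lead (Cb q z) l (w q :: l') w := h.par.c_right q

theorem Lead.x_right {z : U u α} {l l' : List α} {w : Perm α} (h : Lead z l l' w) (q : α) : 
    Lead (z * 𝐱 q) (w q :: l) l' w := by
  have : Lead (z * 𝐱 q) (l ++ [w q]) l' w := by
    obtain ⟨y, hy, h⟩ := h
    refine ⟨y * 𝐱 q, ?_, ?_⟩
    · refine (hy.mul_right _).trans ?_
      rw [mul_assoc, mul_assoc, (sd u α).σx, Xl_append, Xl_cons, Xl_nil, mul_one, mul_assoc, ← mul_assoc (Cl u l'), ← mul_assoc (𝐱 _)]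
      exact ((Cl_x_pm _ _).mul_right _).mul_left _
    · rw [← sub_mul, List.length_append]; exact F_mul_x h _
  exact this.perm_x (List.perm_append_singleton _ _)

theorem Lead.mem {z : U u α} {l l' : List α} {w : Perm α} (h : Lead z l l' w) : z ∈ F u α (l.length + 1) := by
  obtain ⟨y, hy, h⟩ := h
  have h1 : y ∈ F u α (l.length + 1) := Pm_mem hy (F_word (Nat.lt_succ_self _) (mul_mem (Bs_Cl _) (Bs_s _)))
  simpa using add_mem (F_mono (Nat.le_succ _) h) h1

theorem Lead.add {z y : U u α} {l l' : List α} {w : Perm α} (h : Lead z l l' w) (hy : y - z ∈ F u α l.length) : Lead y l l' w := by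
  obtain ⟨y', hy', h⟩ := h
  exact ⟨y', hy', by simpa using add_mem hy h⟩

theorem SW_comm_Cl {l : List α} {k : α} (h : k ∉ l) : (SW k * inc (Cl u l) : U u (Option α)) = inc (Cl u l) * SW k := by
  induction l with
  | nil => simp
  | cons i l ih =>
    simp at h
    rw [Cl_cons, map_mul, ← mul_assoc, inc_c, SW_c_ne (Ne.symm h.1), mul_assoc, ih h.2, mul_assoc]

variable [Fintype α] (κ : ℂ)

theorem Lead.xb {z : U u α} {l l' : List α} {w : Perm α} (h : Lead z l l' w) (q : α) : 
    Lead ((-Φ κ q (𝐱 none) : Module.End ℂ (U u α)) z) (w q :: l) l' w := by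
  rw [LinearMap.neg_apply]
  exact ((h.x_right q).add (xb_lead κ h.mem q)).neg

theorem eps_SWSW {p p' : α} (h : p ≠ p') : eps κ (SW p * SW p' : U u (Option α)) = 𝐬 (swap p p') := by
  have : (SW p * SW p' : U u (Option α)) = inc (𝐬 (swap p p')) * SW p := by
    rw [inc_swap, SW, SW, ← map_mul, ← map_mul]
    congr 1
    ext1 z; simp only [Perm.mul_apply, swap_apply_def]; grind
  rw [this, eps_inc_l, eps_s, mul_one]

theorem Lead.E {z : U u α} {l l' : List α} {w : Perm α} (h : Lead z l l' w) {p q : α} (hp : p ∉ l) (hp' : p ∉ l')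
    (hpq : p ≠ w q) : Lead (Φ κ q (SW p) z) l l' (swap p (w q) * w) := by
  obtain ⟨y, hy, h⟩ := h
  refine ⟨Φ κ q (SW p) y, ?_, ?_⟩
  · refine (Pm_map (Φ κ q (SW p)) hy).trans ?_
    rw [Φ_apply, map_mul inc, map_mul inc, ← mul_assoc, SW_comm_list hp, mul_assoc, mul_assoc, eps_inc_l,
      ← mul_assoc, ← mul_assoc, SW_comm_Cl hp', mul_assoc, mul_assoc, eps_inc_l, SW_s, ← mul_assoc (SW p), eps_inc_r, eps_SWSW κ hpq,
      ← map_mul]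
    exact Pm.refl _
  · rw [← map_sub]; exact e_F κ h _ _

theorem Lead.list_x {ι : Type} {w : Perm α} {op : ι → Module.End ℂ (U u α)} {g : ι → α} 
    (hop : ∀ j (z : U u α) l l', Lead z l l' w → Lead (op j z) (g j :: l) l' w) (β : ι → Fin 2) (L : List ι) 
    {z : U u α} {l l' : List α} (h : Lead z l l' w) :
    Lead ((L.map (fun j => op j ^ (β j : ℕ))).prod z) ((L.filter (fun j => β j = 1)).map g ++ l) l' w := by
  induction L with
  | nil => simpa using h
  | cons j L ih =>
    rw [List.map_cons, List.prod_cons, Module.End.mul_apply]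
    obtain hb | hb : β j = 0 ∨ β j = 1 := by omega
    · rw [hb, List.filter_cons_of_neg (by simp [hb])]; simpa using ih
    · rw [hb, List.filter_cons_of_pos (by simp [hb])]; simpa using hop j _ _ _ ih

theorem Lead.list_c {ι : Type} {w : Perm α} {op : ι → Module.End ℂ (U u α)} {g : ι → α} 
    (hop : ∀ j (z : U u α) l l', Lead z l l' w → Lead (op j z) l (g j :: l') w) (β : ι → Fin 2) (L : List ι) 
    {z : U u α} {l l' : List α} (h : Lead z l l' w) :
    Lead ((L.map (fun j => op j ^ (β j : ℕ))).prod z) l ((L.filter (fun j => β j = 1)).map g ++ l') w := by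
  induction L with
  | nil => simpa using h
  | cons j L ih =>
    rw [List.map_cons, List.prod_cons, Module.End.mul_apply]
    obtain hb | hb : β j = 0 ∨ β j = 1 := by omega
    · rw [hb, List.filter_cons_of_neg (by simp [hb])]; simpa using ih
    · rw [hb, List.filter_cons_of_pos (by simp [hb])]; simpa using hop j _ _ _ ih

end
end

section
/-- the product of transpositions coming from `e^f` -/
def QQ {r t : ℕ} (v : Perm (Fin t)) (f : ℕ) : Perm (Fin r ⊕ Fin t) :=
  ((List.range f).map (fun i => if h : i < r ∧ i < t then swap (Sum.inl ⟨i, h.1⟩) (Sum.inr (v ⟨i, h.2⟩)) else 1)).prod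

theorem QQ_succ {r t : ℕ} (v : Perm (Fin t)) (f : ℕ) (h : f < r ∧ f < t) : (QQ v (f+1) : Perm (Fin r ⊕ Fin t)) =
   QQ v f * swap (Sum.inl ⟨f, h.1⟩) (Sum.inr (v ⟨f, h.2⟩)) := by
  simp [QQ, List.range_succ, h]

theorem QQ_inl {r t : ℕ} (v : Perm (Fin t)) (f : ℕ) (hf : f ≤ r ∧ f ≤ t) (i : Fin r) : 
    (QQ v f : Perm (Fin r ⊕ Fin t)) (Sum.inl i) = if h : (i:ℕ) < f then Sum.inr (v ⟨i, by omega⟩) else Sum.inl i := by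
  suffices H : (∀ i : Fin r, (QQ v f : Perm (Fin r ⊕ Fin t)) (Sum.inl i) = if h : (i:ℕ) < f then Sum.inr (v ⟨i, by omega⟩) else Sum.inl i) ∧
     (∀ j : Fin t, (QQ v f : Perm (Fin r ⊕ Fin t)) (Sum.inr (v j)) = if h : (j:ℕ) < f then Sum.inl ⟨j, by omega⟩ else Sum.inr (v j)) from H.1 i
  clear i
  induction f with
  | zero => simp [QQ]
  | succ f ih =>
    have ih := ih (by omega)
    rw [QQ_succ v f (by omega)]
    refine ⟨fun i => ?_, fun j => ?_⟩
    · rw [Perm.mul_apply]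
      by_cases hi : i = ⟨f, by omega⟩
      · subst hi; rw [swap_apply_left, ih.2]; simp
      · rw [swap_apply_of_ne_of_ne (by simpa using hi) (by simp), ih.1]
        have : (i:ℕ) ≠ f := fun h => hi (Fin.ext h)
        by_cases h : (i:ℕ) < f
        · rw [dif_pos h, dif_pos (by omega)]
        · rw [dif_neg h, dif_neg (by omega)]
    · rw [Perm.mul_apply]
      by_cases hi : j = ⟨f, by omega⟩
      · subst hi; rw [swap_apply_right, ih.1]; simp
      · rw [swap_apply_of_ne_of_ne (by simp) (by simpa using hi), ih.2]
        have : (j:ℕ) ≠ f := fun h => hi (Fin.ext h)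
        by_cases h : (j:ℕ) < f
        · rw [dif_pos h, dif_pos (by omega)]
        · rw [dif_neg h, dif_neg (by omega)]

theorem QQ_inr {r t : ℕ} (v : Perm (Fin t)) (f : ℕ) (hf : f ≤ r ∧ f ≤ t) (j : Fin t) : 
    (QQ v f : Perm (Fin r ⊕ Fin t)) (Sum.inr (v j)) = if h : (j:ℕ) < f then Sum.inl ⟨j, by omega⟩ else Sum.inr (v j) := by
  induction f with
  | zero => simp [QQ]
  | succ f ih =>
    have ih := ih (by omega)
    rw [QQ_succ v f (by omega), Perm.mul_apply]
    by_cases hi : j = ⟨f, by omega⟩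
    · subst hi; rw [swap_apply_right, QQ_inl v f (by omega)]; simp
    · rw [swap_apply_of_ne_of_ne (by simp) (by simpa using hi), ih]
      have : (j:ℕ) ≠ f := fun h => hi (Fin.ext h)
      by_cases h : (j:ℕ) < f
      · rw [dif_pos h, dif_pos (by omega)]
      · rw [dif_neg h, dif_neg (by omega)]

section
variable (m : ℕ) (p : ℂ) (r t : ℕ) (hr : 0 < r) (ht : 0 < t)

theorem rF_σ (w : Perm (Fin r)) : (repF m p r t hr ht).σ w = Lm (𝐬 (pl w)) := rfl
theorem rF_σb (w : Perm (Fin t)) : (repF m p r t hr ht).σb w = Rr (𝐬 (pb w⁻¹)) := rfl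

theorem op_xp (i : ℕ) : ∀ (hi : i < r), (repF m p r t hr ht).xp (i+1) = Lm (𝐱 (Sum.inl ⟨i, hi⟩)) := by
  induction i with
  | zero => intro hi; simp [AWBC.xp]; rfl
  | succ i ih =>
    intro hi
    have ih := ih (by omega)
    have h1 : (repF m p r t hr ht).xp (i+1+1) = (repF m p r t hr ht).s (i+1) * (repF m p r t hr ht).xp (i+1) * (repF m p r t hr ht).s (i+1) := by
      simp only [AWBC.xp, Nat.add_sub_cancel, List.range_succ, List.reverse_append, List.map_append, List.prod_append]
      simp [mul_assoc]
    rw [h1, ih]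
    have h2 : (repF m p r t hr ht).s (i+1) = Lm (𝐬 (swap (Sum.inl ⟨i, by omega⟩) (Sum.inl ⟨i+1, hi⟩))) := by
      unfold WBC.s
      rw [rF_σ, Nat.add_sub_cancel, sw_eq (by omega) hi, pl_swap]
    rw [h2, ← Lm_mul, ← Lm_mul, (sd _ _).σx, mul_assoc, (sd _ _).ss]
    simp

theorem op_xbp (i : ℕ) : ∀ (hi : i < t), (repF m p r t hr ht).xbp (i+1) = -Φ (omSeq m p 1) (Sum.inr ⟨i, hi⟩) (𝐱 none) := by
  induction i with
  | zero => intro hi; simp [AWBC.xbp]; rfl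
  | succ i ih =>
    intro hi
    have ih := ih (by omega)
    have h1 : (repF m p r t hr ht).xbp (i+1+1) = (repF m p r t hr ht).sb (i+1) * (repF m p r t hr ht).xbp (i+1) * (repF m p r t hr ht).sb (i+1) := by
      simp only [AWBC.xbp, Nat.add_sub_cancel, List.range_succ, List.reverse_append, List.map_append, List.prod_append]
      simp [mul_assoc]
    rw [h1, ih]
    have h2 : (repF m p r t hr ht).sb (i+1) = Rr (𝐬 (swap (Sum.inr ⟨i, by omega⟩) (Sum.inr ⟨i+1, hi⟩))) := by
      unfold WBC.sb
      rw [rF_σb, Nat.add_sub_cancel, sw_inv, sw_eq (by omega) hi, pb_swap]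
    rw [h2]
    refine (ring_neg1 _ _ _).trans ?_
    rw [Φ_sb_conj]

theorem op_E (i : ℕ) (hi : i < r) (hi' : i < t) : (repF m p r t hr ht).E (i+1) (i+1) = 
    Φ (omSeq m p 1) (Sum.inr ⟨i, hi'⟩) (SW (Sum.inl ⟨i, hi⟩)) := by
  unfold WBC.E WBC.tr WBC.trb
  rw [rF_σ, rF_σb, Nat.sub_self, Nat.add_sub_cancel, sw_inv, sw_eq hr hi, sw_eq ht hi', pb_swap, pl_swap]
  have h : Lm (𝐬 (swap (Sum.inl ⟨0,hr⟩) (Sum.inl ⟨i,hi⟩))) * (repF m p r t hr ht).e * Lm (𝐬 (swap (Sum.inl ⟨0,hr⟩) (Sum.inl ⟨i,hi⟩))) = 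
      Φ (omSeq m p 1) (Sum.inr ⟨0, ht⟩) (SW (Sum.inl ⟨i, hi⟩)) := by
    show Lm _ * Φ _ _ _ * Lm _ = _
    rw [Lm_Φ, Φ_Lm, SW_s, mul_assoc, ← map_mul, (sd _ _).ss]
    simp
  rw [← Φ_sb_conj (q := Sum.inr ⟨0,ht⟩), ← h]
  simp only [mul_assoc]

/-- effect of `e^f` on leading terms -/
theorem Lead_epow (f : ℕ) (hf : f ≤ r ∧ f ≤ t) {z : U (p*(p+1)) (Fin r ⊕ Fin t)} {l l' : List (Fin r ⊕ Fin t)} 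
    (v : Perm (Fin t)) : ∀ {w : Perm (Fin r ⊕ Fin t)}, Lead z l l' w → (∀ i, Sum.inl i ∉ l) → (∀ i, Sum.inl i ∉ l') → 
    (∀ j : Fin t, (j:ℕ) < f → w (Sum.inr j) = Sum.inr (v j)) → 
    Lead ((repF m p r t hr ht).epow f z) l l' (QQ v f * w) := by
  induction f generalizing z with
  | zero => intro w h _ _ _; simpa [WBC.epow, QQ] using h
  | succ f ih =>
    intro w h hl hl' hw
    have e : (repF m p r t hr ht).epow (f+1) = (repF m p r t hr ht).epow f * (repF m p r t hr ht).E (f+1) (f+1) := by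
      simp [WBC.epow, List.range_succ]
    rw [e, op_E m p r t hr ht f (by omega) (by omega), QQ_succ v f (by omega), Module.End.mul_apply, mul_assoc]
    have hwf := hw ⟨f, by omega⟩ (Nat.lt_succ_self _)
    have h1 := h.E (omSeq m p 1) (p := Sum.inl ⟨f, by omega⟩) (q := Sum.inr ⟨f, by omega⟩) (hl _) (hl' _) (by rw [hwf]; simp)
    rw [hwf] at h1
    refine ih (by omega) h1 hl hl' ?_
    intro j hj
    rw [Perm.mul_apply, hw _ (by omega), swap_apply_of_ne_of_ne (by simp)]
    simp only [ne_eq, Sum.inr.injEq, EmbeddingLike.apply_eq_iff_eq]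
    rintro rfl
    simp at hj

variable {r t} in
def vv (x : L2Index r t) : Perm (Fin t) := x.d2.pt⁻¹ * x.wb⁻¹
variable {r t} in
def Px (x : L2Index r t) : Perm (Fin r ⊕ Fin t) := pl x.d1.pr⁻¹ * (QQ (vv x) x.f * (pl (x.w * x.d2.pr) * pb (vv x)) * pb x.d1.pt)
variable {r t} in
def Sx (x : L2Index r t) (β : Fin r → Fin 2) (βb : Fin t → Fin 2) : List (Fin r ⊕ Fin t) := 
  ((List.finRange r).filter (fun i => β i = 1)).map (fun i => Sum.inl (x.d1.pr⁻¹ i)) ++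
  ((List.finRange t).filter (fun j => βb j = 1)).map (fun j => Sum.inr (vv x j))

theorem Lead_l2 (x : L2Index r t) : Lead ((repF m p r t hr ht).l2Elt x 1) (Sx x x.βx x.βxb) (Sx x x.α x.αb) (Px x) := by
  unfold AWBC.l2Elt
  simp only [Module.End.mul_apply]
  have h0 := ((((Lead_one (u := p*(p+1)) (α := Fin r ⊕ Fin t)).s_right (pb x.d2.pt⁻¹)).s_left (pl x.d2.pr)).s_right (pb x.wb⁻¹)).s_left (pl x.w)
  have e0 : pl x.w * (pl x.d2.pr * (1 * pb x.d2.pt⁻¹) * pb x.wb⁻¹) = (pl (x.w * x.d2.pr) * pb (vv x) : Perm (Fin r ⊕ Fin t)) := by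
    rw [vv, pl_mul, pb_mul]; simp only [mul_assoc, one_mul]
  rw [e0] at h0
  have h1 := Lead.list_c (op := fun j => (repF m p r t hr ht).cb j) (g := fun j => Sum.inr (vv x j)) (by
    intro j z l l' h
    have := h.Cb (Sum.inr j)
    simp at this
    exact this) x.αb (List.finRange t) h0
  have h2 := Lead.list_x (op := fun j : Fin t => (repF m p r t hr ht).xbp (j+1)) (g := fun j => Sum.inr (vv x j)) (by
    intro j z l l' h
    rw [op_xbp m p r t hr ht j j.2]
    simpa using h.xb (omSeq m p 1) (Sum.inr j)) x.βxb (List.finRange t).reverse h1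
  have hf := x.hf
  have h3 := Lead_epow m p r t hr ht x.f (by omega) (vv x) h2 (by simp) (by simp) (by simp)
  have h4 := Lead.list_x (op := fun j : Fin r => (repF m p r t hr ht).xp (j+1)) (g := fun j => Sum.inl j) (by
    intro j z l l' h
    rw [op_xp m p r t hr ht j j.2]
    exact h.x_left (Sum.inl j)) x.βx (List.finRange r).reverse h3
  have h5 := Lead.list_c (op := fun j => (repF m p r t hr ht).c j) (g := fun j => Sum.inl j) (by
    intro j z l l' h
    exact h.c_left (Sum.inl j)) x.α (List.finRange r) h4
  have h6 := (h5.s_right (pb x.d1.pt)).s_left (pl x.d1.pr⁻¹)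
  have h7 := (h6.perm_x (l₂ := Sx x x.βx x.βxb) ?_).perm_c (l₂ := Sx x x.α x.αb) ?_
  · have e : (repF m p r t hr ht).σb x.d1.pt⁻¹ = Rr (𝐬 (pb x.d1.pt)) := by rw [rF_σb, inv_inv]
    rw [e]
    exact h7
  · rw [List.map_append, Sx]
    refine List.Perm.append ?_ ?_
    · simp only [List.filter_reverse, List.map_reverse, List.map_map]
      exact (List.reverse_perm _)
    · simp only [List.filter_reverse, List.map_reverse, List.map_map, List.map_append, List.map_nil, List.append_nil]
      exact (List.reverse_perm _)
  · simp [Sx, Function.comp_def]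

end
end

section
section
variable {n : ℕ}

def KK (n i m : ℕ) : Perm (Fin n) := ((List.range' i m).map (fun k => sw n (k-1) k)).prod

theorem KK_facts (m : ℕ) : ∀ (i : ℕ) (hi : 1 ≤ i) (h : i + m ≤ n), 
    (∀ x : Fin n, (x:ℕ) + 1 = i + m → (KK n i m x : ℕ) + 1 = i) ∧ (∀ x : Fin n, (x:ℕ) + 1 < i → KK n i m x = x) ∧ 
    (∀ x : Fin n, i + m ≤ x → KK n i m x = x) := by
  induction m with
  | zero => intro i hi h; simp [KK]
  | succ m ih =>
    intro i hi h
    obtain ⟨h1, h2, h3⟩ := ih (i+1) (by omega) (by omega)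
    have e : KK n i (m+1) = swap ⟨i-1, by omega⟩ ⟨i, by omega⟩ * KK n (i+1) m := by
      rw [KK, List.range'_succ, List.map_cons, List.prod_cons, sw_eq (by omega) (by omega)]; rfl
    rw [e]
    refine ⟨fun x hx => ?_, fun x hx => ?_, fun x hx => ?_⟩
    · have := h1 x (by omega)
      have e2 : KK n (i+1) m x = ⟨i, by omega⟩ := Fin.ext (by simpa using this)
      rw [Perm.mul_apply, e2, swap_apply_right]; simp; omega
    · rw [Perm.mul_apply, h2 x (by omega), swap_apply_of_ne_of_ne]
      · intro h; rw [h] at hx; simp at hx; omega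
      · intro h; rw [h] at hx; simp at hx
    · rw [Perm.mul_apply, h3 x (by omega), swap_apply_of_ne_of_ne]
      · intro h; rw [h] at hx; simp at hx; omega
      · intro h; rw [h] at hx; simp at hx

theorem sIJ_KK {i j : ℕ} (h : i ≤ j) : sIJ n i j = KK n i (j-i) := by
  unfold sIJ KK
  rcases h.eq_or_lt with rfl | h
  · simp
  · simp [h]

def PP (n : ℕ) (g : ℕ → ℕ) : ℕ → Perm (Fin n)
  | 0 => 1
  | k+1 => sIJ n (k+1) (g k) * PP n g k

theorem PP_eq (g : ℕ → ℕ) (k : ℕ) : ((List.range k).reverse.map (fun k => sIJ n (k+1) (g k))).prod = PP n g k := by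
  induction k with
  | zero => rfl
  | succ k ih => rw [List.range_succ, List.reverse_append, List.map_append, List.prod_append, ih]; simp [PP]

theorem PP_fin {f : ℕ} (a : Fin f → ℕ) : ((List.finRange f).reverse.map (fun (k : Fin f) => sIJ n ((k : ℕ) + 1) (a k))).prod = 
    PP n (fun k => if h : k < f then a ⟨k, h⟩ else 0) f := by
  rw [← PP_eq, ← List.map_coe_finRange_eq_range, ← List.map_reverse, List.map_map]
  congr 2
  funext k
  simp

theorem PP_step {g : ℕ → ℕ} {f : ℕ} (h1 : ∀ k < f, k + 1 ≤ g k) (h2 : ∀ k < f, g k ≤ n) {k : ℕ} (hk : k < f) 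
    {y : Fin n} (hy : (PP n g k y : ℕ) + 1 = g k) : (PP n g f y : ℕ) = k := by
  suffices ∀ m, k < m → m ≤ f → (PP n g m y : ℕ) = k from this f hk le_rfl
  intro m hm
  induction m, hm using Nat.le_induction with
  | base => 
    intro _
    have a1 := h1 k hk
    have a2 := h2 k hk
    show ((sIJ n (k+1) (g k) * PP n g k) y : ℕ) = k
    rw [sIJ_KK a1, Perm.mul_apply]
    have := (KK_facts (n := n) (g k - (k+1)) (k+1) (by omega) (by omega)).1 (PP n g k y) (by omega)
    omega
  | succ m hm ih =>
    intro hmf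
    have ih := ih (by omega)
    have a1 := h1 m (by omega)
    have a2 := h2 m (by omega)
    show ((sIJ n (m+1) (g m) * PP n g m) y : ℕ) = k
    rw [sIJ_KK a1, Perm.mul_apply, (KK_facts (n := n) (g m - (m+1)) (m+1) (by omega) (by omega)).2.1 _ (by omega), ih]

/-- recovering the parameters -/
theorem PP_rec {g g' : ℕ → ℕ} {f : ℕ} (h1 : ∀ k < f, k + 1 ≤ g k) (h2 : ∀ k < f, g k ≤ n) (h1' : ∀ k < f, k + 1 ≤ g' k) (h2' : ∀ k < f, g' k ≤ n)
    (H : ∀ y : Fin n, ∀ k < f, (PP n g f y : ℕ) = k → (PP n g' f y : ℕ) = k) : ∀ k < f, g k = g' k := by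
  intro k
  induction k using Nat.strong_induction_on with
  | _ k ih =>
    intro hk
    have e : ∀ m ≤ k, PP n g m = PP n g' m := by
      intro m hm
      induction m with
      | zero => rfl
      | succ m ihm => 
        show sIJ n (m+1) (g m) * PP n g m = sIJ n (m+1) (g' m) * PP n g' m
        rw [ihm (by omega), ih m (by omega) (by omega)]
    have a1 := h1 k hk
    have a2 := h2 k hk
    have a1' := h1' k hk
    have a2' := h2' k hk
    let y := (PP n g k).symm ⟨g k - 1, by omega⟩
    have hy : (PP n g k y : ℕ) + 1 = g k := by simp [y]; omega
    let y' := (PP n g' k).symm ⟨g' k - 1, by omega⟩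
    have hy' : (PP n g' k y' : ℕ) + 1 = g' k := by simp [y']; omega
    have b1 := H y k hk (PP_step h1 h2 hk hy)
    have b2 := PP_step h1' h2' hk hy'
    have : y = y' := (PP n g' f).injective (Fin.ext (b1.trans b2.symm))
    rw [← hy, ← hy', this, e k le_rfl]

theorem PP_mono {g : ℕ → ℕ} {f : ℕ} (h1 : ∀ k < f, k + 1 ≤ g k) (h2 : ∀ k < f, g k ≤ n) (hg : ∀ k l, k < l → l < f → g k < g l)
    {k : ℕ} (hk : k < f) (y : Fin n) (hy : (y:ℕ) + 1 = g k) : (PP n g f y : ℕ) = k := by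
  refine PP_step h1 h2 hk ?_
  suffices ∀ m ≤ k, PP n g m y = y by rw [this k le_rfl, hy]
  intro m hm
  induction m with
  | zero => rfl
  | succ m ih =>
    have a1 := h1 m (by omega)
    have a2 := h2 m (by omega)
    have := hg m k (by omega) hk
    show (sIJ n (m+1) (g m) * PP n g m) y = y
    rw [Perm.mul_apply, ih (by omega), sIJ_KK a1]
    exact (KK_facts (n := n) (g m - (m+1)) (m+1) (by omega) (by omega)).2.2 _ (by omega)

end

section
variable {r t f : ℕ}

theorem DElt_lb (d : DElt r t f) (k : Fin f) : (k:ℕ) + 1 ≤ d.a k := by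
  have : ∀ k : ℕ, ∀ h : k < f, k + 1 ≤ d.a ⟨k, h⟩ := by
    intro k
    induction k with
    | zero => intro h; exact d.ha_lb _
    | succ k ih => 
      intro h
      have := ih (by omega)
      have h2 := d.ha_mono (a := ⟨k, by omega⟩) (b := ⟨k+1, h⟩) (by simp)
      omega
  exact this k k.2

theorem pr_apply (d : DElt r t f) (k : Fin f) (y : Fin r) (hy : (y:ℕ) + 1 = d.a k) : (d.pr y : ℕ) = k := by
  rw [DElt.pr, PP_fin]
  refine PP_mono ?_ ?_ ?_ k.2 y ?_
  · intro l hl; simp only [hl, dif_pos]; exact DElt_lb d ⟨l, hl⟩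
  · intro l hl; simp only [hl, dif_pos]; exact d.ha_ub ⟨l, hl⟩
  · intro l l' h hl; 
    have hl2 : l < f := by omega
    simp only [hl, hl2, dif_pos]; exact d.ha_mono (by simpa using h)
  · simpa using hy

theorem pr_iff (d : DElt r t f) (y : Fin r) : (d.pr y : ℕ) < f ↔ ∃ k, (y:ℕ) + 1 = d.a k := by
  constructor
  · intro h
    refine ⟨⟨d.pr y, h⟩, ?_⟩
    have h1 := d.ha_lb ⟨d.pr y, h⟩
    have h2 := d.ha_ub ⟨d.pr y, h⟩
    have := pr_apply d ⟨d.pr y, h⟩ ⟨d.a ⟨d.pr y, h⟩ - 1, by omega⟩ (by simp; omega)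
    have h3 := d.pr.injective (Fin.ext this)
    have h4 := congrArg Fin.val h3
    simp only at h4
    omega
  · rintro ⟨k, hk⟩
    rw [pr_apply d k y hk]; exact k.2

/-- the set of `y` with `pr y < f` determines `f` and the parameters `a` -/
theorem a_det {f' : ℕ} (d : DElt r t f) (d' : DElt r t f') (H : ∀ y : Fin r, (d.pr y : ℕ) < f ↔ (d'.pr y : ℕ) < f') :
    ∃ h : f = f', ∀ k, d.a k = d'.a (Fin.cast h k) := by
  have hr : Set.range d.a = Set.range d'.a := by
    ext z
    constructor
    · rintro ⟨k, rfl⟩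
      have h1 := d.ha_lb k
      have h2 := d.ha_ub k
      obtain ⟨k', hk'⟩ := (pr_iff d' ⟨d.a k - 1, by omega⟩).1 ((H _).1 ((pr_iff d _).2 ⟨k, by simp; omega⟩))
      exact ⟨k', by simp at hk'; omega⟩
    · rintro ⟨k, rfl⟩
      have h1 := d'.ha_lb k
      have h2 := d'.ha_ub k
      obtain ⟨k', hk'⟩ := (pr_iff d ⟨d'.a k - 1, by omega⟩).1 ((H _).2 ((pr_iff d' _).2 ⟨k, by simp; omega⟩))
      exact ⟨k', by simp at hk'; omega⟩
  have hf : f = f' := by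
    have h1 := Set.ncard_range_of_injective d.ha_mono.injective
    have h2 := Set.ncard_range_of_injective d'.ha_mono.injective
    rw [hr] at h1
    simpa using h1.symm.trans h2
  subst hf
  refine ⟨rfl, fun k => ?_⟩
  have := (StrictMono.range_inj d.ha_mono d'.ha_mono).1 hr
  rw [this]; rfl

theorem pr_det {d d' : DElt r t f} (h : d.a = d'.a) : d.pr = d'.pr := by rw [DElt.pr, DElt.pr, h]

theorem b_det {d d' : DElt r t f} (H : ∀ y : Fin t, (d.pt y : ℕ) < f → d'.pt y = d.pt y) : d.b = d'.b := by
  funext k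
  have := PP_rec (n := t) (g := fun k => if h : k < f then d.b ⟨k, h⟩ else 0) (g' := fun k => if h : k < f then d'.b ⟨k, h⟩ else 0) (f := f)
    (by intro l hl; simp only [hl, dif_pos]; exact d.hb_lb ⟨l, hl⟩) (by intro l hl; simp only [hl, dif_pos]; exact d.hb_ub ⟨l, hl⟩)
    (by intro l hl; simp only [hl, dif_pos]; exact d'.hb_lb ⟨l, hl⟩) (by intro l hl; simp only [hl, dif_pos]; exact d'.hb_ub ⟨l, hl⟩)
    (by 
      intro y k hk h
      rw [← PP_fin] at h ⊢
      have := H y (by rw [DElt.pt, h]; exact hk)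
      rw [← h]
      exact congrArg Fin.val this) k k.2
  simpa using this

theorem DElt_ext {d d' : DElt r t f} (h : d.a = d'.a) (h' : d.b = d'.b) : d = d' := by
  cases d; cases d'; simp only at h h'; subst h; subst h'; rfl

end
end

section
section
variable {r t : ℕ}

theorem p_ai {α : Type} (w : Perm α) (i : α) : w (w⁻¹ i) = i := Equiv.apply_symm_apply w i
theorem p_ia {α : Type} (w : Perm α) (i : α) : w⁻¹ (w i) = i := Equiv.symm_apply_apply w i

theorem fix_lt {n f : ℕ} {w : Perm (Fin n)} (hw : ∀ i : Fin n, (i:ℕ) < f → w i = i) (i : Fin n) : (w i : ℕ) < f ↔ (i:ℕ) < f := by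
  constructor
  · intro h
    have := w.injective (hw _ h)
    rwa [this] at h
  · intro h; rwa [hw _ h]

theorem hf2 (x : L2Index r t) : x.f ≤ r ∧ x.f ≤ t := ⟨x.hf.trans (min_le_left _ _), x.hf.trans (min_le_right _ _)⟩

theorem vv_lt (x : L2Index r t) (j : Fin t) (h : (j:ℕ) < x.f) : vv x j = x.d2.pt⁻¹ j := by
  rw [vv, Perm.mul_apply]
  congr 1
  rw [Perm.inv_eq_iff_eq, x.hwb _ h]

theorem Px_inl_lt (x : L2Index r t) (i : Fin r) (j : Fin t) (hij : (i:ℕ) = j) (h : (i:ℕ) < x.f) :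
    Px x (Sum.inl (x.d2.pr⁻¹ i)) = Sum.inr (x.d2.pt⁻¹ j) := by
  simp only [Px, Perm.mul_apply, pl_inl, pb_inl, p_ai, x.hw _ h, QQ_inl _ _ (hf2 x), dif_pos h, pl_inr]
  rw [← vv_lt x j (hij ▸ h)]
  congr 2; exact Fin.ext hij

theorem Px_inl_ge (x : L2Index r t) (i : Fin r) (h : ¬ (i:ℕ) < x.f) :
    Px x (Sum.inl (x.d2.pr⁻¹ i)) = Sum.inl (x.d1.pr⁻¹ (x.w i)) := by
  have h' : ¬ (x.w i : ℕ) < x.f := by rwa [fix_lt x.hw]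
  simp only [Px, Perm.mul_apply, pl_inl, pb_inl, p_ai, QQ_inl _ _ (hf2 x), dif_neg h', pl_inr]

theorem Px_inr_lt (x : L2Index r t) (i : Fin r) (j : Fin t) (hij : (i:ℕ) = j) (h : (j:ℕ) < x.f) :
    Px x (Sum.inr (x.d1.pt⁻¹ j)) = Sum.inl (x.d1.pr⁻¹ i) := by
  simp only [Px, Perm.mul_apply, pl_inl, pb_inr, pl_inr, p_ai, QQ_inr _ _ (hf2 x), dif_pos h]
  congr 2; exact Fin.ext hij.symm

theorem Px_inr_ge (x : L2Index r t) (j : Fin t) (h : ¬ (j:ℕ) < x.f) :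
    Px x (Sum.inr (x.d1.pt⁻¹ j)) = Sum.inr (vv x j) := by
  simp only [Px, Perm.mul_apply, pl_inl, pb_inr, pl_inr, p_ai, QQ_inr _ _ (hf2 x), dif_neg h]

theorem Px_A (x : L2Index r t) (a : Fin r) : (x.d2.pr a : ℕ) < x.f ↔ ∃ b, Px x (Sum.inl a) = Sum.inr b := by
  constructor
  · intro h
    have := Px_inl_lt x (x.d2.pr a) ⟨x.d2.pr a, h.trans_le (hf2 x).2⟩ rfl h
    rw [p_ia] at this
    exact ⟨_, this⟩
  · rintro ⟨b, hb⟩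
    by_contra h
    have := Px_inl_ge x (x.d2.pr a) h
    rw [p_ia, hb] at this
    simp at this

theorem Px_B (x : L2Index r t) (a : Fin r) : (x.d1.pr a : ℕ) < x.f ↔ ∃ b, Px x (Sum.inr b) = Sum.inl a := by
  constructor
  · intro h
    have := Px_inr_lt x (x.d1.pr a) ⟨x.d1.pr a, h.trans_le (hf2 x).2⟩ rfl h
    rw [p_ia] at this
    exact ⟨_, this⟩
  · rintro ⟨b, hb⟩
    by_cases h : (x.d1.pt b : ℕ) < x.f
    · have := Px_inr_lt x ⟨x.d1.pt b, h.trans_le (hf2 x).1⟩ (x.d1.pt b) rfl h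
      rw [p_ia, hb] at this
      have e := Sum.inl.inj this
      rw [e, p_ai]; exact h
    · have := Px_inr_ge x (x.d1.pt b) h
      rw [p_ia, hb] at this
      simp at this

theorem mem_Sx_inl (x : L2Index r t) (β : Fin r → Fin 2) (βb : Fin t → Fin 2) (i : Fin r) :
    Sum.inl (x.d1.pr⁻¹ i) ∈ Sx x β βb ↔ β i = 1 := by
  simp [Sx]
theorem mem_Sx_inr (x : L2Index r t) (β : Fin r → Fin 2) (βb : Fin t → Fin 2) (j : Fin t) :
    Sum.inr (vv x j) ∈ Sx x β βb ↔ βb j = 1 := by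
  simp [Sx]

theorem Sx_nodup (x : L2Index r t) (β : Fin r → Fin 2) (βb : Fin t → Fin 2) : (Sx x β βb).Nodup := by
  unfold Sx
  refine List.Nodup.append ?_ ?_ ?_
  · refine List.Nodup.map ?_ ((List.nodup_finRange r).filter _)
    intro a b h; simpa using h
  · refine List.Nodup.map ?_ ((List.nodup_finRange t).filter _)
    intro a b h; simpa using h
  · intro z h1 h2
    simp only [List.mem_map] at h1 h2
    obtain ⟨a, _, rfl⟩ := h1
    obtain ⟨b, _, hb⟩ := h2
    simp at hb

theorem fin2_ext {ι : Type} {β β' : ι → Fin 2} (h : ∀ i, β i = 1 ↔ β' i = 1) : β = β' := by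
  funext i
  have := h i
  revert this
  generalize β i = a
  generalize β' i = b
  revert a b
  decide

theorem Sx_det (x y : L2Index r t) (hd : x.d1.pr = y.d1.pr) (hv : vv x = vv y) {β β' : Fin r → Fin 2} {βb βb' : Fin t → Fin 2}
    (h : (Sx x β βb).toFinset = (Sx y β' βb').toFinset) : β = β' ∧ βb = βb' := by
  have H : ∀ z, z ∈ Sx x β βb ↔ z ∈ Sx y β' βb' := fun z => by
    rw [← List.mem_toFinset, h, List.mem_toFinset]
  constructor
  · refine fin2_ext fun i => ?_
    rw [← mem_Sx_inl x β βb, H, hd, mem_Sx_inl]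
  · refine fin2_ext fun j => ?_
    rw [← mem_Sx_inr x β βb, H, hv, mem_Sx_inr]

def key (x : L2Index r t) : Finset (Fin r ⊕ Fin t) × Finset (Fin r ⊕ Fin t) × Perm (Fin r ⊕ Fin t) :=
  ((Sx x x.βx x.βxb).toFinset, (Sx x x.α x.αb).toFinset, Px x)

theorem key_inj : Function.Injective (key : L2Index r t → _) := by
  intro x y h
  simp only [key, Prod.mk.injEq] at h
  obtain ⟨hS, hT, hP⟩ := h
  have HA : ∀ a, (x.d2.pr a : ℕ) < x.f ↔ (y.d2.pr a : ℕ) < y.f := fun a => by rw [Px_A, Px_A, hP]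
  have HB : ∀ a, (x.d1.pr a : ℕ) < x.f ↔ (y.d1.pr a : ℕ) < y.f := fun a => by rw [Px_B, Px_B, hP]
  obtain ⟨hf, ha2⟩ := a_det _ _ HA
  obtain ⟨_, ha1⟩ := a_det _ _ HB
  obtain ⟨α, βx, αb, βxb, f, hff, d1, d2, w, wb, hw, hwb⟩ := x
  obtain ⟨α', βx', αb', βxb', f', hff', d1', d2', w', wb', hw', hwb'⟩ := y
  simp only at hf
  subst hf
  have ea2 : d2.a = d2'.a := funext ha2
  have ea1 : d1.a = d1'.a := funext ha1
  have ep2 := pr_det ea2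
  have ep1 := pr_det ea1
  have hft := hff.trans (min_le_right _ _)
  have hfr := hff.trans (min_le_left _ _)
  have ed2 : d2 = d2' := by
    refine DElt_ext ea2 (b_det fun y hy => ?_)
    have h1 := Px_inl_lt ⟨α, βx, αb, βxb, f, hff, d1, d2, w, wb, hw, hwb⟩ ⟨d2.pt y, hy.trans_le hfr⟩ (d2.pt y) rfl hy
    have h2 := Px_inl_lt ⟨α', βx', αb', βxb', f, hff', d1', d2', w', wb', hw', hwb'⟩ ⟨d2.pt y, hy.trans_le hfr⟩ (d2.pt y) rfl hy
    rw [← hP] at h2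
    simp only [← ep2] at h1 h2
    rw [h1] at h2
    have := Sum.inr.inj h2
    rw [p_ia, eq_comm, Perm.inv_eq_iff_eq] at this
    exact this.symm
  subst ed2
  have ed1 : d1 = d1' := by
    refine DElt_ext ea1 (b_det fun y hy => ?_)
    have h1 := Px_inr_lt ⟨α, βx, αb, βxb, f, hff, d1, d2, w, wb, hw, hwb⟩ ⟨d1.pt y, hy.trans_le hfr⟩ (d1.pt y) rfl hy
    have h2 := Px_inr_lt ⟨α', βx', αb', βxb', f, hff', d1', d2, w', wb', hw', hwb'⟩ ⟨d1.pt y, hy.trans_le hfr⟩ (d1.pt y) rfl hy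
    rw [← hP] at h2
    simp only [← ep1] at h1 h2
    rw [← h1] at h2
    have := Sum.inr.inj ((Px _).injective h2)
    rw [p_ia, Perm.inv_eq_iff_eq] at this
    exact this.symm
  subst ed1
  have ew : w = w' := by
    ext1 i
    by_cases hi : (i:ℕ) < f
    · rw [hw i hi, hw' i hi]
    · have h1 := Px_inl_ge ⟨α, βx, αb, βxb, f, hff, d1, d2, w, wb, hw, hwb⟩ i hi
      have h2 := Px_inl_ge ⟨α', βx', αb', βxb', f, hff', d1, d2, w', wb', hw', hwb'⟩ i hi
      rw [← hP] at h2
      simp only at h1 h2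
      rw [h1] at h2
      exact d1.pr⁻¹.injective (Sum.inl.inj h2)
  have ev : vv ⟨α, βx, αb, βxb, f, hff, d1, d2, w, wb, hw, hwb⟩ = vv ⟨α', βx', αb', βxb', f, hff', d1, d2, w', wb', hw', hwb'⟩ := by
    ext1 j
    by_cases hj : (j:ℕ) < f
    · rw [vv_lt _ j hj, vv_lt _ j hj]
    · have h1 := Px_inr_ge ⟨α, βx, αb, βxb, f, hff, d1, d2, w, wb, hw, hwb⟩ j hj
      have h2 := Px_inr_ge ⟨α', βx', αb', βxb', f, hff', d1, d2, w', wb', hw', hwb'⟩ j hj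
      rw [← hP] at h2
      simp only at h1 h2
      rw [h1] at h2
      exact Sum.inr.inj h2
  obtain ⟨e1, e2⟩ := Sx_det _ _ (by rfl) ev hS
  obtain ⟨e3, e4⟩ := Sx_det _ _ (by rfl) ev hT
  have ewb : wb = wb' := by
    simp only [vv] at ev
    exact inv_injective (mul_left_cancel ev)
  simp only at e1 e2 e3 e4
  subst e1 e2 e3 e4 ew ewb
  rfl
end

section
variable {u : ℂ} {α : Type} [DecidableEq α]

theorem Lead_mon {z : U u α} {l l' : List α} {w : Perm α} (h : Lead z l l' w) (hl : l.Nodup) (hl' : l'.Nodup) :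
    ∃ y, Pm y (mon u (l.toFinset, l'.toFinset, w)) ∧ z - y ∈ F u α l.toFinset.card := by
  have p1 : l.Perm l.toFinset.toList := by
    refine (List.perm_ext_iff_of_nodup hl (Finset.nodup_toList _)).2 fun a => ?_
    simp
  have p2 : l'.Perm l'.toFinset.toList := by
    refine (List.perm_ext_iff_of_nodup hl' (Finset.nodup_toList _)).2 fun a => ?_
    simp
  have := (h.perm_x p1).perm_c p2
  obtain ⟨y, h1, h2⟩ := this
  rw [Finset.length_toList] at h2
  exact ⟨y, h1, h2⟩

theorem li_of_lead [Fintype α] {ι : Type} (g : ι → U u α) (k : ι → Finset α × Finset α × Perm α) (hk : Function.Injective k)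
    (H : ∀ i, ∃ y, Pm y (mon u (k i)) ∧ g i - y ∈ F u α (k i).1.card) : LinearIndependent ℂ g := by
  classical
  let b := Module.Basis.mk (mon_li (u := u) (α := α)) mon_span
  have bz : ∀ z, b z = mon u z := fun z => by simp [b]
  have hF : ∀ (n : ℕ) (a : U u α), a ∈ F u α n → ∀ z : Finset α × Finset α × Perm α, n ≤ z.1.card → b.repr a z = 0 := by
    intro n a ha z hz
    have := F_mon n ha
    refine Submodule.span_induction (p := fun a _ => b.repr a z = 0) ?_ (by simp) ?_ ?_ this
    · rintro _ ⟨z', hz', rfl⟩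
      rw [← bz, Module.Basis.repr_self, Finsupp.single_apply, if_neg]
      rintro rfl
      exact absurd hz' (by simpa using hz)
    · intro x y _ _ hx hy; simp [hx, hy]
    · intro c x _ hx; simp [hx]
  have hg : ∀ i z, (k i).1.card ≤ z.1.card → z ≠ k i → b.repr (g i) z = 0 := by
    intro i z h1 h2
    obtain ⟨y, hy, hy'⟩ := H i
    have e := hF _ _ hy' z h1
    rw [map_sub, Finsupp.sub_apply, sub_eq_zero] at e
    rw [e]
    rcases hy with rfl | rfl
    · rw [← bz, Module.Basis.repr_self, Finsupp.single_apply, if_neg h2.symm]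
    · rw [map_neg, ← bz, Module.Basis.repr_self, Finsupp.neg_apply, Finsupp.single_apply, if_neg h2.symm, neg_zero]
  have hg' : ∀ i, b.repr (g i) (k i) ≠ 0 := by
    intro i
    obtain ⟨y, hy, hy'⟩ := H i
    have e := hF _ _ hy' (k i) le_rfl
    rw [map_sub, Finsupp.sub_apply, sub_eq_zero] at e
    rw [e]
    rcases hy with rfl | rfl
    · rw [← bz, Module.Basis.repr_self, Finsupp.single_apply, if_pos rfl]; exact one_ne_zero
    · rw [map_neg, ← bz, Module.Basis.repr_self, Finsupp.neg_apply, Finsupp.single_apply, if_pos rfl]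
      exact neg_ne_zero.2 one_ne_zero
  rw [linearIndependent_iff]
  intro c hc
  by_contra hne
  obtain ⟨i, hi, hmax⟩ := Finset.exists_max_image c.support (fun i => (k i).1.card) (Finsupp.support_nonempty_iff.2 hne)
  have e : b.repr (Finsupp.linearCombination ℂ g c) (k i) = 0 := by rw [hc]; simp
  rw [Finsupp.linearCombination_apply, Finsupp.sum, map_sum, Finsupp.finsetSum_apply, Finset.sum_eq_single i] at e
  · rw [map_smul, Finsupp.smul_apply, smul_eq_mul] at e
    exact (mul_ne_zero (Finsupp.mem_support_iff.1 hi) (hg' i)) e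
  · intro j hj hji
    rw [map_smul, Finsupp.smul_apply, hg j (k i) (hmax j hj) (fun h => hji (hk h.symm)), smul_zero]
  · intro h; exact absurd hi h
end

section
variable {A B : Type} [Ring A] [Algebra ℂ A] [Ring B] [Algebra ℂ B] {r t : ℕ} {ω : ℂ}

theorem hom_l2 {d : AWBC ℂ A r t ω} {d' : AWBC ℂ B r t ω} {φ : A →ₐ[ℂ] B} (h : AWBCHom d d' φ) (x : L2Index r t) :
    φ (d.l2Elt x) = d'.l2Elt x := by
  simp only [AWBC.l2Elt, WBC.cpow, WBC.cbpow, WBC.epow, WBC.E, WBC.tr, WBC.trb, AWBC.xp, AWBC.xbp, WBC.s, WBC.sb,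
    map_mul, map_list_prod, List.map_map, Function.comp_def, map_pow, h.map_σ, h.map_σb, h.map_c, h.map_cb, h.map_e,
    h.map_x1, h.map_xb1]
end

theorem main (A : Type) [Ring A] [Algebra ℂ A]
    (r t m : ℕ) (hr : 1 ≤ r) (ht : 1 ≤ t) (p : ℂ) (d : AWBC ℂ A r t (omSeq m p 1))
    (hu : d.IsCycUniversal (omSeq m p)
      (Polynomial.X ^ 2 - Polynomial.C (p * (p + 1)))
      (Polynomial.X ^ 2 - Polynomial.C ((p - 2 * (m : ℂ) + 1) * (p - 2 * (m : ℂ))))) :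
    LinearIndependent ℂ (fun x : L2Index r t => d.l2Elt x) := by
  obtain ⟨φ, hφ, _⟩ := hu.2.2 _ (repF m p r t hr ht) (repF_spec m p r t hr ht) (repF_cyc m p r t hr ht)
  refine LinearIndependent.of_comp ((LinearMap.applyₗ (1 : U (p*(p+1)) (Fin r ⊕ Fin t))).comp φ.toLinearMap) ?_
  refine li_of_lead _ key key_inj fun x => ?_
  have := Lead_mon (Lead_l2 m p r t hr ht x) (Sx_nodup _ _ _) (Sx_nodup _ _ _)
  simpa [hom_l2 hφ, key] using this
end

end L2

/-- Theorem 4.7: in the level two walled Brauer–Clifford superalgebra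
`BC_{2,r,t}` over `ℂ` (with the parameters of (4.16)), the monomials
`d_1^{-1} c^α x'^β e^f x̄'^{β̄} c̄^{ᾱ} w d_2` are `ℂ`-linearly independent. -/
theorem statement11 (A : Type) [Ring A] [Algebra ℂ A]
    (r t m : ℕ) (hr : 1 ≤ r) (ht : 1 ≤ t) (hm : 2 * (r + t) ≤ m)
    (p : ℂ)
    (hp : (∀ z : ℤ, p ≠ (z : ℂ)) ∨ (∃ z : ℤ, p = (z : ℂ) ∧ ((2 * (m : ℤ) < z) ∨ z < 0)))
    (d : AWBC ℂ A r t (omSeq m p 1))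
    (hu : d.IsCycUniversal (omSeq m p)
      (Polynomial.X ^ 2 - Polynomial.C (p * (p + 1)))
      (Polynomial.X ^ 2 - Polynomial.C ((p - 2 * (m : ℂ) + 1) * (p - 2 * (m : ℂ))))) :
    LinearIndependent ℂ (fun x : L2Index r t => d.l2Elt x) := by
  exact L2.main A r t m hr ht p d hu
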